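/- arXiv:1807.08886 — 4 statements merged into one kernel-verified Lean document; each statement's English description precedes it below -/
import Mathlib

section
/- For every constant c > 0 there exists a constant α > 0 such that the following holds for every n ≥ 2. Let G be an n-vertex simple graph with maximum degree Δ. Suppose each vertex v of G independently samples a list L(v) consisting of ⌈α·log n⌉ colors, each drawn independently and uniformly at random from {1, …, Δ+1}. Then with probability at least 1 − n^{−c}, there exists a proper coloring C of G with colors from {1, …, Δ+1} such that C(v) ∈ L(v) for every vertex v. -/
set_option linter.unusedSectionVars false

namespace PaletteSparsification

open Finset

section Averages

/-- The average of a real function over a finite type. -/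
noncomputable def avg {Ω : Type*} [Fintype Ω] (f : Ω → ℝ) : ℝ :=
  (∑ x, f x) / Fintype.card Ω

open Classical in
/-- The probability of an event under the uniform distribution on a finite type. -/
noncomputable def pr {Ω : Type*} [Fintype Ω] (p : Ω → Prop) : ℝ :=
  avg fun x => if p x then 1 else 0

variable {Ω Ω' : Type*} [Fintype Ω] [Fintype Ω']

lemma avg_mono {f g : Ω → ℝ} (h : ∀ x, f x ≤ g x) : avg f ≤ avg g := by
  unfold avg
  gcongr with x
  exact h x

lemma avg_const [Nonempty Ω] (c : ℝ) : avg (fun _ : Ω => c) = c := by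
  simp [avg]

lemma avg_nonneg {f : Ω → ℝ} (h : ∀ x, 0 ≤ f x) : 0 ≤ avg f :=
  div_nonneg (Finset.sum_nonneg fun x _ => h x) (Nat.cast_nonneg _)

lemma avg_add (f g : Ω → ℝ) : avg (fun x => f x + g x) = avg f + avg g := by
  simp [avg, Finset.sum_add_distrib, add_div]

lemma avg_mul_left (c : ℝ) (f : Ω → ℝ) : avg (fun x => c * f x) = c * avg f := by
  simp [avg, ← Finset.mul_sum, mul_div_assoc]

lemma avg_mul_right (c : ℝ) (f : Ω → ℝ) : avg (fun x => f x * c) = avg f * c := by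
  simp only [mul_comm _ c, avg_mul_left]

lemma avg_sum {ι : Type*} (s : Finset ι) (f : ι → Ω → ℝ) :
    avg (fun x => ∑ i ∈ s, f i x) = ∑ i ∈ s, avg (f i) := by
  simp only [avg]
  rw [Finset.sum_comm, Finset.sum_div]

lemma avg_equiv (e : Ω ≃ Ω') (f : Ω' → ℝ) : avg (fun x => f (e x)) = avg f := by
  simp only [avg, Fintype.card_congr e]
  rw [e.sum_comp]

lemma avg_prod (f : Ω × Ω' → ℝ) : avg f = avg fun x => avg fun y => f (x, y) := by
  simp only [avg, Fintype.card_prod, Nat.cast_mul, Fintype.sum_prod_type]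
  rw [← Finset.sum_div, div_div, mul_comm]

lemma avg_prod_swap (f : Ω × Ω' → ℝ) : avg f = avg fun y => avg fun x => f (x, y) := by
  rw [← avg_equiv (Equiv.prodComm Ω' Ω), avg_prod]
  rfl

lemma avg_fst [Nonempty Ω'] (f : Ω → ℝ) : avg (fun z : Ω × Ω' => f z.1) = avg f := by
  rw [avg_prod]
  simp only [avg_const]

section Pi

variable {ι : Type*} [Fintype ι] [DecidableEq ι]

lemma avg_piecewise (s : Finset ι) (f : (ι → Ω) → ℝ) [Nonempty Ω] :
    avg f = avg fun Y : ι → Ω => avg fun X : ι → Ω => f (s.piecewise X Y) := by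
  rw [← avg_prod_swap (fun z : (ι → Ω) × (ι → Ω) => f (s.piecewise z.1 z.2))]
  let e : (ι → Ω) × (ι → Ω) ≃ (ι → Ω) × (ι → Ω) :=
    { toFun := fun z => (s.piecewise z.1 z.2, s.piecewise z.2 z.1)
      invFun := fun z => (s.piecewise z.1 z.2, s.piecewise z.2 z.1)
      left_inv := fun z => by
        ext i <;> by_cases h : i ∈ s <;> simp [h]
      right_inv := fun z => by
        ext i <;> by_cases h : i ∈ s <;> simp [h] }
  rw [← avg_fst (Ω' := ι → Ω) f, ← avg_equiv e]
  rfl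

lemma avg_update (i : ι) (f : (ι → Ω) → ℝ) [Nonempty Ω] :
    avg f = avg fun Y : ι → Ω => avg fun x : Ω => f (Function.update Y i x) := by
  rw [← avg_prod (fun z : (ι → Ω) × Ω => f (Function.update z.1 i z.2))]
  let e : (ι → Ω) × Ω ≃ (ι → Ω) × Ω :=
    { toFun := fun z => (Function.update z.1 i z.2, z.1 i)
      invFun := fun z => (Function.update z.1 i z.2, z.1 i)
      left_inv := fun z => by simp
      right_inv := fun z => by simp }
  rw [← avg_fst (Ω' := Ω) f, ← avg_equiv e]
  rfl

lemma avg_eval (i : ι) (f : Ω → ℝ) [Nonempty Ω] : avg (fun X : ι → Ω => f (X i)) = avg f := by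
  rw [avg_update i]
  simp [avg_const]

lemma avg_pi_prod (g : ι → Ω → ℝ) :
    avg (fun X : ι → Ω => ∏ i, g i (X i)) = ∏ i, avg (g i) := by
  simp only [avg, Fintype.card_pi, Finset.prod_div_distrib, Nat.cast_prod]
  rw [Finset.prod_univ_sum, Fintype.piFinset_univ]

lemma avg_pi_prod_finset [Nonempty Ω] (s : Finset ι) (g : ι → Ω → ℝ) :
    avg (fun X : ι → Ω => ∏ i ∈ s, g i (X i)) = ∏ i ∈ s, avg (g i) := by
  have h := avg_pi_prod (fun i x => if i ∈ s then g i x else 1)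
  have h2 : ∀ i, avg (fun x => if i ∈ s then g i x else 1) = if i ∈ s then avg (g i) else 1 := by
    intro i
    by_cases hi : i ∈ s <;> simp [hi, avg_const]
  simp only [h2] at h
  simpa [Finset.prod_ite_mem] using h

end Pi

lemma pr_nonneg (p : Ω → Prop) : 0 ≤ pr p :=
  avg_nonneg fun x => by split_ifs <;> norm_num

lemma pr_mono {p q : Ω → Prop} (h : ∀ x, p x → q x) : pr p ≤ pr q := by
  refine avg_mono fun x => ?_
  by_cases hp : p x
  · simp [hp, h x hp]
  · simp only [hp, if_false]
    split_ifs <;> norm_num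

lemma pr_congr {p q : Ω → Prop} (h : ∀ x, p x ↔ q x) : pr p = pr q :=
  le_antisymm (pr_mono fun x => (h x).1) (pr_mono fun x => (h x).2)

lemma pr_false {p : Ω → Prop} (h : ∀ x, ¬ p x) : pr p = 0 := by
  simp [pr, avg, h]

lemma pr_true [Nonempty Ω] {p : Ω → Prop} (h : ∀ x, p x) : pr p = 1 := by
  simp [pr, avg_const, h]

lemma pr_le_one [Nonempty Ω] (p : Ω → Prop) : pr p ≤ 1 :=
  (pr_mono (q := fun _ => True) fun _ _ => trivial).trans (pr_true fun _ => trivial).le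

lemma pr_or_le (p q : Ω → Prop) : pr (fun x => p x ∨ q x) ≤ pr p + pr q := by
  unfold pr
  rw [← avg_add]
  refine avg_mono fun x => ?_
  by_cases hp : p x <;> by_cases hq : q x <;> simp [hp, hq]

lemma pr_exists_le {ι : Type*} (s : Finset ι) (p : ι → Ω → Prop) :
    pr (fun x => ∃ i ∈ s, p i x) ≤ ∑ i ∈ s, pr (p i) := by
  classical
  induction s using Finset.induction_on with
  | empty => simp [pr_false]
  | insert a s ha ih =>
    rw [Finset.sum_insert ha]
    refine le_trans (pr_mono (q := fun x => p a x ∨ ∃ i ∈ s, p i x) ?_)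
      ((pr_or_le _ _).trans (by gcongr))
    intro x
    simp

lemma pr_split (p q : Ω → Prop) :
    pr q = pr (fun x => p x ∧ q x) + pr (fun x => ¬ p x ∧ q x) := by
  unfold pr
  rw [← avg_add]
  congr 1
  ext x
  by_cases hp : p x <;> by_cases hq : q x <;> simp [hp, hq]

lemma pr_not [Nonempty Ω] (p : Ω → Prop) : pr (fun x => ¬ p x) = 1 - pr p := by
  have h := pr_split p (fun _ : Ω => True)
  rw [pr_true (fun _ => trivial)] at h
  simp only [and_true] at h
  linarith

lemma pr_equiv (e : Ω ≃ Ω') (p : Ω' → Prop) : pr (fun x => p (e x)) = pr p := by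
  classical exact avg_equiv e fun y => if p y then 1 else 0

lemma pr_eq_card (p : Ω → Prop) : pr p = (Nat.card {x // p x} : ℝ) / Nat.card Ω := by
  classical
  simp only [pr, avg, Nat.card_eq_fintype_card, Fintype.card_subtype]
  congr 1
  rw [Finset.sum_boole]

lemma pr_mem [DecidableEq Ω] (s : Finset Ω) :
    pr (fun x => x ∈ s) = (s.card : ℝ) / Fintype.card Ω := by
  rw [pr_eq_card]
  simp

lemma pr_notMem [Nonempty Ω] [DecidableEq Ω] (s : Finset Ω) :
    pr (fun x => x ∉ s) = 1 - (s.card : ℝ) / Fintype.card Ω := by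
  rw [pr_not, pr_mem]

lemma pr_prod_le {p : Ω × Ω' → Prop} {δ : ℝ} [Nonempty Ω] (h : ∀ x, pr (fun y => p (x, y)) ≤ δ) :
    pr p ≤ δ := by
  unfold pr
  rw [avg_prod]
  exact (avg_mono h).trans (avg_const δ).le

lemma pr_fst [Nonempty Ω'] (p : Ω → Prop) : pr (fun z : Ω × Ω' => p z.1) = pr p := by
  classical exact avg_fst fun x => if p x then 1 else 0

section Pi

variable {ι : Type*} [Fintype ι] [DecidableEq ι]

lemma pr_piecewise_le [Nonempty Ω] (s : Finset ι) {p : (ι → Ω) → Prop} {δ : ℝ}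
    (h : ∀ Y : ι → Ω, pr (fun X : ι → Ω => p (s.piecewise X Y)) ≤ δ) : pr p ≤ δ := by
  unfold pr
  rw [avg_piecewise s]
  exact (avg_mono h).trans (avg_const δ).le

lemma pr_forall_mem [Nonempty Ω] (s : Finset ι) (p : ι → Ω → Prop) :
    pr (fun X : ι → Ω => ∀ i ∈ s, p i (X i)) = ∏ i ∈ s, pr (p i) := by
  classical
  unfold pr
  rw [← avg_pi_prod_finset]
  congr 1
  ext X
  rw [Finset.prod_ite_zero, Finset.prod_const_one]
  congr!

lemma pr_forall [Nonempty Ω] (p : ι → Ω → Prop) :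
    pr (fun X : ι → Ω => ∀ i, p i (X i)) = ∏ i, pr (p i) := by
  rw [← pr_forall_mem]
  simp

lemma pr_eval [Nonempty Ω] (i : ι) (p : Ω → Prop) : pr (fun X : ι → Ω => p (X i)) = pr p := by
  classical exact avg_eval i fun x => if p x then 1 else 0

/-- Events depending on disjoint sets of coordinates are independent. -/
lemma pr_and_of_disjoint_support [Nonempty Ω] (s : Finset ι) {p q : (ι → Ω) → Prop}
    (hp : ∀ X Y, (∀ i ∈ s, X i = Y i) → (p X ↔ p Y))
    (hq : ∀ X Y, (∀ i ∉ s, X i = Y i) → (q X ↔ q Y)) :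
    pr (fun X => p X ∧ q X) = pr p * pr q := by
  classical
  unfold pr
  rw [avg_piecewise s, ← avg_mul_left]
  congr 1
  ext Y
  rw [← avg_mul_right]
  congr 1
  ext X
  beta_reduce
  rw [hp (s.piecewise X Y) X (by simp +contextual),
    hq (s.piecewise X Y) Y (by simp +contextual)]
  by_cases h1 : p X <;> by_cases h2 : q Y <;> simp [h1, h2]

end Pi

end Averages

section LocalLemma

variable {V ι Ω : Type*} [Fintype ι] [DecidableEq ι] [Fintype Ω] [Nonempty Ω]

/-- The key step of the symmetric local lemma: conditionally on avoiding the events indexed by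
`S`, every event has probability at most `2 * p`. -/
lemma pr_and_avoid_le (E : V → (ι → Ω) → Prop) (vbl : V → Finset ι) (p : ℝ) (d : ℕ)
    (hp : 0 ≤ p)
    (hE : ∀ v X Y, (∀ i ∈ vbl v, X i = Y i) → (E v X ↔ E v Y))
    (hpr : ∀ v, pr (E v) ≤ p)
    (hd : ∀ v, ∀ S : Finset V, (∀ u ∈ S, ¬ Disjoint (vbl u) (vbl v)) → S.card ≤ d)
    (hpd : 4 * p * d ≤ 1) (m : ℕ) :
    ∀ S : Finset V, S.card ≤ m → ∀ v,
      pr (fun X => E v X ∧ ∀ u ∈ S, ¬ E u X) ≤ 2 * p * pr (fun X => ∀ u ∈ S, ¬ E u X) := by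
  classical
  induction m with
  | zero =>
    intro S hS v
    obtain rfl : S = ∅ := by simpa using hS
    simp only [notMem_empty, false_imp_iff, implies_true, and_true]
    rw [pr_true fun _ => trivial]
    linarith [hpr v]
  | succ m ih =>
    intro S hS v
    set S₁ := S.filter fun u => ¬ Disjoint (vbl u) (vbl v) with hS₁
    set S₂ := S.filter fun u => Disjoint (vbl u) (vbl v) with hS₂
    have h1 : pr (fun X => E v X ∧ ∀ u ∈ S, ¬ E u X)
        ≤ p * pr (fun X => ∀ u ∈ S₂, ¬ E u X) := by
      calc _ ≤ pr (fun X => E v X ∧ ∀ u ∈ S₂, ¬ E u X) :=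
            pr_mono fun X hX => ⟨hX.1, fun u hu => hX.2 u (mem_of_mem_filter u hu)⟩
        _ = pr (E v) * pr (fun X => ∀ u ∈ S₂, ¬ E u X) := by
            refine pr_and_of_disjoint_support (vbl v) (hE v) fun X Y hXY => ?_
            refine forall₂_congr fun u hu => not_congr (hE u X Y fun i hi => hXY i fun hiv => ?_)
            exact Finset.disjoint_left.1 (Finset.mem_filter.1 hu).2 hi hiv
        _ ≤ _ := by gcongr; exacts [pr_nonneg _, hpr v]
    have h2 : pr (fun X => ∀ u ∈ S₂, ¬ E u X) ≤ pr (fun X => ∀ u ∈ S, ¬ E u X)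
        + ∑ u ∈ S₁, pr (fun X => E u X ∧ ∀ w ∈ S₂, ¬ E w X) := by
      refine le_trans (pr_mono (q := fun X => (∀ u ∈ S, ¬ E u X) ∨
        ∃ u ∈ S₁, E u X ∧ ∀ w ∈ S₂, ¬ E w X) fun X hX => ?_)
        ((pr_or_le _ _).trans (by gcongr; exact pr_exists_le _ _))
      by_cases h : ∃ u ∈ S₁, E u X
      · obtain ⟨u, hu, hE⟩ := h
        exact Or.inr ⟨u, hu, hE, hX⟩
      · push Not at h
        refine Or.inl fun u hu => ?_
        by_cases hdis : Disjoint (vbl u) (vbl v)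
        · exact hX u (by simp [hS₂, hu, hdis])
        · exact h u (by simp [hS₁, hu, hdis])
    have h3 : ∑ u ∈ S₁, pr (fun X => E u X ∧ ∀ w ∈ S₂, ¬ E w X)
        ≤ ∑ u ∈ S₁, 2 * p * pr (fun X => ∀ u ∈ S₂, ¬ E u X) := by
      refine Finset.sum_le_sum fun u hu => ih S₂ ?_ u
      have hlt : S₂.card < S.card := by
        refine Finset.card_lt_card (Finset.filter_ssubset.2 ⟨u, ?_⟩)
        simpa [hS₁] using hu
      omega
    have h4 : (S₁.card : ℝ) ≤ d := by
      exact_mod_cast hd v S₁ fun u hu => (Finset.mem_filter.1 hu).2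
    rw [Finset.sum_const, nsmul_eq_mul] at h3
    have h0 := pr_nonneg fun X : ι → Ω => ∀ u ∈ S₂, ¬ E u X
    set P₂ := pr fun X : ι → Ω => ∀ u ∈ S₂, ¬ E u X
    have h5 : (S₁.card : ℝ) * (2 * p * P₂) ≤ d * (2 * p * P₂) := by gcongr
    have h6 : d * (2 * p * P₂) ≤ P₂ / 2 := by nlinarith
    have h7 : P₂ ≤ 2 * pr (fun X => ∀ u ∈ S, ¬ E u X) := by linarith
    nlinarith

/-- The symmetric Lovász local lemma, for events determined by few coordinates of a uniformly
random function. -/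
lemma exists_avoiding [Fintype V] (E : V → (ι → Ω) → Prop) (vbl : V → Finset ι) (p : ℝ) (d : ℕ)
    (hp : 0 ≤ p) (hp4 : 4 * p ≤ 1)
    (hE : ∀ v X Y, (∀ i ∈ vbl v, X i = Y i) → (E v X ↔ E v Y))
    (hpr : ∀ v, pr (E v) ≤ p)
    (hd : ∀ v, ∀ S : Finset V, (∀ u ∈ S, ¬ Disjoint (vbl u) (vbl v)) → S.card ≤ d)
    (hpd : 4 * p * d ≤ 1) : ∃ X, ∀ v, ¬ E v X := by
  classical
  have key : ∀ S : Finset V, 0 < pr (fun X => ∀ u ∈ S, ¬ E u X) := by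
    intro S
    induction S using Finset.induction_on with
    | empty => simp [pr_true]
    | insert v S hv ih =>
      have h1 := pr_and_avoid_le E vbl p d hp hE hpr hd hpd S.card S le_rfl v
      have h2 := pr_split (E v) (fun X => ∀ u ∈ S, ¬ E u X)
      have h3 : pr (fun X => ∀ u ∈ insert v S, ¬ E u X)
          = pr (fun X => ¬ E v X ∧ ∀ u ∈ S, ¬ E u X) := pr_congr fun X => by simp
      rw [h3]
      nlinarith
  by_contra! h
  have := key Finset.univ
  rw [pr_false] at this
  · exact lt_irrefl _ this
  · intro X hX
    obtain ⟨v, hv⟩ := h X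
    exact hX v (mem_univ v) hv

end LocalLemma

section Monochromatic

variable {V Ω : Type*} [Fintype V] [DecidableEq V] [Fintype Ω] [DecidableEq Ω] [Nonempty Ω]

lemma pr_eq_avg_piecewise (s : Finset V) (p : (V → Ω) → Prop) :
    pr p = avg fun Y : V → Ω => pr fun X : V → Ω => p (s.piecewise X Y) := by
  unfold pr
  rw [avg_piecewise s]

/-- The colors that `u` has to avoid in order not to agree with an `E`-neighbour in `W` on one of
the colors in `P`. -/
def hitColors (E : Finset (V × V)) (P : V → V → Finset Ω) (W : Finset V) (X : V → Ω) (u : V) :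
    Finset Ω :=
  (W.filter fun w => (u, w) ∈ E ∧ X w ∈ P u w).image X

lemma exp_neg_le_one_sub_half {x : ℝ} (h0 : 0 ≤ x) (h1 : x ≤ 1) : Real.exp (-x) ≤ 1 - x / 2 := by
  rw [Real.exp_neg, inv_le_comm₀ (Real.exp_pos _) (by linarith)]
  refine le_trans ?_ (Real.add_one_le_exp x)
  rw [inv_le_iff_one_le_mul₀ (by linarith)]
  nlinarith

lemma card_hitColors_insert (E : Finset (V × V)) (P : V → V → Finset Ω) {W : Finset V} {w : V}
    (hw : w ∉ W) (Y : V → Ω) (x : Ω) (u : V) :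
    (hitColors E P W Y u).card
      + (if (u, w) ∈ E ∧ x ∈ P u w \ hitColors E P W Y u then 1 else 0)
      ≤ (hitColors E P (insert w W) (Function.update Y w x) u).card := by
  have hsub : hitColors E P W Y u ⊆ hitColors E P (insert w W) (Function.update Y w x) u := by
    intro c hc
    simp only [hitColors, mem_image, mem_filter] at hc ⊢
    obtain ⟨z, ⟨hz, hzE, hzP⟩, rfl⟩ := hc
    have hne : z ≠ w := fun h => hw (h ▸ hz)
    exact ⟨z, ⟨mem_insert_of_mem hz, hzE, by simpa [hne] using hzP⟩, by simp [hne]⟩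
  split_ifs with h
  · rw [mem_sdiff] at h
    rw [← card_insert_of_notMem h.2.2]
    refine card_le_card (insert_subset ?_ hsub)
    simp only [hitColors, mem_image, mem_filter]
    exact ⟨w, ⟨mem_insert_self _ _, h.1, by simpa using h.2.1⟩, by simp⟩
  · simpa using card_le_card hsub

lemma avg_exp_hitColors_le (U : Finset V) (E : Finset (V × V)) (P : V → V → Finset Ω)
    (a : ℝ) (hU : ∀ e ∈ E, e.1 ∈ U)
    (hP : ∀ e ∈ E, ((univ.filter fun w => (e.1, w) ∈ E).card : ℝ) + a ≤ (P e.1 e.2).card)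
    (hW : ∀ w, (univ.filter fun u => (u, w) ∈ E).card ≤ Fintype.card Ω) (W : Finset V) :
    avg (fun X : V → Ω => Real.exp (-((∑ u ∈ U, ((hitColors E P W X u).card : ℝ)) /
        Fintype.card Ω)))
      ≤ Real.exp (-(a / (2 * (Fintype.card Ω : ℝ) ^ 2) * (E.filter fun e => e.2 ∈ W).card)) := by
  have hκ : (0 : ℝ) < Fintype.card Ω := by exact_mod_cast Fintype.card_pos
  set κ : ℝ := (Fintype.card Ω : ℝ) with hκdef
  induction W using Finset.induction_on with
  | empty => simp [hitColors, avg_const]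
  | insert w W hw ih =>
    set N := univ.filter fun u => (u, w) ∈ E with hN
    have hNU : N ⊆ U := fun u hu => hU (u, w) (by simpa [hN] using hu)
    have hcard : (E.filter fun e => e.2 ∈ insert w W).card
        = (E.filter fun e => e.2 ∈ W).card + N.card := by
      have h1 : (E.filter fun e => e.2 ∈ insert w W)
          = (E.filter fun e => e.2 ∈ W) ∪ N.image (fun u => (u, w)) := by
        ext ⟨u, z⟩
        simp only [mem_filter, mem_insert, mem_union, mem_image, hN, mem_univ, true_and,
          Prod.mk.injEq]
        constructor
        · rintro ⟨h, rfl | h'⟩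
          · exact Or.inr ⟨u, h, rfl, rfl⟩
          · exact Or.inl ⟨h, h'⟩
        · rintro (h | ⟨u', h, rfl, rfl⟩)
          · exact ⟨h.1, Or.inr h.2⟩
          · exact ⟨h, Or.inl rfl⟩
      rw [h1, card_union_of_disjoint, card_image_of_injective]
      · intro u u' h
        exact (Prod.mk.inj h).1
      · rw [Finset.disjoint_left]
        rintro ⟨u, z⟩ h h'
        simp only [mem_filter, mem_image, Prod.mk.injEq] at h h'
        obtain ⟨_, _, _, rfl⟩ := h'
        exact hw h.2
    rw [avg_update w]
    have hstep : ∀ Y : V → Ω,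
        avg (fun x : Ω => Real.exp (-((∑ u ∈ U,
          ((hitColors E P (insert w W) (Function.update Y w x) u).card : ℝ)) / κ)))
        ≤ Real.exp (-((∑ u ∈ U, ((hitColors E P W Y u).card : ℝ)) / κ)) *
          Real.exp (-(a / (2 * κ ^ 2) * N.card)) := by
      intro Y
      set S : ℝ := ∑ u ∈ U, ((hitColors E P W Y u).card : ℝ)
      let I : Ω → ℝ := fun x => ∑ u ∈ N, if x ∈ P u w \ hitColors E P W Y u then (1 : ℝ) else 0
      have hI0 : ∀ x, 0 ≤ I x := fun x =>
        Finset.sum_nonneg fun u _ => by split_ifs <;> norm_num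
      have hIN : ∀ x, I x ≤ N.card := fun x => by
        calc I x ≤ ∑ u ∈ N, (1 : ℝ) := Finset.sum_le_sum fun u _ => by split_ifs <;> norm_num
          _ = N.card := by simp
      have hIκ : ∀ x, I x / κ ≤ 1 := fun x => by
        rw [div_le_one hκ]
        have h : (N.card : ℝ) ≤ Fintype.card Ω := by exact_mod_cast hW w
        exact (hIN x).trans h
      have hsum : ∀ x, S + I x ≤
          ∑ u ∈ U, ((hitColors E P (insert w W) (Function.update Y w x) u).card : ℝ) := by
        intro x
        have hI : I x = ∑ u ∈ U,
            if (u, w) ∈ E ∧ x ∈ P u w \ hitColors E P W Y u then (1 : ℝ) else 0 := by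
          simp only [I]
          rw [← Finset.sum_filter, ← Finset.sum_filter]
          refine Finset.sum_congr ?_ fun _ _ => rfl
          ext u
          simp only [mem_filter, hN, mem_univ, true_and]
          constructor
          · rintro ⟨h1, h2⟩
            exact ⟨hU _ h1, h1, h2⟩
          · rintro ⟨_, h1, h2⟩
            exact ⟨h1, h2⟩
        rw [hI, ← Finset.sum_add_distrib]
        refine Finset.sum_le_sum fun u _ => ?_
        have := card_hitColors_insert E P hw Y x u
        exact_mod_cast this
      have hexp : ∀ x, Real.exp (-((∑ u ∈ U,
          ((hitColors E P (insert w W) (Function.update Y w x) u).card : ℝ)) / κ))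
          ≤ Real.exp (-(S / κ)) * (1 + (-(1 / (2 * κ))) * I x) := by
        intro x
        calc _ ≤ Real.exp (-((S + I x) / κ)) := by
              rw [Real.exp_le_exp]
              have := hsum x
              gcongr
          _ = Real.exp (-(S / κ)) * Real.exp (-(I x / κ)) := by
              rw [← Real.exp_add]
              congr 1
              ring
          _ ≤ Real.exp (-(S / κ)) * (1 - I x / κ / 2) := by
              gcongr
              exact exp_neg_le_one_sub_half (div_nonneg (hI0 x) hκ.le) (hIκ x)
          _ = _ := by
              congr 1
              field_simp
              ring
      have havgI : N.card * (a / κ) ≤ avg I := by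
        simp only [I]
        rw [avg_sum]
        calc (N.card : ℝ) * (a / κ) = ∑ u ∈ N, a / κ := by simp
          _ ≤ _ := Finset.sum_le_sum fun u hu => ?_
        have hpr : avg (fun x => if x ∈ P u w \ hitColors E P W Y u then (1 : ℝ) else 0)
            = ((P u w \ hitColors E P W Y u).card : ℝ) / κ := by
          rw [avg, ← Finset.sum_filter, Finset.sum_const, hκdef]
          simp only [nsmul_eq_mul, mul_one]
          congr 3
          ext x
          simp
        rw [hpr]
        have huE : (u, w) ∈ E := by simpa [hN] using hu
        have h1 := hP _ huE
        have h2 : (hitColors E P W Y u).card ≤ (univ.filter fun z => (u, z) ∈ E).card := by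
          refine card_image_le.trans (card_le_card fun z hz => ?_)
          simp only [mem_filter, mem_univ, true_and] at hz ⊢
          exact hz.2.1
        have h3 : (P u w).card ≤ (P u w \ hitColors E P W Y u).card
            + (hitColors E P W Y u).card := by
          have := le_card_sdiff (hitColors E P W Y u) (P u w)
          omega
        have h2' : ((hitColors E P W Y u).card : ℝ) ≤ (univ.filter fun z => (u, z) ∈ E).card := by
          exact_mod_cast h2
        have h3' : ((P u w).card : ℝ) ≤ (P u w \ hitColors E P W Y u).card
            + (hitColors E P W Y u).card := by exact_mod_cast h3
        gcongr
        simp only at h1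
        linarith
      refine (avg_mono hexp).trans ?_
      rw [avg_mul_left, avg_add, avg_const, avg_mul_left]
      gcongr
      refine le_trans ?_ (Real.add_one_le_exp _)
      have : 1 / (2 * κ) * (N.card * (a / κ)) ≤ 1 / (2 * κ) * avg I := by gcongr
      have h5 : a / (2 * κ ^ 2) * N.card = 1 / (2 * κ) * (N.card * (a / κ)) := by
        field_simp
      rw [h5]
      linarith
    refine (avg_mono hstep).trans ?_
    rw [avg_mul_right, hcard]
    calc _ ≤ Real.exp (-(a / (2 * κ ^ 2) * (E.filter fun e => e.2 ∈ W).card)) *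
          Real.exp (-(a / (2 * κ ^ 2) * N.card)) := by gcongr
      _ = _ := by
          rw [← Real.exp_add]
          congr 1
          push_cast
          ring

lemma pr_no_monochromatic_directed_le (U W : Finset V) (hUW : Disjoint U W) (E : Finset (V × V))
    (P : V → V → Finset Ω) (a : ℝ) (hE : E ⊆ U ×ˢ W)
    (hP : ∀ e ∈ E, ((univ.filter fun w => (e.1, w) ∈ E).card : ℝ) + a ≤ (P e.1 e.2).card)
    (hW : ∀ w, (univ.filter fun u => (u, w) ∈ E).card ≤ Fintype.card Ω) :
    pr (fun X : V → Ω => ∀ e ∈ E, ∀ c ∈ P e.1 e.2, ¬ (X e.1 = c ∧ X e.2 = c))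
      ≤ Real.exp (-(a / (2 * (Fintype.card Ω : ℝ) ^ 2) * E.card)) := by
  have hκ : (0 : ℝ) < Fintype.card Ω := by exact_mod_cast Fintype.card_pos
  rw [pr_eq_avg_piecewise U]
  have hfil : E.filter (fun e => e.2 ∈ W) = E :=
    Finset.filter_true_of_mem fun e he => (mem_product.1 (hE he)).2
  have hmain := avg_exp_hitColors_le U E P a (fun e he => (mem_product.1 (hE he)).1) hP hW W
  rw [hfil] at hmain
  refine le_trans (avg_mono fun Y => ?_) hmain
  have hsub : pr (fun X : V → Ω => ∀ e ∈ E, ∀ c ∈ P e.1 e.2,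
      ¬ (U.piecewise X Y e.1 = c ∧ U.piecewise X Y e.2 = c))
      ≤ pr (fun X : V → Ω => ∀ u ∈ U, X u ∉ hitColors E P W Y u) := by
    refine pr_mono fun X hX u hu hmem => ?_
    simp only [hitColors, mem_image, mem_filter] at hmem
    obtain ⟨w, ⟨hw, hwE, hwP⟩, hXw⟩ := hmem
    refine hX (u, w) hwE (Y w) hwP ⟨?_, ?_⟩
    · simp [hu, hXw]
    · simp [Finset.disjoint_right.1 hUW hw]
  refine hsub.trans ?_
  rw [pr_forall_mem U fun u x => x ∉ hitColors E P W Y u, Finset.sum_div, ← Finset.sum_neg_distrib,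
    Real.exp_sum]
  refine Finset.prod_le_prod (fun u _ => pr_nonneg _) fun u _ => ?_
  rw [pr_notMem]
  exact Real.one_sub_le_exp_neg _

end Monochromatic

section Directed

variable {V : Type*} [DecidableEq V]

/-- The number of ordered pairs of `r`-related elements of `K`. -/
def numPairs (r : V → V → Prop) [DecidableRel r] (K : Finset V) : ℕ :=
  ∑ u ∈ K, (K.filter fun w => r u w).card

lemma exists_cut (r : V → V → Prop) [DecidableRel r] (hsymm : ∀ u w, r u w → r w u)
    (hirr : ∀ u, ¬ r u u) (K : Finset V) :
    ∃ U W : Finset V, Disjoint U W ∧ U ∪ W = K ∧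
      numPairs r K ≤ 4 * ∑ u ∈ U, (W.filter fun w => r u w).card := by
  induction K using Finset.induction_on with
  | empty => exact ⟨∅, ∅, by simp [numPairs]⟩
  | insert v K hv ih =>
    obtain ⟨U, W, hd, hU, hN⟩ := ih
    have hvU : v ∉ U := fun h => hv (hU ▸ mem_union_left _ h)
    have hvW : v ∉ W := fun h => hv (hU ▸ mem_union_right _ h)
    have hcount : ∀ S : Finset V, ∑ u ∈ S, (if r u v then 1 else 0)
        = (S.filter fun w => r v w).card := by
      intro S
      rw [card_filter]
      refine Finset.sum_congr rfl fun u _ => ?_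
      simp only [show r u v ↔ r v u from ⟨hsymm _ _, hsymm _ _⟩]
    have hins : ∀ S : Finset V, v ∉ S → ∀ u, ((insert v S).filter fun w => r u w).card
        = (S.filter fun w => r u w).card + if r u v then 1 else 0 := by
      intro S hS u
      rw [filter_insert]
      split_ifs with h
      · rw [card_insert_of_notMem (by simp [hS])]
      · rfl
    have hsplit : (K.filter fun w => r v w).card
        = (U.filter fun w => r v w).card + (W.filter fun w => r v w).card := by
      rw [← hU, filter_union, card_union_of_disjoint (disjoint_filter_filter hd)]
    have hN' : numPairs r (insert v K)
        = numPairs r K + 2 * (K.filter fun w => r v w).card := by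
      unfold numPairs
      rw [sum_insert hv, hins K hv, if_neg (hirr v)]
      simp_rw [hins K hv]
      rw [sum_add_distrib, hcount]
      ring
    rcases le_total (U.filter fun w => r v w).card (W.filter fun w => r v w).card with h | h
    · refine ⟨insert v U, W, disjoint_insert_left.2 ⟨hvW, hd⟩, by rw [insert_union, hU], ?_⟩
      rw [sum_insert hvU]
      omega
    · refine ⟨U, insert v W, disjoint_insert_right.2 ⟨hvU, hd⟩, by rw [union_insert, hU], ?_⟩
      simp_rw [hins W hvW]
      rw [sum_add_distrib, hcount]
      omega

lemma exists_directed_subset (r : V → V → Prop) [DecidableRel r] (hsymm : ∀ u w, r u w → r w u)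
    (hirr : ∀ u, ¬ r u u) (K : Finset V) (k : ℕ) (hk : 16 ≤ k)
    (hdeg : ∀ u ∈ K, (K.filter fun w => r u w).card ≤ k) :
    ∃ (U W : Finset V) (E : Finset (V × V)), Disjoint U W ∧ U ⊆ K ∧ W ⊆ K ∧ E ⊆ U ×ˢ W ∧
      (∀ e ∈ E, r e.1 e.2) ∧ (∀ u (F : Finset V), (∀ w ∈ F, (u, w) ∈ E) → F.card ≤ k / 4) ∧
      numPairs r K ≤ 20 * E.card := by
  obtain ⟨U, W, hd, hU, hN⟩ := exists_cut r hsymm hirr K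
  have hWK : W ⊆ K := hU ▸ subset_union_right
  have hUK : U ⊆ K := hU ▸ subset_union_left
  have hS : ∀ u, ∃ S ⊆ W.filter fun w => r u w,
      S.card = min (k / 4) (W.filter fun w => r u w).card := fun u =>
    exists_subset_card_eq (min_le_right _ _)
  choose S hSsub hScard using hS
  refine ⟨U, W, (U ×ˢ W).filter fun e => e.2 ∈ S e.1, hd, hUK, hWK, filter_subset _ _, ?_, ?_, ?_⟩
  · intro e he
    exact (mem_filter.1 (hSsub _ (mem_filter.1 he).2)).2
  · intro u F hF
    refine (card_le_card (t := S u) fun w hw => (mem_filter.1 (hF w hw)).2).trans ?_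
    rw [hScard]
    exact min_le_left _ _
  · have hE : ((U ×ˢ W).filter fun e => e.2 ∈ S e.1).card = ∑ u ∈ U, (S u).card := by
      rw [card_filter, sum_product]
      refine Finset.sum_congr rfl fun u _ => ?_
      rw [← card_filter]
      congr 1
      ext w
      simp only [mem_filter, and_iff_right_iff_imp]
      exact fun h => (mem_filter.1 (hSsub _ h)).1
    have hle : ∑ u ∈ U, (W.filter fun w => r u w).card ≤ 5 * ∑ u ∈ U, (S u).card := by
      rw [mul_sum]
      refine Finset.sum_le_sum fun u hu => ?_
      have h1 := (card_le_card (filter_subset_filter (fun w => r u w) hWK)).trans (hdeg u (hUK hu))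
      rw [hScard]
      omega
    rw [hE]
    omega

/-- A random assignment has a pair of related vertices sharing an allowed value, except with
probability exponentially small in the number of related pairs. -/
lemma pr_no_monochromatic_le {Ω : Type*} [Fintype V] [Fintype Ω] [DecidableEq Ω] [Nonempty Ω]
    (r : V → V → Prop) [DecidableRel r]
    (hsymm : ∀ u w, r u w → r w u) (hirr : ∀ u, ¬ r u u) (K : Finset V) (k : ℕ) (hk : 16 ≤ k)
    (hdeg : ∀ u ∈ K, (K.filter fun w => r u w).card ≤ k) (hkκ : k ≤ Fintype.card Ω)
    (P : V → V → Finset Ω) (hP : ∀ u ∈ K, ∀ w ∈ K, r u w → k ≤ 2 * (P u w).card) :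
    pr (fun X : V → Ω => ∀ u ∈ K, ∀ w ∈ K, r u w → ∀ c ∈ P u w, ¬ (X u = c ∧ X w = c))
      ≤ Real.exp (-(k * numPairs r K / (160 * (Fintype.card Ω : ℝ) ^ 2))) := by
  obtain ⟨U, W, E, hd, hUK, hWK, hE, hr, hcap, hN⟩ :=
    exists_directed_subset r hsymm hirr K k hk hdeg
  have hκ : (0 : ℝ) < Fintype.card Ω := by exact_mod_cast Fintype.card_pos
  have hmem : ∀ e ∈ E, e.1 ∈ K ∧ e.2 ∈ K := fun e he =>
    ⟨hUK (mem_product.1 (hE he)).1, hWK (mem_product.1 (hE he)).2⟩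
  have h := pr_no_monochromatic_directed_le U W hd E P (k / 4) hE ?_ ?_
  · refine (pr_mono fun X hX e he c hc => ?_).trans (h.trans ?_)
    · exact hX _ (hmem e he).1 _ (hmem e he).2 (hr e he) c hc
    · rw [Real.exp_le_exp, neg_le_neg_iff]
      have hN' : (numPairs r K : ℝ) ≤ 20 * E.card := by exact_mod_cast hN
      calc (k : ℝ) * numPairs r K / (160 * (Fintype.card Ω : ℝ) ^ 2)
          ≤ k * (20 * E.card) / (160 * (Fintype.card Ω : ℝ) ^ 2) := by gcongr
        _ = _ := by field_simp; ring
  · intro e he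
    have h1 := hcap e.1 (univ.filter fun w => (e.1, w) ∈ E) (by simp)
    have h2 := hP _ (hmem e he).1 _ (hmem e he).2 (hr e he)
    have h1' : (4 : ℝ) * (univ.filter fun w => (e.1, w) ∈ E).card ≤ k := by
      exact_mod_cast (by omega)
    have h2' : (k : ℝ) ≤ 2 * (P e.1 e.2).card := by exact_mod_cast h2
    linarith
  · intro w
    by_cases hw : ∃ u, (u, w) ∈ E
    · obtain ⟨u, hu⟩ := hw
      refine le_trans (le_trans (card_le_card fun x hx => ?_) (hdeg w (hmem _ hu).2)) hkκ
      have hx' : (x, w) ∈ E := (mem_filter.1 hx).2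
      exact mem_filter.2 ⟨(hmem _ hx').1, hsymm _ _ (hr _ hx')⟩
    · push Not at hw
      simp [hw]

end Directed

section Colorful

lemma card_filter_card_le_le {α : Type*} [DecidableEq α] (K : Finset α) (a : ℕ) {θ : ℝ}
    (hθ : 1 ≤ θ) :
    ((K.powerset.filter fun S => S.card ≤ a).card : ℝ) ≤ θ ^ a * (1 + θ⁻¹) ^ K.card := by
  have hθ0 : 0 < θ := by linarith
  have h1 : ∑ S ∈ K.powerset, θ⁻¹ ^ S.card = (1 + θ⁻¹) ^ K.card := by
    have := Finset.sum_pow_mul_eq_add_pow θ⁻¹ 1 K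
    simp only [one_pow, mul_one] at this
    rw [this, add_comm]
  calc ((K.powerset.filter fun S => S.card ≤ a).card : ℝ)
      = ∑ S ∈ K.powerset.filter fun S => S.card ≤ a, (1 : ℝ) := by simp
    _ ≤ ∑ S ∈ K.powerset.filter fun S => S.card ≤ a, θ ^ a * θ⁻¹ ^ S.card := by
        refine Finset.sum_le_sum fun S hS => ?_
        have := (mem_filter.1 hS).2
        rw [inv_pow, ← div_eq_mul_inv, one_le_div (by positivity)]
        exact pow_le_pow_right₀ hθ this
    _ ≤ ∑ S ∈ K.powerset, θ ^ a * θ⁻¹ ^ S.card :=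
        Finset.sum_le_sum_of_subset_of_nonneg (filter_subset _ _) fun _ _ _ => by positivity
    _ = θ ^ a * (1 + θ⁻¹) ^ K.card := by rw [← mul_sum, h1]

variable {V : Type*} [DecidableEq V]

lemma numPairs_le_sdiff (r : V → V → Prop) [DecidableRel r] (hsymm : ∀ u w, r u w → r w u)
    {K U : Finset V} (hU : U ⊆ K) (d : ℕ) (hdeg : ∀ u ∈ K, (K.filter fun w => r u w).card ≤ d) :
    numPairs r K ≤ numPairs r (K \ U) + 2 * U.card * d := by
  have hsplit : ∀ u, (K.filter fun w => r u w).card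
      = ((K \ U).filter fun w => r u w).card + (U.filter fun w => r u w).card := by
    intro u
    rw [← card_union_of_disjoint (disjoint_filter_filter sdiff_disjoint), ← filter_union,
      sdiff_union_of_subset hU]
  have h1 : ∑ u ∈ U, (K.filter fun w => r u w).card ≤ U.card * d :=
    Finset.sum_le_card_nsmul _ _ _ fun u hu => hdeg u (hU hu)
  have h2 : ∑ u ∈ K \ U, (U.filter fun w => r u w).card ≤ U.card * d := by
    calc ∑ u ∈ K \ U, (U.filter fun w => r u w).card
        = ∑ w ∈ U, ((K \ U).filter fun u => r u w).card := by
          simp_rw [card_filter]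
          exact sum_comm
      _ ≤ ∑ w ∈ U, (K.filter fun u => r w u).card := by
          refine Finset.sum_le_sum fun w _ => card_le_card fun u hu => ?_
          rw [mem_filter] at hu ⊢
          exact ⟨(mem_sdiff.1 hu.1).1, hsymm _ _ hu.2⟩
      _ ≤ _ := h1
  have h3 : numPairs r K = ∑ u ∈ K \ U, (K.filter fun w => r u w).card
      + ∑ u ∈ U, (K.filter fun w => r u w).card := (sum_sdiff hU).symm
  have h4 : ∑ u ∈ K \ U, (K.filter fun w => r u w).card
      = numPairs r (K \ U) + ∑ u ∈ K \ U, (U.filter fun w => r u w).card := by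
    rw [numPairs, ← sum_add_distrib]
    exact Finset.sum_congr rfl fun u _ => hsplit u
  rw [h3, h4]
  linarith

variable {Ω : Type*} [DecidableEq Ω]

/-- A set of triples `(u, w, c)` forming a matching of `r`-related pairs in `K` in which every pair
can be given a common color `c`, with distinct colors for distinct pairs. -/
structure IsColorful (r : V → V → Prop) (K : Finset V) (A : V → Finset Ω) (has : V → Ω → Prop)
    (T : Finset (V × V × Ω)) : Prop where
  left_mem : ∀ t ∈ T, t.1 ∈ K
  right_mem : ∀ t ∈ T, t.2.1 ∈ K
  rel : ∀ t ∈ T, r t.1 t.2.1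
  color_mem : ∀ t ∈ T, t.2.2 ∈ A t.1 ∩ A t.2.1
  has_left : ∀ t ∈ T, has t.1 t.2.2
  has_right : ∀ t ∈ T, has t.2.1 t.2.2
  color_ne : ∀ s ∈ T, ∀ t ∈ T, s ≠ t → s.2.2 ≠ t.2.2
  left_ne : ∀ s ∈ T, ∀ t ∈ T, s ≠ t → s.1 ≠ t.1
  right_ne : ∀ s ∈ T, ∀ t ∈ T, s ≠ t → s.2.1 ≠ t.2.1
  left_ne_right : ∀ s ∈ T, ∀ t ∈ T, s ≠ t → s.1 ≠ t.2.1

lemma IsColorful.subset {r : V → V → Prop} {K : Finset V} {A : V → Finset Ω} {has : V → Ω → Prop}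
    {T T' : Finset (V × V × Ω)} (h : IsColorful r K A has T) (hT : T' ⊆ T) :
    IsColorful r K A has T' :=
  ⟨fun t ht => h.1 t (hT ht), fun t ht => h.2 t (hT ht), fun t ht => h.3 t (hT ht),
    fun t ht => h.4 t (hT ht), fun t ht => h.5 t (hT ht), fun t ht => h.6 t (hT ht),
    fun s hs t ht => h.7 s (hT hs) t (hT ht), fun s hs t ht => h.8 s (hT hs) t (hT ht),
    fun s hs t ht => h.9 s (hT hs) t (hT ht), fun s hs t ht => h.10 s (hT hs) t (hT ht)⟩

lemma exists_certificate [Fintype V] [Fintype Ω] {r : V → V → Prop} {K : Finset V}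
    {A : V → Finset Ω} {has : V → Ω → Prop} {M : ℕ} {Pal : Finset Ω} (hPal : ∀ v, A v ⊆ Pal)
    (hno : ¬ ∃ T, IsColorful r K A has T ∧ T.card = M) :
    ∃ U ⊆ K, ∃ D ⊆ Pal, U.card ≤ 2 * M ∧ D.card ≤ M ∧ ∀ u ∈ K \ U, ∀ w ∈ K \ U, r u w →
      ∀ c ∈ (A u ∩ A w) \ D, ¬ (has u c ∧ has w c) := by
  classical
  obtain ⟨T, hT, hmax⟩ := Finset.exists_max_image
    (univ.filter fun T : Finset (V × V × Ω) => IsColorful r K A has T) Finset.card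
    ⟨∅, by simp only [mem_filter, mem_univ, true_and]; constructor <;> simp⟩
  simp only [mem_filter, mem_univ, true_and] at hT hmax
  have hM : T.card < M := by
    by_contra h
    obtain ⟨T', hT', hc⟩ := exists_subset_card_eq (not_lt.1 h)
    exact hno ⟨T', hT.subset hT', hc⟩
  refine ⟨T.image (fun t => t.1) ∪ T.image (fun t => t.2.1), ?_, T.image (fun t => t.2.2), ?_, ?_,
    card_image_le.trans hM.le, ?_⟩
  · refine union_subset ?_ ?_ <;> intro x hx <;> obtain ⟨t, ht, rfl⟩ := mem_image.1 hx
    · exact hT.1 t ht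
    · exact hT.2 t ht
  · intro x hx
    obtain ⟨t, ht, rfl⟩ := mem_image.1 hx
    exact hPal _ (mem_inter.1 (hT.color_mem t ht)).1
  · have h1 := card_union_le (T.image (fun t => t.1)) (T.image (fun t => t.2.1))
    have h2 : (T.image (fun t => t.1)).card ≤ T.card := card_image_le
    have h3 : (T.image (fun t => t.2.1)).card ≤ T.card := card_image_le
    omega
  · rintro u hu w hw hr c hc ⟨hcu, hcw⟩
    simp only [mem_sdiff, mem_union, mem_image, not_or, not_exists, not_and] at hu hw hc
    obtain ⟨huK, hu1, hu2⟩ := hu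
    obtain ⟨hwK, hw1, hw2⟩ := hw
    have hnew : (u, w, c) ∉ T := fun h => hu1 _ h rfl
    have hcol : IsColorful r K A has (insert (u, w, c) T) := by
      constructor
      · rintro t ht
        rcases mem_insert.1 ht with rfl | ht
        · exact huK
        · exact hT.1 t ht
      · rintro t ht
        rcases mem_insert.1 ht with rfl | ht
        · exact hwK
        · exact hT.2 t ht
      · rintro t ht
        rcases mem_insert.1 ht with rfl | ht
        · exact hr
        · exact hT.3 t ht
      · rintro t ht
        rcases mem_insert.1 ht with rfl | ht
        · exact hc.1
        · exact hT.4 t ht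
      · rintro t ht
        rcases mem_insert.1 ht with rfl | ht
        · exact hcu
        · exact hT.5 t ht
      · rintro t ht
        rcases mem_insert.1 ht with rfl | ht
        · exact hcw
        · exact hT.6 t ht
      · intro s hs t ht hst
        rcases mem_insert.1 hs with rfl | hs <;> rcases mem_insert.1 ht with rfl | ht
        · exact absurd rfl hst
        · exact fun h => hc.2 t ht h.symm
        · exact fun h => hc.2 s hs h
        · exact hT.7 s hs t ht hst
      · intro s hs t ht hst
        rcases mem_insert.1 hs with rfl | hs <;> rcases mem_insert.1 ht with rfl | ht
        · exact absurd rfl hst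
        · exact fun h => hu1 t ht h.symm
        · exact fun h => hu1 s hs h
        · exact hT.8 s hs t ht hst
      · intro s hs t ht hst
        rcases mem_insert.1 hs with rfl | hs <;> rcases mem_insert.1 ht with rfl | ht
        · exact absurd rfl hst
        · exact fun h => hw2 t ht h.symm
        · exact fun h => hw2 s hs h
        · exact hT.9 s hs t ht hst
      · intro s hs t ht hst
        rcases mem_insert.1 hs with rfl | hs <;> rcases mem_insert.1 ht with rfl | ht
        · exact absurd rfl hst
        · exact fun h => hu2 t ht h.symm
        · exact fun h => hw1 s hs h
        · exact hT.10 s hs t ht hst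
    have := hmax _ hcol
    rw [card_insert_of_notMem hnew] at this
    omega

/-- Random lists contain a large colorful matching with high probability. -/
lemma pr_no_colorful_le [Fintype V] [Fintype Ω] [Nonempty Ω] (r : V → V → Prop)
    (hsymm : ∀ u w, r u w → r w u) (hirr : ∀ u, ¬ r u u) (K : Finset V) [DecidableRel r]
    (A : V → Finset Ω) (Pal : Finset Ω) (hPal : ∀ v, A v ⊆ Pal) (k d M ℓ : ℕ) (hk : 16 ≤ k)
    (hkκ : k ≤ Fintype.card Ω) (hdk : d ≤ k)
    (hdeg : ∀ u ∈ K, (K.filter fun w => r u w).card ≤ d) (hM : 8 * M * d ≤ numPairs r K)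
    (hA : ∀ u ∈ K, ∀ w ∈ K, r u w → k + 2 * M ≤ 2 * (A u ∩ A w).card) {θ : ℝ} (hθ : 1 ≤ θ) :
    pr (fun L : V → Fin ℓ → Ω =>
        ¬ ∃ T, IsColorful r K A (fun v c => ∃ i, L v i = c) T ∧ T.card = M)
      ≤ θ ^ (3 * M) * (1 + θ⁻¹) ^ (K.card + Pal.card) *
        Real.exp (-(ℓ * (k * numPairs r K / (320 * (Fintype.card Ω : ℝ) ^ 2)))) := by
  have hκ : (0 : ℝ) < Fintype.card Ω := by exact_mod_cast Fintype.card_pos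
  set SU := K.powerset.filter fun S => S.card ≤ 2 * M with hSU
  set SD := Pal.powerset.filter fun S => S.card ≤ M with hSD
  let B : Finset V × Finset Ω → (V → Fin ℓ → Ω) → Prop := fun q L =>
    ∀ i, ∀ u ∈ K \ q.1, ∀ w ∈ K \ q.1, r u w → ∀ c ∈ (A u ∩ A w) \ q.2, ¬ (L u i = c ∧ L w i = c)
  have h1 : pr (fun L : V → Fin ℓ → Ω =>
        ¬ ∃ T, IsColorful r K A (fun v c => ∃ i, L v i = c) T ∧ T.card = M)
      ≤ pr (fun L => ∃ q ∈ SU ×ˢ SD, B q L) := by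
    refine pr_mono fun L hL => ?_
    obtain ⟨U, hU, D, hD, hUc, hDc, h⟩ := exists_certificate hPal hL
    refine ⟨(U, D), mem_product.2 ⟨mem_filter.2 ⟨mem_powerset.2 hU, hUc⟩,
      mem_filter.2 ⟨mem_powerset.2 hD, hDc⟩⟩, fun i u hu w hw hr c hc hcc => ?_⟩
    exact h u hu w hw hr c hc ⟨⟨i, hcc.1⟩, ⟨i, hcc.2⟩⟩
  have h2 : ∀ q ∈ SU ×ˢ SD, pr (B q)
      ≤ Real.exp (-(ℓ * (k * numPairs r K / (320 * (Fintype.card Ω : ℝ) ^ 2)))) := by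
    rintro ⟨U, D⟩ hq
    obtain ⟨hU, hD⟩ := mem_product.1 hq
    obtain ⟨hU, hUc⟩ := mem_filter.1 hU
    obtain ⟨hD, hDc⟩ := mem_filter.1 hD
    rw [mem_powerset] at hU hD
    simp only at hU hUc hD hDc
    have e1 : pr (B (U, D)) = pr (fun X : Fin ℓ → V → Ω => ∀ i, ∀ u ∈ K \ U, ∀ w ∈ K \ U, r u w →
        ∀ c ∈ (A u ∩ A w) \ D, ¬ (X i u = c ∧ X i w = c)) :=
      pr_equiv (Equiv.piComm fun _ _ => Ω) fun X : Fin ℓ → V → Ω =>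
        ∀ i, ∀ u ∈ K \ U, ∀ w ∈ K \ U, r u w →
          ∀ c ∈ (A u ∩ A w) \ D, ¬ (X i u = c ∧ X i w = c)
    rw [e1, pr_forall fun _ (Y : V → Ω) => ∀ u ∈ K \ U, ∀ w ∈ K \ U, r u w →
        ∀ c ∈ (A u ∩ A w) \ D, ¬ (Y u = c ∧ Y w = c)]
    rw [prod_const, card_univ, Fintype.card_fin, ← mul_neg, Real.exp_nat_mul]
    refine pow_le_pow_left₀ (pr_nonneg _) ?_ _
    refine (pr_no_monochromatic_le r hsymm hirr (K \ U) k hk (fun u hu => ?_) hkκ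
      (fun u w => (A u ∩ A w) \ D) fun u hu w hw hr => ?_).trans ?_
    · exact ((card_le_card (filter_subset_filter _ sdiff_subset)).trans
        (hdeg u (mem_sdiff.1 hu).1)).trans hdk
    · have := hA u (mem_sdiff.1 hu).1 w (mem_sdiff.1 hw).1 hr
      have := le_card_sdiff D (A u ∩ A w)
      omega
    · rw [Real.exp_le_exp, neg_le_neg_iff]
      have h3 := numPairs_le_sdiff r hsymm hU d hdeg
      have h4 : numPairs r K ≤ 2 * numPairs r (K \ U) := by
        have : 2 * U.card * d ≤ 2 * (2 * M) * d := by gcongr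
        nlinarith
      have h4' : (numPairs r K : ℝ) ≤ 2 * numPairs r (K \ U) := by exact_mod_cast h4
      calc (k * numPairs r K / (320 * (Fintype.card Ω : ℝ) ^ 2))
          ≤ k * (2 * numPairs r (K \ U)) / (320 * (Fintype.card Ω : ℝ) ^ 2) := by gcongr
        _ = _ := by field_simp; ring
  refine h1.trans ((pr_exists_le _ _).trans ((Finset.sum_le_card_nsmul _ _ _ h2).trans ?_))
  rw [nsmul_eq_mul]
  refine mul_le_mul_of_nonneg_right ?_ (Real.exp_pos _).le
  rw [card_product, Nat.cast_mul]
  calc (SU.card : ℝ) * SD.card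
      ≤ (θ ^ (2 * M) * (1 + θ⁻¹) ^ K.card) * (θ ^ M * (1 + θ⁻¹) ^ Pal.card) := by
        have h0 : 0 < θ := by linarith
        exact mul_le_mul (card_filter_card_le_le K _ hθ) (card_filter_card_le_le Pal _ hθ)
          (by positivity) (by positivity)
    _ = _ := by ring

end Colorful

section Hall

lemma one_add_exp_convex_le {a b h : ℝ} (h0 : 0 ≤ h) (h1 : h ≤ 1) :
    1 + Real.exp ((1 - h) * a + h * b)
      ≤ Real.exp ((1 - h) * (a + Real.exp (-a)) + h * Real.exp b) := by
  have ha : 0 < 1 + Real.exp a := by positivity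
  have hb : 0 < 1 + Real.exp b := by positivity
  have e1 := Real.geom_mean_le_arith_mean2_weighted (sub_nonneg.2 h1) h0
    (inv_pos.2 ha).le (inv_pos.2 hb).le (by ring)
  have e2 := Real.geom_mean_le_arith_mean2_weighted (sub_nonneg.2 h1) h0
    (mul_pos (Real.exp_pos a) (inv_pos.2 ha)).le (mul_pos (Real.exp_pos b) (inv_pos.2 hb)).le
    (by ring)
  rw [Real.mul_rpow (Real.exp_pos a).le (inv_pos.2 ha).le,
    Real.mul_rpow (Real.exp_pos b).le (inv_pos.2 hb).le, ← Real.exp_mul, ← Real.exp_mul] at e2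
  rw [Real.inv_rpow ha.le, Real.inv_rpow hb.le] at e1 e2
  have pa : 0 < (1 + Real.exp a) ^ (1 - h) := Real.rpow_pos_of_pos ha _
  have pb : 0 < (1 + Real.exp b) ^ h := Real.rpow_pos_of_pos hb _
  have e3 : 1 + Real.exp ((1 - h) * a + h * b)
      ≤ (1 + Real.exp a) ^ (1 - h) * (1 + Real.exp b) ^ h := by
    have hsum : (1 - h) * (1 + Real.exp a)⁻¹ + h * (1 + Real.exp b)⁻¹ +
        ((1 - h) * (Real.exp a * (1 + Real.exp a)⁻¹) +
          h * (Real.exp b * (1 + Real.exp b)⁻¹)) = 1 := by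
      field_simp
      ring
    have hexp : Real.exp ((1 - h) * a + h * b) = Real.exp (a * (1 - h)) * Real.exp (b * h) := by
      rw [← Real.exp_add]
      congr 1
      ring
    rw [hexp]
    have e4 : ((1 + Real.exp a) ^ (1 - h))⁻¹ * ((1 + Real.exp b) ^ h)⁻¹ *
        (1 + Real.exp (a * (1 - h)) * Real.exp (b * h)) ≤ 1 := by
      calc _ = ((1 + Real.exp a) ^ (1 - h))⁻¹ * ((1 + Real.exp b) ^ h)⁻¹ +
            Real.exp (a * (1 - h)) * ((1 + Real.exp a) ^ (1 - h))⁻¹ *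
              (Real.exp (b * h) * ((1 + Real.exp b) ^ h)⁻¹) := by ring
        _ ≤ _ := add_le_add e1 e2
        _ = 1 := hsum
    rw [← mul_inv, inv_mul_le_iff₀ (by positivity), mul_one] at e4
    exact e4
  have e5 : (1 + Real.exp a) ^ (1 - h) ≤ Real.exp ((1 - h) * (a + Real.exp (-a))) := by
    have : 1 + Real.exp a ≤ Real.exp (a + Real.exp (-a)) := by
      rw [Real.exp_add]
      calc 1 + Real.exp a = Real.exp a * (Real.exp (-a) + 1) := by
            rw [mul_add, ← Real.exp_add]; simp
        _ ≤ _ := by gcongr; exact Real.add_one_le_exp _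
    calc _ ≤ (Real.exp (a + Real.exp (-a))) ^ (1 - h) :=
          Real.rpow_le_rpow ha.le this (sub_nonneg.2 h1)
      _ = _ := by rw [← Real.exp_mul, mul_comm]
  have e6 : (1 + Real.exp b) ^ h ≤ Real.exp (h * Real.exp b) := by
    have : 1 + Real.exp b ≤ Real.exp (Real.exp b) := by
      have := Real.add_one_le_exp (Real.exp b)
      linarith
    calc _ ≤ (Real.exp (Real.exp b)) ^ h := Real.rpow_le_rpow hb.le this h0
      _ = _ := by rw [← Real.exp_mul, mul_comm]
  rw [Real.exp_add ((1 - h) * (a + Real.exp (-a)))]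
  exact e3.trans (mul_le_mul e5 e6 pb.le (Real.exp_pos _).le)

variable {V Ω : Type*} [Fintype V] [DecidableEq V] [Fintype Ω] [DecidableEq Ω] [Nonempty Ω]

lemma exists_hall_violator (R : Finset V) (A : V → Finset Ω) {ℓ : ℕ} (L : V → Fin ℓ → Ω)
    (hno : ¬ ∃ f : V → Ω, Set.InjOn f R ∧ ∀ v ∈ R, f v ∈ A v ∧ ∃ i, L v i = f v) :
    ∃ T ∈ R.powerset, T.Nonempty ∧ ∃ D : Finset Ω, Fintype.card Ω + 1 ≤ D.card + T.card ∧
      ∀ v ∈ T, ∀ i, L v i ∉ D ∩ A v := by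
  classical
  let N : R → Finset Ω := fun v => (A v).filter fun c => ∃ i, L v i = c
  by_cases hall : ∀ S : Finset R, S.card ≤ (S.biUnion N).card
  · obtain ⟨f, hf, hfN⟩ := (Finset.all_card_le_biUnion_card_iff_exists_injective N).1 hall
    refine absurd ⟨fun v => if h : v ∈ R then f ⟨v, h⟩ else Classical.arbitrary Ω, ?_, ?_⟩ hno
    · intro u hu v hv huv
      have hu' : u ∈ R := hu
      have hv' : v ∈ R := hv
      simp only [hu', hv', dif_pos] at huv
      exact congrArg Subtype.val (hf huv)
    · intro v hv
      simp only [hv, dif_pos]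
      exact mem_filter.1 (hfN ⟨v, hv⟩)
  · push Not at hall
    obtain ⟨S, hS⟩ := hall
    refine ⟨S.map (Function.Embedding.subtype _), ?_, ?_, univ \ S.biUnion N, ?_, ?_⟩
    · rw [mem_powerset]
      intro v hv
      obtain ⟨w, _, rfl⟩ := mem_map.1 hv
      exact w.2
    · rw [map_nonempty, nonempty_iff_ne_empty]
      rintro rfl
      simp at hS
    · rw [card_map, card_sdiff_of_subset (subset_univ _), card_univ]
      have := card_le_univ (S.biUnion N)
      omega
    · intro v hv i hi
      obtain ⟨w, hw, rfl⟩ := mem_map.1 hv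
      rw [mem_inter, mem_sdiff] at hi
      exact hi.1.2 (mem_biUnion.2 ⟨w, hw, mem_filter.2 ⟨hi.2, i, rfl⟩⟩)

lemma pr_lists_avoid_le (T : Finset V) (B : V → Finset Ω) (ℓ : ℕ) :
    pr (fun L : V → Fin ℓ → Ω => ∀ v ∈ T, ∀ i, L v i ∉ B v)
      ≤ Real.exp (-(ℓ / Fintype.card Ω * ∑ v ∈ T, ((B v).card : ℝ))) := by
  rw [pr_forall_mem T fun v (l : Fin ℓ → Ω) => ∀ i, l i ∉ B v, mul_sum, ← Finset.sum_neg_distrib,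
    Real.exp_sum]
  refine Finset.prod_le_prod (fun _ _ => pr_nonneg _) fun v _ => ?_
  rw [pr_forall fun _ x => x ∉ B v, prod_const, card_univ, Fintype.card_fin, pr_notMem]
  have h : -((ℓ : ℝ) / Fintype.card Ω * (B v).card)
      = ℓ * (-((B v).card / Fintype.card Ω : ℝ)) := by ring
  rw [h, Real.exp_nat_mul]
  refine pow_le_pow_left₀ ?_ (Real.one_sub_le_exp_neg _) _
  rw [sub_nonneg]
  refine div_le_one_of_le₀ ?_ (Nat.cast_nonneg _)
  exact_mod_cast card_le_univ _

/-- Union bound over color sets for a large set `T` of vertices. -/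
lemma sum_large_le (R T : Finset V) (hTR : T ⊆ R) (hT : T.Nonempty) (A : V → Finset Ω) (ℓ τ : ℝ)
    (hℓ : 0 ≤ ℓ)
    (hτk : Real.exp (-τ) * Fintype.card Ω ≤ 1) (hτ : 0 ≤ τ) (hTk : (Fintype.card Ω : ℝ) ≤ 2 * T.card)
    (hℓτ : Real.exp (τ - ℓ / 2) * Fintype.card Ω ≤ 1)
    (hb : ∑ v ∈ T, ((Fintype.card Ω : ℝ) - (A v).card)
      ≤ T.card * ((Fintype.card Ω : ℝ) - R.card + 1 / 2)) :
    ∑ D ∈ (univ : Finset (Finset Ω)).filter fun D => Fintype.card Ω + 1 ≤ D.card + T.card,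
      Real.exp (-(ℓ / Fintype.card Ω * ∑ v ∈ T, ((D ∩ A v).card : ℝ)))
      ≤ Real.exp (2 - τ / 2) * Real.exp (-τ) ^ (R.card - T.card) := by
  have hκ : (0 : ℝ) < Fintype.card Ω := by exact_mod_cast Fintype.card_pos
  set κ : ℝ := (Fintype.card Ω : ℝ) with hκdef
  have ht : (0 : ℝ) < T.card := by exact_mod_cast hT.card_pos
  set g : Ω → ℝ := fun c => ((T.filter fun v => c ∈ A v).card : ℝ) with hg
  have hsumg : ∀ D : Finset Ω, ∑ v ∈ T, ((D ∩ A v).card : ℝ) = ∑ c ∈ D, g c := by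
    intro D
    simp only [hg]
    have : ∀ v, ((D ∩ A v).card : ℝ) = ∑ c ∈ D, if c ∈ A v then (1 : ℝ) else 0 := by
      intro v
      rw [← Finset.sum_filter, Finset.sum_const, nsmul_eq_mul, mul_one, filter_mem_eq_inter]
    simp_rw [this]
    rw [sum_comm]
    refine Finset.sum_congr rfl fun c _ => ?_
    rw [← Finset.sum_filter, Finset.sum_const, nsmul_eq_mul, mul_one]
  have step1 : ∑ D ∈ (univ : Finset (Finset Ω)).filter fun D => Fintype.card Ω + 1 ≤ D.card + T.card,
      Real.exp (-(ℓ / κ * ∑ v ∈ T, ((D ∩ A v).card : ℝ)))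
      ≤ ∑ D : Finset Ω, Real.exp (-τ * (κ + 1 - T.card)) *
          ∏ c ∈ D, Real.exp (τ - ℓ / κ * g c) := by
    have hterm : ∀ D : Finset Ω, Real.exp (-τ * (κ + 1 - T.card)) *
          ∏ c ∈ D, Real.exp (τ - ℓ / κ * g c)
        = Real.exp (τ * (D.card - (κ + 1 - T.card)) +
            -(ℓ / κ * ∑ v ∈ T, ((D ∩ A v).card : ℝ))) := by
      intro D
      rw [← Real.exp_sum, ← Real.exp_add, hsumg, Finset.sum_sub_distrib, mul_sum]
      congr 1
      simp
      ring
    simp_rw [hterm]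
    refine le_trans (Finset.sum_le_sum fun D hD => ?_)
      (Finset.sum_le_sum_of_subset_of_nonneg (filter_subset _ _) fun _ _ _ => (Real.exp_pos _).le)
    have hD' : κ + 1 ≤ D.card + T.card := by
      rw [hκdef]; exact_mod_cast (mem_filter.1 hD).2
    rw [Real.exp_le_exp]
    have : 0 ≤ τ * (D.card - (κ + 1 - T.card)) := mul_nonneg hτ (by linarith)
    linarith
  refine step1.trans ?_
  rw [← mul_sum]
  have hprod : ∑ D : Finset Ω, ∏ c ∈ D, Real.exp (τ - ℓ / κ * g c)
      = ∏ c, (1 + Real.exp (τ - ℓ / κ * g c)) := by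
    rw [Finset.prod_one_add, powerset_univ]
  rw [hprod]
  set E : ℝ := ∑ c, (1 - g c / T.card) with hE
  have hEle : E ≤ κ - R.card + 1 / 2 := by
    have h1 : T.card * E = ∑ v ∈ T, (κ - (A v).card) := by
      have h2 := hsumg univ
      simp only [univ_inter] at h2
      rw [hE, Finset.sum_sub_distrib, Finset.sum_sub_distrib, h2, mul_sub,
        mul_sum _ fun c => g c / (T.card : ℝ)]
      have : ∀ c, (T.card : ℝ) * (g c / T.card) = g c := fun c => by field_simp
      rw [Finset.sum_congr rfl fun c _ => this c]
      simp [hκdef]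
    rw [← h1] at hb
    exact le_of_mul_le_mul_left hb ht
  have hg1 : ∀ c, g c / T.card ≤ 1 := fun c => by
    rw [div_le_one ht]
    simp only [hg]
    exact_mod_cast card_le_card (filter_subset _ _)
  have hg0 : ∀ c, 0 ≤ g c / T.card := fun c => by positivity
  have hE0 : E ≤ κ := by
    calc E ≤ ∑ c : Ω, (1 : ℝ) := Finset.sum_le_sum fun c _ => by have := hg0 c; linarith
      _ = κ := by simp [hκdef]
  have hfac : ∀ c, 1 + Real.exp (τ - ℓ / κ * g c)
      ≤ Real.exp ((1 - g c / T.card) * (τ + Real.exp (-τ)) + Real.exp (τ - ℓ / 2)) := by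
    intro c
    have h1 := one_add_exp_convex_le (a := τ) (b := τ - ℓ * T.card / κ) (hg0 c) (hg1 c)
    have h2 : (1 - g c / T.card) * τ + g c / T.card * (τ - ℓ * T.card / κ)
        = τ - ℓ / κ * g c := by
      field_simp
      ring
    rw [h2] at h1
    refine h1.trans ?_
    rw [Real.exp_le_exp]
    have h3 : Real.exp (τ - ℓ * T.card / κ) ≤ Real.exp (τ - ℓ / 2) := by
      rw [Real.exp_le_exp]
      have : ℓ / 2 ≤ ℓ * T.card / κ := by
        rw [le_div_iff₀ hκ]
        nlinarith
      linarith
    have h4 : g c / T.card * Real.exp (τ - ℓ * T.card / κ) ≤ 1 * Real.exp (τ - ℓ / 2) :=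
      mul_le_mul (hg1 c) h3 (Real.exp_pos _).le zero_le_one
    linarith
  have hprodle : ∏ c, (1 + Real.exp (τ - ℓ / κ * g c)) ≤ Real.exp (E * τ + 2) := by
    refine (Finset.prod_le_prod (fun c _ => by positivity) fun c _ => hfac c).trans ?_
    rw [← Real.exp_sum, Real.exp_le_exp, Finset.sum_add_distrib, ← Finset.sum_mul, ← hE]
    have h1 : ∑ _c : Ω, Real.exp (τ - ℓ / 2) = Real.exp (τ - ℓ / 2) * κ := by
      simp [hκdef, mul_comm]
    rw [h1]
    have : E * Real.exp (-τ) ≤ κ * Real.exp (-τ) := by gcongr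
    nlinarith
  calc _ ≤ Real.exp (-τ * (κ + 1 - T.card)) * Real.exp (E * τ + 2) := by gcongr
    _ ≤ Real.exp (2 - τ / 2) * Real.exp (-τ) ^ (R.card - T.card) := by
      rw [← Real.exp_nat_mul, ← Real.exp_add, ← Real.exp_add, Real.exp_le_exp,
        Nat.cast_sub (card_le_card hTR)]
      have : E * τ ≤ (κ - R.card + 1 / 2) * τ := by gcongr
      linarith

/-- Union bound over color sets for a small set `T` of vertices. -/
lemma sum_small_le (T : Finset V) (A : V → Finset Ω) (ℓ : ℝ) (hℓ : 0 ≤ ℓ)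
    (hTk : 2 * T.card < Fintype.card Ω)
    (hA : ∀ v ∈ T, 3 * Fintype.card Ω ≤ 4 * (A v).card) :
    ∑ D ∈ (univ : Finset (Finset Ω)).filter fun D => Fintype.card Ω + 1 ≤ D.card + T.card,
      Real.exp (-(ℓ / Fintype.card Ω * ∑ v ∈ T, ((D ∩ A v).card : ℝ)))
      ≤ Real.exp 1 * (Fintype.card Ω * Real.exp (-(ℓ / 4))) ^ T.card := by
  have hκ : (0 : ℝ) < Fintype.card Ω := by exact_mod_cast Fintype.card_pos
  have hκ1 : (1 : ℝ) ≤ Fintype.card Ω := by exact_mod_cast Fintype.card_pos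
  set k := Fintype.card Ω with hk
  have hterm : ∀ D ∈ (univ : Finset (Finset Ω)).filter fun D => k + 1 ≤ D.card + T.card,
      Real.exp (-(ℓ / k * ∑ v ∈ T, ((D ∩ A v).card : ℝ))) ≤ Real.exp (-(ℓ / 4)) ^ T.card := by
    intro D hD
    have hD := (mem_filter.1 hD).2
    rw [← Real.exp_nat_mul, Real.exp_le_exp]
    have h1 : T.card * ((k : ℝ) / 4) ≤ ∑ v ∈ T, ((D ∩ A v).card : ℝ) := by
      rw [← nsmul_eq_mul]
      refine Finset.card_nsmul_le_sum _ _ _ fun v hv => ?_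
      have h2 := hA v hv
      have h3 := card_union_add_card_inter D (A v)
      have h4 := card_le_univ (D ∪ A v)
      have h5 : k ≤ 4 * (D ∩ A v).card := by omega
      have : (k : ℝ) ≤ 4 * (D ∩ A v).card := by exact_mod_cast h5
      linarith
    calc -(ℓ / k * ∑ v ∈ T, ((D ∩ A v).card : ℝ)) ≤ -(ℓ / k * (T.card * ((k : ℝ) / 4))) := by
          gcongr
      _ = _ := by field_simp
  have hcard : (((univ : Finset (Finset Ω)).filter fun D => k + 1 ≤ D.card + T.card).card : ℝ)
      ≤ Real.exp 1 * (k : ℝ) ^ T.card := by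
    have h1 : ((univ : Finset (Finset Ω)).filter fun D => k + 1 ≤ D.card + T.card).card
        ≤ ((univ : Finset Ω).powerset.filter fun D => D.card ≤ T.card).card := by
      refine card_le_card_of_injOn compl ?_ fun _ _ _ _ h => compl_injective h
      intro D hD
      have hD := (mem_filter.1 hD).2
      simp only [coe_filter, powerset_univ, mem_univ, true_and, Set.mem_ofPred_eq, card_compl]
      omega
    have h2 := card_filter_card_le_le (univ : Finset Ω) T.card hκ1
    have h3 : (1 + (k : ℝ)⁻¹) ^ (univ : Finset Ω).card ≤ Real.exp 1 := by
      rw [card_univ, ← hk]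
      calc (1 + (k : ℝ)⁻¹) ^ k ≤ (Real.exp (k : ℝ)⁻¹) ^ k := by
            gcongr
            rw [add_comm]
            exact Real.add_one_le_exp _
        _ = Real.exp 1 := by
            rw [← Real.exp_nat_mul]
            congr 1
            field_simp
    calc _ ≤ _ := by exact_mod_cast h1
      _ ≤ _ := h2
      _ ≤ (k : ℝ) ^ T.card * Real.exp 1 := by gcongr
      _ = _ := mul_comm _ _
  refine (Finset.sum_le_card_nsmul _ _ _ hterm).trans ?_
  rw [nsmul_eq_mul, mul_pow, ← mul_assoc]
  gcongr

/-- Random lists allow an injective coloring of `R` with high probability. -/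
lemma pr_no_injective_coloring_le (R : Finset V) (A : V → Finset Ω) (ℓ : ℕ) (τ : ℝ)
    (hτ : 0 ≤ τ) (hτk : Real.exp (-τ) * Fintype.card Ω ≤ 1) (hτR : Real.exp (-τ) * R.card ≤ 1)
    (hℓτ : Real.exp (τ - ℓ / 2) * Fintype.card Ω ≤ 1)
    (hℓ : R.card * (Fintype.card Ω * Real.exp (-(ℓ / 4))) ≤ 1)
    (hA : ∀ v ∈ R, 3 * Fintype.card Ω ≤ 4 * (A v).card)
    (hb : ∀ T ⊆ R, Fintype.card Ω ≤ 2 * T.card →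
      ∑ v ∈ T, ((Fintype.card Ω : ℝ) - (A v).card)
        ≤ T.card * ((Fintype.card Ω : ℝ) - R.card + 1 / 2)) :
    pr (fun L : V → Fin ℓ → Ω =>
        ¬ ∃ f : V → Ω, Set.InjOn f R ∧ ∀ v ∈ R, f v ∈ A v ∧ ∃ i, L v i = f v)
      ≤ Real.exp 1 * (2 * (R.card * (Fintype.card Ω * Real.exp (-(ℓ / 4))))) +
        Real.exp (3 - τ / 2) := by
  set x : ℝ := Fintype.card Ω * Real.exp (-((ℓ : ℝ) / 4)) with hx
  have hx0 : 0 ≤ x := by positivity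
  let Ds : Finset V → Finset (Finset Ω) := fun T =>
    univ.filter fun D => Fintype.card Ω + 1 ≤ D.card + T.card
  let w : Finset V → ℝ := fun T => ∑ D ∈ Ds T,
      Real.exp (-((ℓ : ℝ) / Fintype.card Ω * ∑ v ∈ T, ((D ∩ A v).card : ℝ)))
  have h1 : pr (fun L : V → Fin ℓ → Ω =>
        ¬ ∃ f : V → Ω, Set.InjOn f R ∧ ∀ v ∈ R, f v ∈ A v ∧ ∃ i, L v i = f v)
      ≤ ∑ T ∈ R.powerset.erase ∅, w T := by
    refine (pr_mono (q := fun L => ∃ T ∈ R.powerset.erase ∅, ∃ D ∈ Ds T,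
      ∀ v ∈ T, ∀ i, L v i ∉ D ∩ A v) fun L hL => ?_).trans ?_
    · obtain ⟨T, hT, hne, D, hD, h⟩ := exists_hall_violator R A L hL
      exact ⟨T, mem_erase.2 ⟨hne.ne_empty, hT⟩, D, mem_filter.2 ⟨mem_univ _, hD⟩, h⟩
    · refine (pr_exists_le _ _).trans (Finset.sum_le_sum fun T _ => ?_)
      refine (pr_exists_le _ _).trans (Finset.sum_le_sum fun D _ => ?_)
      exact pr_lists_avoid_le T (fun v => D ∩ A v) ℓ
  have h2 : ∀ T ∈ R.powerset.erase ∅, w T ≤ Real.exp 1 * x ^ T.card +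
      Real.exp (2 - τ / 2) * (Real.exp (-τ) ^ (R.card - T.card)) := by
    intro T hT
    obtain ⟨hne, hT⟩ := mem_erase.1 hT
    rw [mem_powerset] at hT
    by_cases hc : 2 * T.card < Fintype.card Ω
    · have := sum_small_le T A ℓ (Nat.cast_nonneg _) hc fun v hv => hA v (hT hv)
      refine this.trans (le_add_of_nonneg_right ?_)
      positivity
    · rw [not_lt] at hc
      have := sum_large_le R T hT (nonempty_iff_ne_empty.2 hne) A ℓ τ (Nat.cast_nonneg _) hτk hτ
        (by exact_mod_cast hc) hℓτ (hb T hT hc)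
      refine this.trans (le_add_of_nonneg_left ?_)
      positivity
  have h3 : ∑ T ∈ R.powerset.erase ∅, x ^ T.card ≤ 2 * (R.card * x) := by
    have hs : ∑ T ∈ R.powerset, x ^ T.card = (1 + x) ^ R.card := by
      have := Finset.sum_pow_mul_eq_add_pow x 1 R
      simp only [one_pow, mul_one] at this
      rw [this, add_comm]
    have hs2 : ∑ T ∈ R.powerset.erase ∅, x ^ T.card = (1 + x) ^ R.card - 1 := by
      rw [← hs, ← Finset.add_sum_erase R.powerset (fun T => x ^ T.card) (empty_mem_powerset R)]
      simp
    rw [hs2]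
    have h4 : (1 + x) ^ R.card ≤ Real.exp (R.card * x) := by
      rw [Real.exp_nat_mul]
      gcongr
      rw [add_comm]
      exact Real.add_one_le_exp _
    have h5 := Real.abs_exp_sub_one_le (x := R.card * x) (by rwa [abs_of_nonneg (by positivity)])
    rw [abs_of_nonneg (show (0 : ℝ) ≤ R.card * x by positivity)] at h5
    have := le_abs_self (Real.exp (R.card * x) - 1)
    linarith
  have h6 : ∑ T ∈ R.powerset.erase ∅, Real.exp (-τ) ^ (R.card - T.card) ≤ Real.exp 1 := by
    have hs : ∑ T ∈ R.powerset, Real.exp (-τ) ^ (R.card - T.card)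
        = (1 + Real.exp (-τ)) ^ R.card := by
      have := Finset.sum_pow_mul_eq_add_pow 1 (Real.exp (-τ)) R
      simpa only [one_pow, one_mul] using this
    calc _ ≤ ∑ T ∈ R.powerset, Real.exp (-τ) ^ (R.card - T.card) :=
          Finset.sum_le_sum_of_subset_of_nonneg (erase_subset _ _) fun _ _ _ => by positivity
      _ = (1 + Real.exp (-τ)) ^ R.card := hs
      _ ≤ Real.exp (Real.exp (-τ)) ^ R.card := by
          gcongr
          rw [add_comm]
          exact Real.add_one_le_exp _
      _ ≤ Real.exp 1 := by
          rw [← Real.exp_nat_mul, Real.exp_le_exp]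
          linarith
  calc _ ≤ _ := h1
    _ ≤ _ := Finset.sum_le_sum h2
    _ = Real.exp 1 * ∑ T ∈ R.powerset.erase ∅, x ^ T.card + Real.exp (2 - τ / 2) *
        ∑ T ∈ R.powerset.erase ∅, Real.exp (-τ) ^ (R.card - T.card) := by
      rw [Finset.sum_add_distrib, mul_sum, mul_sum]
    _ ≤ Real.exp 1 * (2 * (R.card * x)) + Real.exp (2 - τ / 2) * Real.exp 1 := by gcongr
    _ = _ := by
      rw [← Real.exp_add (2 - τ / 2)]
      congr 2
      ring

end Hall

section Clique

variable {V Ω : Type*} [Fintype V] [DecidableEq V] [Fintype Ω] [DecidableEq Ω] [Nonempty Ω]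

/-- Combining a colorful matching with an injective coloring of the unmatched vertices. -/
lemma exists_coloring_of_colorful (G : SimpleGraph V) (K : Finset V) (A : V → Finset Ω)
    (has has' : V → Ω → Prop) (T : Finset (V × V × Ω))
    (hT : IsColorful (fun u w => u ≠ w ∧ ¬ G.Adj u w) K A has T) (g : V → Ω)
    (hinj : Set.InjOn g (K \ (T.image (fun t => t.1) ∪ T.image (fun t => t.2.1)) : Finset V))
    (hg : ∀ v ∈ K \ (T.image (fun t => t.1) ∪ T.image (fun t => t.2.1)),
      g v ∈ A v \ T.image (fun t => t.2.2) ∧ has' v (g v)) :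
    ∃ f : V → Ω, (∀ u ∈ K, ∀ w ∈ K, G.Adj u w → f u ≠ f w) ∧
      ∀ v ∈ K, f v ∈ A v ∧ (has v (f v) ∨ has' v (f v)) := by
  classical
  set U := T.image (fun t => t.1) ∪ T.image (fun t => t.2.1) with hU
  have hUt : ∀ v, ∃ t : V × V × Ω, v ∈ U → t ∈ T ∧ (t.1 = v ∨ t.2.1 = v) := by
    intro v
    by_cases hv : v ∈ U
    · rcases mem_union.1 hv with h | h <;> obtain ⟨t, ht, rfl⟩ := mem_image.1 h
      · exact ⟨t, fun _ => ⟨ht, Or.inl rfl⟩⟩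
      · exact ⟨t, fun _ => ⟨ht, Or.inr rfl⟩⟩
    · exact ⟨(v, v, Classical.arbitrary Ω), fun h => absurd h hv⟩
  choose t ht using hUt
  have htT := fun v hv => (ht v hv).1
  have htv := fun v hv => (ht v hv).2
  have hR : ∀ v ∈ K, v ∉ U → v ∈ K \ U := fun v h h' => mem_sdiff.2 ⟨h, h'⟩
  refine ⟨fun v => if v ∈ U then (t v).2.2 else g v, ?_, ?_⟩
  · intro u hu w hw huw heq
    by_cases h1 : u ∈ U <;> by_cases h2 : w ∈ U <;> simp only [h1, h2, if_true, if_false] at heq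
    · by_cases hst : t u = t w
      · have hr := hT.rel _ (htT u h1)
        rcases htv u h1 with e1 | e1 <;> rcases htv w h2 with e2 | e2
        · exact huw.ne (by rw [← e1, ← e2, hst])
        · rw [← hst] at e2
          rw [e1, e2] at hr
          exact hr.2 huw
        · rw [← hst] at e2
          rw [e1, e2] at hr
          exact hr.2 huw.symm
        · exact huw.ne (by rw [← e1, ← e2, hst])
      · exact hT.color_ne _ (htT u h1) _ (htT w h2) hst heq
    · have := (hg w (hR w hw h2)).1
      rw [← heq] at this
      exact (mem_sdiff.1 this).2 (mem_image_of_mem _ (htT u h1))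
    · have := (hg u (hR u hu h1)).1
      rw [heq] at this
      exact (mem_sdiff.1 this).2 (mem_image_of_mem _ (htT w h2))
    · exact huw.ne (hinj (hR u hu h1) (hR w hw h2) heq)
  · intro v hv
    by_cases h : v ∈ U
    · simp only [h, if_true]
      have hc := mem_inter.1 (hT.color_mem _ (htT v h))
      rcases htv v h with e | e
      · have := hT.has_left _ (htT v h)
        rw [e] at this hc
        exact ⟨hc.1, Or.inl this⟩
      · have := hT.has_right _ (htT v h)
        rw [e] at this hc
        exact ⟨hc.2, Or.inl this⟩
    · simp only [h, if_false]
      exact ⟨(mem_sdiff.1 (hg v (hR v hv h)).1).1, Or.inr (hg v (hR v hv h)).2⟩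

lemma IsColorful.card_verts {r : V → V → Prop} (hirr : ∀ u, ¬ r u u) {K : Finset V}
    {A : V → Finset Ω} {has : V → Ω → Prop} {T : Finset (V × V × Ω)} (h : IsColorful r K A has T) :
    (T.image (fun t => t.1) ∪ T.image (fun t => t.2.1)).card = 2 * T.card := by
  rw [card_union_of_disjoint, card_image_of_injOn, card_image_of_injOn]
  · ring
  · intro s hs t ht hst
    by_contra hne
    exact h.right_ne s hs t ht hne hst
  · intro s hs t ht hst
    by_contra hne
    exact h.left_ne s hs t ht hne hst
  · rw [disjoint_left]
    intro x hx hx'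
    obtain ⟨s, hs, rfl⟩ := mem_image.1 hx
    obtain ⟨t, ht, hst⟩ := mem_image.1 hx'
    by_cases hne : s = t
    · subst hne
      have := h.rel s hs
      rw [hst] at this
      exact hirr _ this
    · exact h.left_ne_right s hs t ht hne hst.symm

/-- The color `c` appears in one of the two parts of the list `l`. -/
def inList {ℓ₁ ℓ₂ : ℕ} (l : (Fin ℓ₁ → Ω) × (Fin ℓ₂ → Ω)) (c : Ω) : Prop :=
  (∃ i, l.1 i = c) ∨ ∃ i, l.2 i = c

lemma sum_deficit_le (K T : Finset V) (k M : ℕ) (b b' f : V → ℝ) (m : ℝ)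
    (hb' : ∀ v ∈ T, b' v ≤ b v + M) (hb : ∀ v ∈ T, b v + K.card ≤ f v + k) (hm : ∑ v ∈ T, f v ≤ m)
    (hM : 4 * m ≤ k * (M + 1)) (hT : (k : ℝ) ≤ 2 * T.card) :
    ∑ v ∈ T, b' v ≤ T.card * ((k : ℝ) - (K.card - 2 * M) + 1 / 2) := by
  have h1 : ∑ v ∈ T, b' v ≤ ∑ v ∈ T, (f v + (k - K.card + M)) :=
    Finset.sum_le_sum fun v hv => by linarith [hb' v hv, hb v hv]
  rw [Finset.sum_add_distrib, Finset.sum_const, nsmul_eq_mul] at h1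
  have hM0 : (0 : ℝ) ≤ M := Nat.cast_nonneg _
  have hT0 : (0 : ℝ) ≤ T.card := Nat.cast_nonneg _
  have h2 : m ≤ T.card * (M + 1 / 2) := by
    have : (k : ℝ) * (M + 1) ≤ 2 * T.card * (M + 1) := by gcongr
    nlinarith
  linarith

/-- Almost-cliques can be colored from random lists with high probability. -/
lemma pr_clique_fail_le (G : SimpleGraph V) [DecidableRel G.Adj] (K : Finset V) (A : V → Finset Ω)
    {k : ℕ} (hkΩ : Fintype.card Ω = k) (hk : 32 ≤ k) (ℓ₁ ℓ₂ : ℕ) (lam B : ℝ) (hB : 1 ≤ B)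
    (hlam : 0 ≤ lam) (hℓ₁ : 320 * (12 + B) * lam ≤ ℓ₁) (hℓ₂ : 4 * (B + 2) * lam ≤ ℓ₂)
    (hkn : (k : ℝ) ≤ Real.exp lam) (hKn : (K.card : ℝ) ≤ Real.exp lam)
    (hA : ∀ v ∈ K, 32 * k ≤ 32 * (A v).card + k)
    (hf : ∀ v ∈ K, 32 * (K.filter fun w => v ≠ w ∧ ¬ G.Adj v w).card ≤ k)
    (hbal : ∀ v ∈ K, K.card ≤ (K.filter fun w => v ≠ w ∧ ¬ G.Adj v w).card + (A v).card) :
    pr (fun L : V → (Fin ℓ₁ → Ω) × (Fin ℓ₂ → Ω) =>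
      ¬ ∃ f : V → Ω, (∀ u ∈ K, ∀ w ∈ K, G.Adj u w → f u ≠ f w) ∧
        ∀ v ∈ K, f v ∈ A v ∧ inList (L v) (f v))
      ≤ 3 * Real.exp (3 - B * lam / 4) := by
  classical
  set r : V → V → Prop := fun u w => u ≠ w ∧ ¬ G.Adj u w with hr
  have hsymm : ∀ u w, r u w → r w u := fun u w h => ⟨h.1.symm, fun h' => h.2 h'.symm⟩
  have hirr : ∀ u, ¬ r u u := fun u h => h.1 rfl
  have hk0 : 0 < k := by omega
  have hkR : (0 : ℝ) < k := by exact_mod_cast hk0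
  set m := numPairs r K with hm
  set M := 4 * m / k with hM
  have hMk : M * k ≤ 4 * m := Nat.div_mul_le_self _ _
  have hMk' : 4 * m < k * (M + 1) := Nat.lt_mul_div_succ _ hk0
  have hdeg : ∀ u ∈ K, (K.filter fun w => r u w).card ≤ k / 32 := fun u hu => by
    have := hf u hu
    change 32 * (K.filter fun w => r u w).card ≤ k at this
    omega
  have hmle : m ≤ K.card * (k / 32) := Finset.sum_le_card_nsmul _ _ _ hdeg
  have hM8 : 8 * M ≤ K.card := by
    have h1 : 32 * m ≤ K.card * k := by
      have : K.card * (k / 32 * 32) ≤ K.card * k := Nat.mul_le_mul_left _ (Nat.div_mul_le_self _ _)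
      linarith
    have h2 : 8 * M * k ≤ K.card * k := by linarith
    exact Nat.le_of_mul_le_mul_right h2 hk0
  have hKk : K.Nonempty → 32 * K.card ≤ 33 * k := by
    rintro ⟨v, hv⟩
    have h1 := hf v hv
    have h2 := hbal v hv
    have h3 := card_le_univ (A v)
    omega
  have hMk3 : 256 * M ≤ 33 * k := by
    rcases K.eq_empty_or_nonempty with h | h
    · have : K.card = 0 := by simp [h]
      omega
    · have := hKk h
      omega
  -- the two parts are independent
  let e : (V → (Fin ℓ₁ → Ω) × (Fin ℓ₂ → Ω)) ≃ (V → Fin ℓ₁ → Ω) × (V → Fin ℓ₂ → Ω) :=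
    Equiv.arrowProdEquivProdArrow V (fun _ => Fin ℓ₁ → Ω) (fun _ => Fin ℓ₂ → Ω)
  let has₁ : (V → Fin ℓ₁ → Ω) → V → Ω → Prop := fun X v c => ∃ i, X v i = c
  let has₂ : (V → Fin ℓ₂ → Ω) → V → Ω → Prop := fun X v c => ∃ i, X v i = c
  let Rest : Finset (V × V × Ω) → Finset V := fun T =>
    K \ (T.image (fun t => t.1) ∪ T.image (fun t => t.2.1))
  let Inj : Finset (V × V × Ω) → (V → Fin ℓ₂ → Ω) → Prop := fun T X =>
    ∃ g : V → Ω, Set.InjOn g (Rest T) ∧ ∀ v ∈ Rest T, g v ∈ A v \ T.image (fun t => t.2.2) ∧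
      ∃ i, X v i = g v
  let P₁ : (V → Fin ℓ₁ → Ω) × (V → Fin ℓ₂ → Ω) → Prop := fun z =>
    ¬ ∃ T, IsColorful r K A (has₁ z.1) T ∧ T.card = M
  let P₂ : (V → Fin ℓ₁ → Ω) × (V → Fin ℓ₂ → Ω) → Prop := fun z =>
    ∃ T, IsColorful r K A (has₁ z.1) T ∧ T.card = M ∧ ∀ T, IsColorful r K A (has₁ z.1) T ∧
      T.card = M → ¬ Inj T z.2
  have hsplit : pr (fun L : V → (Fin ℓ₁ → Ω) × (Fin ℓ₂ → Ω) =>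
      ¬ ∃ f : V → Ω, (∀ u ∈ K, ∀ w ∈ K, G.Adj u w → f u ≠ f w) ∧
        ∀ v ∈ K, f v ∈ A v ∧ inList (L v) (f v)) ≤ pr P₁ + pr P₂ := by
    refine le_trans ?_ (pr_or_le P₁ P₂)
    rw [← pr_equiv e]
    refine pr_mono fun L hL => ?_
    by_cases h : P₁ (e L)
    · exact Or.inl h
    · refine Or.inr ?_
      have h' := not_not.1 h
      obtain ⟨T, hT, hTc⟩ := h'
      refine ⟨T, hT, hTc, ?_⟩
      rintro T' ⟨hT', -⟩ ⟨g, hinj, hg⟩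
      exact hL (exists_coloring_of_colorful G K A (has₁ (e L).1) (has₂ (e L).2) T' hT' g hinj hg)
  have hP₁ : pr P₁ ≤ Real.exp (2 - B * lam / 4) := by
    have h1 : pr P₁ = pr (fun X : V → Fin ℓ₁ → Ω =>
        ¬ ∃ T, IsColorful r K A (has₁ X) T ∧ T.card = M) :=
      pr_fst fun X : V → Fin ℓ₁ → Ω => ¬ ∃ T, IsColorful r K A (has₁ X) T ∧ T.card = M
    rw [h1]
    rcases Nat.eq_zero_or_pos M with hM0 | hM0
    · rw [pr_false]
      · exact (Real.exp_pos _).le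
      · intro X hX
        refine hX ⟨∅, ?_, by simp [hM0]⟩
        constructor <;> simp
    · have h2 := pr_no_colorful_le r hsymm hirr K A univ (fun _ => subset_univ _) k (k / 32) M ℓ₁
        (by omega) hkΩ.ge (by omega) hdeg ?_ ?_ (θ := Real.exp lam) (Real.one_le_exp hlam)
      · refine h2.trans ?_
        rw [hkΩ, card_univ, hkΩ]
        have h3 : (1 + (Real.exp lam)⁻¹) ^ (K.card + k) ≤ Real.exp 2 := by
          calc (1 + (Real.exp lam)⁻¹) ^ (K.card + k)
              ≤ Real.exp ((Real.exp lam)⁻¹) ^ (K.card + k) := by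
                gcongr
                rw [add_comm]
                exact Real.add_one_le_exp _
            _ ≤ Real.exp 2 := by
                rw [← Real.exp_nat_mul, Real.exp_le_exp, ← div_eq_mul_inv,
                  div_le_iff₀ (Real.exp_pos _)]
                push_cast
                linarith
        have hρ : (1 : ℝ) / 4 ≤ m / k := by
          rw [le_div_iff₀ hkR]
          have h5 : k ≤ 4 * m := by nlinarith
          have : (k : ℝ) ≤ 4 * m := by exact_mod_cast h5
          linarith
        have hMρ : (M : ℝ) ≤ 4 * (m / k) := by
          rw [← mul_div_assoc, le_div_iff₀ hkR]
          exact_mod_cast hMk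
        calc Real.exp lam ^ (3 * M) * (1 + (Real.exp lam)⁻¹) ^ (K.card + k) *
              Real.exp (-(ℓ₁ * (k * m / (320 * (k : ℝ) ^ 2))))
            ≤ Real.exp lam ^ (3 * M) * Real.exp 2 *
              Real.exp (-(ℓ₁ * (k * m / (320 * (k : ℝ) ^ 2)))) := by gcongr
          _ ≤ _ := by
            rw [← Real.exp_nat_mul, ← Real.exp_add, ← Real.exp_add, Real.exp_le_exp]
            have h6 : (k : ℝ) * m / (320 * (k : ℝ) ^ 2) = (m / k) / 320 := by field_simp
            rw [h6]
            set ρ : ℝ := (m : ℝ) / k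
            push_cast
            have h7 : 320 * (12 + B) * lam * (ρ / 320) ≤ ℓ₁ * (ρ / 320) := by gcongr
            have h8 : (M : ℝ) * lam ≤ 4 * ρ * lam := by gcongr
            have h9 : 1 / 4 * (B * lam) ≤ ρ * (B * lam) := by gcongr
            nlinarith
      · have h1 : k / 32 * 32 ≤ k := Nat.div_mul_le_self _ _
        have h2 : M * (k / 32 * 32) ≤ M * k := Nat.mul_le_mul_left _ h1
        nlinarith
      · intro u hu w hw _
        have h1 := hA u hu
        have h2 := hA w hw
        have h3 := card_union_add_card_inter (A u) (A w)
        have h4 := card_le_univ (A u ∪ A w)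
        omega
  have hP₂ : pr P₂ ≤ Real.exp 1 * (2 * Real.exp (-(B * lam))) + Real.exp (3 - B * lam / 2) := by
    refine pr_prod_le fun X => ?_
    by_cases hX : ∃ T, IsColorful r K A (has₁ X) T ∧ T.card = M
    · obtain ⟨T, hT, hTc⟩ := hX
      refine (pr_mono (q := fun Y => ¬ Inj T Y) fun Y hY => ?_).trans ?_
      · obtain ⟨-, -, -, h⟩ := hY
        exact h T ⟨hT, hTc⟩
      set R := Rest T with hR
      have hRK : R ⊆ K := sdiff_subset
      have hRc : R.card + 2 * M = K.card := by
        have h1 := hT.card_verts hirr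
        rw [hTc] at h1
        rw [← h1, hR]
        refine card_sdiff_add_card_eq_card ?_
        refine union_subset ?_ ?_ <;> intro x hx <;> obtain ⟨t, ht, rfl⟩ := mem_image.1 hx
        · exact hT.1 t ht
        · exact hT.2 t ht
      have hD : (T.image fun t => t.2.2).card ≤ M := card_image_le.trans hTc.le
      have hA' : ∀ v, (A v).card ≤ (A v \ T.image fun t => t.2.2).card + M := fun v => by
        have := le_card_sdiff (T.image fun t => t.2.2) (A v)
        omega
      have hRn : (R.card : ℝ) ≤ Real.exp lam := by
        refine le_trans ?_ hKn
        exact_mod_cast card_le_card hRK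
      have hBl : lam ≤ B * lam := by nlinarith
      have hsmall : (R.card : ℝ) * (Fintype.card Ω * Real.exp (-(ℓ₂ / 4)))
          ≤ Real.exp (-(B * lam)) := by
        rw [hkΩ]
        calc (R.card : ℝ) * (k * Real.exp (-(ℓ₂ / 4)))
            ≤ Real.exp lam * (Real.exp lam * Real.exp (-(ℓ₂ / 4))) := by gcongr
          _ ≤ _ := by
            rw [← Real.exp_add, ← Real.exp_add, Real.exp_le_exp]
            linarith
      refine (pr_no_injective_coloring_le R (fun v => A v \ T.image fun t => t.2.2) ℓ₂ (B * lam)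
        (by positivity) ?_ ?_ ?_ ?_ ?_ ?_).trans ?_
      · rw [hkΩ]
        calc Real.exp (-(B * lam)) * k ≤ Real.exp (-(B * lam)) * Real.exp lam := by gcongr
          _ ≤ 1 := by
            rw [← Real.exp_add, Real.exp_le_one_iff]
            linarith
      · calc Real.exp (-(B * lam)) * R.card ≤ Real.exp (-(B * lam)) * Real.exp lam := by gcongr
          _ ≤ 1 := by
            rw [← Real.exp_add, Real.exp_le_one_iff]
            linarith
      · rw [hkΩ]
        calc Real.exp (B * lam - ℓ₂ / 2) * k ≤ Real.exp (B * lam - ℓ₂ / 2) * Real.exp lam := by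
              gcongr
          _ ≤ 1 := by
            rw [← Real.exp_add, Real.exp_le_one_iff]
            nlinarith
      · refine hsmall.trans ?_
        rw [Real.exp_le_one_iff]
        have : 0 ≤ B * lam := by positivity
        linarith
      · intro v hv
        have h1 := hA v (hRK hv)
        have h2 := hA' v
        omega
      · intro S hS hSk
        have h1 : (R.card : ℝ) = K.card - 2 * M := by
          rw [← hRc]; push_cast; ring
        rw [h1]
        rw [hkΩ] at hSk ⊢
        refine sum_deficit_le K S k M (fun v => (k : ℝ) - (A v).card) _
          (fun v => ((K.filter fun w => v ≠ w ∧ ¬ G.Adj v w).card : ℝ)) m ?_ ?_ ?_ ?_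
          (by exact_mod_cast hSk)
        · intro v _
          have : ((A v).card : ℝ) ≤ (A v \ T.image fun t => t.2.2).card + M := by
            exact_mod_cast hA' v
          linarith
        · intro v hv
          have : (K.card : ℝ) ≤ (K.filter fun w => v ≠ w ∧ ¬ G.Adj v w).card + (A v).card := by
            exact_mod_cast hbal v (hRK (hS hv))
          linarith
        · rw [hm, numPairs]
          push_cast
          exact Finset.sum_le_sum_of_subset_of_nonneg (hS.trans hRK)
            fun _ _ _ => Nat.cast_nonneg _
        · exact_mod_cast hMk'.le
      · gcongr
    · rw [pr_false]
      · positivity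
      · rintro Y ⟨T, hT, hTc, -⟩
        exact hX ⟨T, hT, hTc⟩
  have hBl : 0 ≤ B * lam := by positivity
  have h1 : Real.exp (2 - B * lam / 4) ≤ Real.exp (3 - B * lam / 4) := by
    rw [Real.exp_le_exp]; linarith
  have h2 : Real.exp (3 - B * lam / 2) ≤ Real.exp (3 - B * lam / 4) := by
    rw [Real.exp_le_exp]; linarith
  have h3 : Real.exp 1 * (2 * Real.exp (-(B * lam))) ≤ Real.exp (3 - B * lam / 4) := by
    have h4 : (2 : ℝ) ≤ Real.exp 1 := by have := Real.add_one_le_exp (1 : ℝ); linarith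
    calc Real.exp 1 * (2 * Real.exp (-(B * lam)))
        ≤ Real.exp 1 * (Real.exp 1 * Real.exp (-(B * lam))) := by gcongr
      _ ≤ _ := by
        rw [← Real.exp_add, ← Real.exp_add, Real.exp_le_exp]
        linarith
  linarith

end Clique

section Triples

variable {V Z : Type*} [Fintype V] [DecidableEq V] [Fintype Z] [DecidableEq Z] [Nonempty Z]

lemma pr_triples_le (Q : Finset Z) (Tr : Finset (Finset V)) (hTr : ∀ t ∈ Tr, t.card = 3) :
    pr (fun X : V → Z => ∀ z ∈ Q, ∃ t ∈ Tr, ∀ v ∈ t, X v = z)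
      ≤ (Tr.card / (Fintype.card Z : ℝ) ^ 3) ^ Q.card := by
  induction Q using Finset.induction_on generalizing Tr with
  | empty => simpa using pr_le_one _
  | insert z Q hz ih =>
    have hκ : (0 : ℝ) < Fintype.card Z := by exact_mod_cast Fintype.card_pos
    let D : Finset V → Finset (Finset V) := fun t => Tr.filter fun t' => Disjoint t' t
    have h1 : pr (fun X : V → Z => ∀ z' ∈ insert z Q, ∃ t ∈ Tr, ∀ v ∈ t, X v = z')
        ≤ pr (fun X : V → Z => ∃ t ∈ Tr, (∀ v ∈ t, X v = z) ∧
            ∀ z' ∈ Q, ∃ t' ∈ D t, ∀ v ∈ t', X v = z') := by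
      refine pr_mono fun X hX => ?_
      obtain ⟨t, ht, htX⟩ := hX z (mem_insert_self _ _)
      refine ⟨t, ht, htX, fun z' hz' => ?_⟩
      obtain ⟨t', ht', htX'⟩ := hX z' (mem_insert_of_mem hz')
      refine ⟨t', mem_filter.2 ⟨ht', disjoint_left.2 fun v hv hv' => ?_⟩, htX'⟩
      have : z = z' := by rw [← htX v hv', ← htX' v hv]
      exact hz (this ▸ hz')
    refine h1.trans ((pr_exists_le _ _).trans ?_)
    have h2 : ∀ t ∈ Tr, pr (fun X : V → Z => (∀ v ∈ t, X v = z) ∧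
            ∀ z' ∈ Q, ∃ t' ∈ D t, ∀ v ∈ t', X v = z')
        ≤ ((Fintype.card Z : ℝ) ^ 3)⁻¹ * (Tr.card / (Fintype.card Z : ℝ) ^ 3) ^ Q.card := by
      intro t ht
      rw [pr_and_of_disjoint_support t]
      · have h3 : pr (fun X : V → Z => ∀ v ∈ t, X v = z) = ((Fintype.card Z : ℝ) ^ 3)⁻¹ := by
          rw [pr_forall_mem t fun _ x => x = z]
          have h4 : pr (fun x : Z => x = z) = (Fintype.card Z : ℝ)⁻¹ := by
            have := pr_mem ({z} : Finset Z)
            simp only [mem_singleton, card_singleton, Nat.cast_one, one_div] at this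
            exact this
          rw [h4, prod_const, hTr t ht, inv_pow]
        rw [h3]
        gcongr
        refine (ih (D t) fun t' ht' => hTr t' (mem_filter.1 ht').1).trans ?_
        gcongr
        exact filter_subset _ _
      · intro X Y hXY
        exact forall₂_congr fun v hv => by rw [hXY v hv]
      · intro X Y hXY
        refine forall₂_congr fun z' _ => exists_congr fun t' => and_congr_right fun ht' =>
          forall₂_congr fun v hv => ?_
        rw [hXY v (disjoint_left.1 (mem_filter.1 ht').2 hv)]
    refine (Finset.sum_le_card_nsmul _ _ _ h2).trans (le_of_eq ?_)
    rw [card_insert_of_notMem hz, nsmul_eq_mul, pow_succ]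
    ring

open Classical in
lemma pr_many_triples_le (Pal : Finset Z) (Tr : Finset (Finset V)) (hTr : ∀ t ∈ Tr, t.card = 3)
    (q : ℕ) :
    pr (fun X : V → Z => q ≤ (Pal.filter fun z => ∃ t ∈ Tr, ∀ v ∈ t, X v = z).card)
      ≤ Real.exp (-(2 * q)) *
        (1 + Real.exp 2 * (Tr.card / (Fintype.card Z : ℝ) ^ 3)) ^ Pal.card := by
  set x : ℝ := Tr.card / (Fintype.card Z : ℝ) ^ 3 with hx
  have hx0 : 0 ≤ x := by positivity
  have h1 : pr (fun X : V → Z => q ≤ (Pal.filter fun z => ∃ t ∈ Tr, ∀ v ∈ t, X v = z).card)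
      ≤ pr (fun X : V → Z => ∃ Q ∈ Pal.powerset.filter fun Q => q ≤ Q.card,
          ∀ z ∈ Q, ∃ t ∈ Tr, ∀ v ∈ t, X v = z) :=
    pr_mono fun X hX => ⟨_, mem_filter.2 ⟨mem_powerset.2 (filter_subset _ _), hX⟩,
      fun z hz => (mem_filter.1 hz).2⟩
  refine h1.trans ((pr_exists_le _ _).trans ?_)
  calc _ ≤ ∑ Q ∈ Pal.powerset.filter fun Q => q ≤ Q.card,
          Real.exp (-(2 * q)) * (Real.exp 2 * x) ^ Q.card := by
        refine Finset.sum_le_sum fun Q hQ => ?_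
        refine (pr_triples_le Q Tr hTr).trans ?_
        rw [mul_pow, ← mul_assoc]
        refine le_mul_of_one_le_left (by positivity) ?_
        rw [← Real.exp_nat_mul, ← Real.exp_add]
        refine Real.one_le_exp ?_
        have : (q : ℝ) ≤ Q.card := by exact_mod_cast (mem_filter.1 hQ).2
        linarith
    _ ≤ ∑ Q ∈ Pal.powerset, Real.exp (-(2 * q)) * (Real.exp 2 * x) ^ Q.card :=
        Finset.sum_le_sum_of_subset_of_nonneg (filter_subset _ _) fun _ _ _ => by positivity
    _ = _ := by
        rw [← mul_sum]
        congr 1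
        have := Finset.sum_pow_mul_eq_add_pow (Real.exp 2 * x) 1 Pal
        simp only [one_pow, mul_one] at this
        rw [this, add_comm]

end Triples

section Sparse

variable {V Ω : Type*} [Fintype V] [DecidableEq V] [Fintype Ω] [DecidableEq Ω] [Nonempty Ω]
  {a : ℕ} [NeZero a]

/-- Vertex `u` keeps the color `c` in the one-shot coloring `X`, in which a vertex is active when
its second coordinate vanishes. -/
def Retained (G : SimpleGraph V) (S : Finset V) (A : V → Finset Ω) (X : V → Ω × Fin a) (u : V)
    (c : Ω) : Prop :=
  X u = (c, 0) ∧ c ∈ A u ∧ ∀ w ∈ S, G.Adj u w → X w ≠ (c, 0)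

open Classical in
/-- Colors kept by at least two neighbors of `v`. -/
noncomputable def doubles (G : SimpleGraph V) (S : Finset V) (A : V → Finset Ω)
    (X : V → Ω × Fin a) (v : V) : Finset Ω :=
  univ.filter fun c => ∃ x ∈ S, ∃ y ∈ S, x ≠ y ∧ G.Adj v x ∧ G.Adj v y ∧
    Retained G S A X x c ∧ Retained G S A X y c

lemma pr_few_doubles_le (G : SimpleGraph V) [DecidableRel G.Adj] (S : Finset V) (A : V → Finset Ω)
    (v : V) {k : ℕ} (hkΩ : Fintype.card Ω = k) (ha : a = 10 ^ 13) (hka : a ^ 3 ≤ k)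
    (hdeg : ∀ u, (S.filter fun w => G.Adj u w).card ≤ k)
    (hA : ∀ u ∈ S, 9 * k ≤ 10 * (A u).card)
    (hpairs : k ^ 2 ≤ 1280000 *
      numPairs (fun u w => u ≠ w ∧ ¬ G.Adj u w) (S.filter fun w => G.Adj v w)) (q : ℕ)
    (hq : 8 * (k : ℝ) / a ^ 3 ≤ q) (hq' : (q : ℝ) ≤ 9 * k / a ^ 3) :
    pr (fun X : V → Ω × Fin a => (doubles G S A X v).card < q)
      ≤ 2 * Real.exp (-(8 * k / a ^ 3)) := by
  classical
  have haR : (a : ℝ) = 10 ^ 13 := by rw [ha]; norm_num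
  have ha0 : (0 : ℝ) < a := by rw [haR]; norm_num
  have hk0 : (0 : ℝ) < k := by rw [← hkΩ]; exact_mod_cast Fintype.card_pos
  set Nb := S.filter fun w => G.Adj v w with hNb
  set r : V → V → Prop := fun u w => u ≠ w ∧ ¬ G.Adj u w with hr
  have hsymm : ∀ u w, r u w → r w u := fun u w h => ⟨h.1.symm, fun h' => h.2 h'.symm⟩
  have hirr : ∀ u, ¬ r u u := fun u h => h.1 rfl
  let emb : Ω ↪ Ω × Fin a := ⟨fun c => (c, 0), fun c c' h => (Prod.mk.inj h).1⟩
  let Pal : Finset (Ω × Fin a) := univ.map emb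
  have hPalc : Pal.card = k := by rw [card_map, card_univ, hkΩ]
  let B : V → Finset (Ω × Fin a) := fun u => if u ∈ S then (A u).map emb else ∅
  have hBmem : ∀ u c, (c, (0 : Fin a)) ∈ B u → c ∈ A u := by
    intro u c h
    simp only [B] at h
    split_ifs at h
    · exact (mem_map' emb).1 h
    · simp at h
  let Tr : Finset (Finset V) := ((Nb ×ˢ Nb).biUnion fun e =>
    (S.filter fun w => G.Adj e.1 w).image fun w => {e.1, e.2, w}).filter fun t => t.card = 3
  have hTr : ∀ t ∈ Tr, t.card = 3 := fun t ht => (mem_filter.1 ht).2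
  have hTrmem : ∀ x ∈ Nb, ∀ y ∈ Nb, ∀ w ∈ S, G.Adj x w → x ≠ y → x ≠ w → y ≠ w →
      ({x, y, w} : Finset V) ∈ Tr := by
    intro x hx y hy w hw hxw h1 h2 h3
    refine mem_filter.2 ⟨mem_biUnion.2 ⟨(x, y), mem_product.2 ⟨hx, hy⟩, mem_image.2
      ⟨w, mem_filter.2 ⟨hw, hxw⟩, rfl⟩⟩, ?_⟩
    rw [card_eq_three]
    exact ⟨x, y, w, h1, h2, h3, rfl⟩
  have hTrc : Tr.card ≤ k ^ 3 := by
    calc Tr.card ≤ (Nb ×ˢ Nb).card * k := by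
          refine (card_filter_le _ _).trans (card_biUnion_le_card_mul _ _ _ fun e _ => ?_)
          exact card_image_le.trans (hdeg _)
      _ ≤ k * k * k := by
          rw [card_product]
          gcongr <;> exact hdeg v
      _ = _ := by ring
  let TC : (V → Ω × Fin a) → Finset (Ω × Fin a) := fun X =>
    Pal.filter fun z => ∃ t ∈ Tr, ∀ v ∈ t, X v = z
  have hsplit : pr (fun X : V → Ω × Fin a => (doubles G S A X v).card < q)
      ≤ pr (fun X : V → Ω × Fin a => ¬ ∃ T, IsColorful r Nb B (fun v c => X v = c) T ∧
          T.card = 2 * q) + pr (fun X : V → Ω × Fin a => q ≤ (TC X).card) := by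
    refine le_trans (pr_mono fun X hX => ?_) (pr_or_le _ _)
    by_contra hcon
    rw [not_or, not_not, not_le] at hcon
    obtain ⟨⟨T, hT, hTc⟩, hTC⟩ := hcon
    have h1 : (T.image fun t => t.2.2) ⊆ (doubles G S A X v).map emb ∪ TC X := by
      intro z hz
      obtain ⟨⟨x, y, c, b⟩, ht, rfl⟩ := mem_image.1 hz
      have hx := hT.left_mem _ ht
      have hy := hT.right_mem _ ht
      have hxy := hT.rel _ ht
      have hcol := mem_inter.1 (hT.color_mem _ ht)
      have hXx := hT.has_left _ ht
      have hXy := hT.has_right _ ht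
      simp only at hx hy hxy hcol hXx hXy ⊢
      have hb : b = 0 := by
        have := hcol.1
        simp only [B] at this
        split_ifs at this
        · obtain ⟨c', -, h⟩ := mem_map.1 this
          exact (Prod.mk.inj h).2.symm
        · simp at this
      subst hb
      have hPal : (c, (0 : Fin a)) ∈ Pal := (mem_map' emb).2 (mem_univ c)
      by_cases hRx : Retained G S A X x c
      · by_cases hRy : Retained G S A X y c
        · refine mem_union_left _ ((mem_map' emb).2 ?_)
          simp only [doubles, mem_filter, mem_univ, true_and]
          exact ⟨x, (mem_filter.1 hx).1, y, (mem_filter.1 hy).1, hxy.1, (mem_filter.1 hx).2,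
            (mem_filter.1 hy).2, hRx, hRy⟩
        · simp only [Retained, not_and, not_forall, not_not] at hRy
          obtain ⟨w, hw, hyw, hXw⟩ := hRy hXy (hBmem _ _ hcol.2)
          refine mem_union_right _ (mem_filter.2 ⟨hPal, {y, x, w}, ?_, ?_⟩)
          · refine hTrmem y hy x hx w hw hyw hxy.1.symm hyw.ne ?_
            rintro rfl
            exact hxy.2 hyw.symm
          · simp [hXx, hXy, hXw]
      · simp only [Retained, not_and, not_forall, not_not] at hRx
        obtain ⟨w, hw, hxw, hXw⟩ := hRx hXx (hBmem _ _ hcol.1)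
        refine mem_union_right _ (mem_filter.2 ⟨hPal, {x, y, w}, ?_, ?_⟩)
        · refine hTrmem x hx y hy w hw hxw hxy.1 hxw.ne ?_
          rintro rfl
          exact hxy.2 hxw
        · simp [hXx, hXy, hXw]
    have h2 := card_le_card h1
    rw [card_image_of_injOn] at h2
    · have h3 := card_union_le ((doubles G S A X v).map emb) (TC X)
      rw [card_map] at h3
      omega
    · intro s hs t ht hst
      by_contra hne
      exact hT.color_ne s hs t ht hne hst
  have hκ : Fintype.card (Ω × Fin a) = k * a := by
    rw [Fintype.card_prod, hkΩ, Fintype.card_fin]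
  have hka3 : (a : ℝ) ^ 3 ≤ k := by exact_mod_cast hka
  have hq1 : (q : ℝ) * 10 ^ 39 ≤ 9 * k := by
    rw [le_div_iff₀ (by positivity), haR] at hq'
    norm_num at hq' ⊢
    exact hq'
  have hqk : 320000000 * q ≤ k := by
    have : (320000000 : ℝ) * q ≤ k := by
      have : (0 : ℝ) ≤ q := Nat.cast_nonneg _
      linarith
    exact_mod_cast this
  have hfirst : pr (fun X : V → Ω × Fin a => ¬ ∃ T, IsColorful r Nb B (fun v c => X v = c) T ∧
      T.card = 2 * q) ≤ Real.exp (-(8 * k / a ^ 3)) := by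
    have h1 := pr_no_colorful_le r hsymm hirr Nb B Pal ?_ k k (2 * q) 1 ?_ ?_ le_rfl
      (fun u _ => ?_) ?_ ?_ (θ := Real.exp 200) (Real.one_le_exp (by norm_num))
    · have h2 : pr (fun X : V → Ω × Fin a => ¬ ∃ T, IsColorful r Nb B (fun v c => X v = c) T ∧
          T.card = 2 * q) = pr (fun L : V → Fin 1 → Ω × Fin a =>
            ¬ ∃ T, IsColorful r Nb B (fun v c => ∃ i, L v i = c) T ∧ T.card = 2 * q) := by
        rw [← pr_equiv (Equiv.arrowCongr (Equiv.refl V) (Equiv.funUnique (Fin 1) (Ω × Fin a)))]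
        refine pr_congr fun L => ?_
        have : (fun v c => (Equiv.arrowCongr (Equiv.refl V)
            (Equiv.funUnique (Fin 1) (Ω × Fin a))) L v = c) = fun v c => ∃ i, L v i = c := by
          ext v c
          simp [Fin.exists_fin_one, Equiv.arrowCongr]
        rw [this]
      rw [h2]
      refine h1.trans ?_
      rw [hκ, hPalc]
      have h3 : (1 + (Real.exp 200)⁻¹) ^ (Nb.card + k) ≤ Real.exp (2 * k * Real.exp (-200)) := by
        rw [← Real.exp_neg]
        calc (1 + Real.exp (-200)) ^ (Nb.card + k) ≤ Real.exp (Real.exp (-200)) ^ (Nb.card + k) := by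
              gcongr
              rw [add_comm]
              exact Real.add_one_le_exp _
          _ ≤ _ := by
              rw [← Real.exp_nat_mul, Real.exp_le_exp]
              have : ((Nb.card + k : ℕ) : ℝ) ≤ 2 * k := by
                have : Nb.card ≤ k := hdeg v
                exact_mod_cast (by omega : Nb.card + k ≤ 2 * k)
              gcongr
      have h4 : Real.exp (-200) ≤ 1 / 10 ^ 39 := by
        rw [Real.exp_neg, one_div]
        apply inv_anti₀ (by norm_num)
        have h5 : (2 : ℝ) ≤ Real.exp 1 := by have := Real.add_one_le_exp (1 : ℝ); linarith
        calc (10 : ℝ) ^ 39 ≤ 2 ^ 200 := by norm_num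
          _ ≤ Real.exp 1 ^ 200 := by gcongr
          _ = Real.exp 200 := by rw [← Real.exp_nat_mul]; norm_num
      have h5 : (k : ℝ) ^ 2 ≤ 1280000 * numPairs r Nb := by exact_mod_cast hpairs
      calc _ ≤ Real.exp 200 ^ (3 * (2 * q)) * Real.exp (2 * k * Real.exp (-200)) *
            Real.exp (-((1 : ℕ) * (k * numPairs r Nb / (320 * ((k * a : ℕ) : ℝ) ^ 2)))) := by
              gcongr
        _ ≤ _ := by
          rw [← Real.exp_nat_mul, ← Real.exp_add, ← Real.exp_add, Real.exp_le_exp]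
          push_cast
          have h6 : (k : ℝ) / (320 * 1280000 * a ^ 2) ≤ k * numPairs r Nb / (320 * (k * a) ^ 2) := by
            rw [div_le_div_iff₀ (by positivity) (by positivity)]
            have h7 : (0 : ℝ) ≤ 320 * k * a ^ 2 := by positivity
            have := mul_le_mul_of_nonneg_left h5 h7
            linarith
          rw [haR] at h6 ⊢
          have h8 : 2 * (k : ℝ) * Real.exp (-200) ≤ 2 * k * (1 / 10 ^ 39) := by gcongr
          norm_num at h6 h8 hq1 ⊢
          linarith
    · intro u
      simp only [B]
      split_ifs
      · exact map_subset_map.2 (subset_univ _)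
      · exact empty_subset _
    · have : 16 ≤ a ^ 3 := by rw [ha]; norm_num
      exact this.trans hka
    · rw [hκ]
      exact Nat.le_mul_of_pos_right _ (Nat.pos_of_ne_zero (NeZero.ne a))
    · exact (card_filter_le _ _).trans (hdeg v)
    · have hk' : 0 < k := by exact_mod_cast hk0
      have : 320000000 * q * k ≤ k * k := Nat.mul_le_mul_right _ hqk
      nlinarith
    · intro u hu w hw _
      have hu' := (mem_filter.1 hu).1
      have hw' := (mem_filter.1 hw).1
      have h1 : B u ∩ B w = (A u ∩ A w).map emb := by
        simp only [B, hu', hw', if_true]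
        exact (map_inter _ _).symm
      rw [h1, card_map]
      have h2 := hA u hu'
      have h3 := hA w hw'
      have h4 := card_union_add_card_inter (A u) (A w)
      have h5 := card_le_univ (A u ∪ A w)
      omega
  have hsecond : pr (fun X : V → Ω × Fin a => q ≤ (TC X).card) ≤ Real.exp (-(8 * k / a ^ 3)) := by
    refine (pr_many_triples_le Pal Tr hTr q).trans ?_
    rw [hκ, hPalc]
    have h1 : (Tr.card : ℝ) / ((k * a : ℕ) : ℝ) ^ 3 ≤ 1 / a ^ 3 := by
      have : (Tr.card : ℝ) ≤ k ^ 3 := by exact_mod_cast hTrc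
      push_cast
      rw [div_le_div_iff₀ (by positivity) (by positivity)]
      rw [mul_pow, one_mul]
      gcongr
    have h2 : Real.exp 2 ≤ 8 := by
      have h3 := Real.exp_one_lt_d9
      have h4 : Real.exp 2 = Real.exp 1 * Real.exp 1 := by rw [← Real.exp_add]; norm_num
      rw [h4]
      nlinarith [Real.exp_pos 1]
    calc _ ≤ Real.exp (-(2 * q)) * (1 + 8 * (1 / a ^ 3)) ^ k := by gcongr
      _ ≤ Real.exp (-(2 * q)) * Real.exp (8 * (1 / a ^ 3)) ^ k := by
        gcongr
        rw [add_comm]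
        exact Real.add_one_le_exp _
      _ ≤ _ := by
        rw [← Real.exp_nat_mul, ← Real.exp_add, Real.exp_le_exp]
        have h5 : (k : ℝ) * (8 * (1 / a ^ 3)) = 8 * k / a ^ 3 := by ring
        rw [h5]
        linarith
  linarith

end Sparse

section Nibble

variable {V Ω : Type*} [Fintype V] [DecidableEq V] [Fintype Ω] [DecidableEq Ω] [Nonempty Ω]

/-- Reading off the first color of each list, together with an independent activation, yields a
uniform sample. -/
lemma pr_first_color {a m : ℕ} [NeZero a] (p : (V → Ω × Fin a) → Prop) :
    pr (fun z : (V → Fin (m + 1) → Ω) × (V → Fin a) => p fun u => (z.1 u 0, z.2 u)) = pr p := by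
  let e : (V → Fin (m + 1) → Ω) × (V → Fin a) ≃ (V → Ω × Fin a) × (V → Fin m → Ω) :=
    { toFun := fun z => (fun u => (z.1 u 0, z.2 u), fun u i => z.1 u i.succ)
      invFun := fun w => (fun u => Fin.cons (w.1 u).1 (w.2 u), fun u => (w.1 u).2)
      left_inv := fun z => by
        refine Prod.ext ?_ rfl
        funext u i
        refine Fin.cases ?_ (fun j => ?_) i <;> simp
      right_inv := fun w => by simp }
  exact (pr_equiv e fun w => p w.1).trans (pr_fst p)

lemma pr_small_range_le {ℓ k : ℕ} (hkΩ : Fintype.card Ω = k) :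
    pr (fun l : Fin ℓ → Ω => 10 * (univ.image l).card < 9 * k)
      ≤ 2 ^ k * Real.exp (-(ℓ / 10)) := by
  have h1 : pr (fun l : Fin ℓ → Ω => 10 * (univ.image l).card < 9 * k)
      ≤ pr (fun l : Fin ℓ → Ω => ∃ D ∈ (univ : Finset (Finset Ω)).filter
          fun D => 10 * D.card < 9 * k, ∀ i, l i ∈ D) :=
    pr_mono fun l hl => ⟨univ.image l, by simpa using hl, fun i => mem_image_of_mem _ (mem_univ i)⟩
  have hk0 : (0 : ℝ) < k := by rw [← hkΩ]; exact_mod_cast Fintype.card_pos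
  refine h1.trans ((pr_exists_le _ _).trans ?_)
  have h2 : ∀ D ∈ (univ : Finset (Finset Ω)).filter fun D => 10 * D.card < 9 * k,
      pr (fun l : Fin ℓ → Ω => ∀ i, l i ∈ D) ≤ Real.exp (-(ℓ / 10)) := by
    intro D hD
    rw [pr_forall fun _ x => x ∈ D, prod_const, card_univ, Fintype.card_fin, pr_mem, hkΩ]
    have h3 : (10 : ℝ) * D.card < 9 * k := by exact_mod_cast (mem_filter.1 hD).2
    have h4 : (D.card : ℝ) / k ≤ Real.exp (-(1 / 10)) := by
      have := Real.add_one_le_exp (-(1 / 10) : ℝ)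
      rw [div_le_iff₀ hk0]
      nlinarith
    calc _ ≤ Real.exp (-(1 / 10)) ^ ℓ := by gcongr
      _ = _ := by rw [← Real.exp_nat_mul]; ring_nf
  refine (Finset.sum_le_card_nsmul _ _ _ h2).trans ?_
  rw [nsmul_eq_mul]
  gcongr
  have h5 : ((univ : Finset (Finset Ω)).filter fun D => 10 * D.card < 9 * k).card ≤ 2 ^ k := by
    refine (card_filter_le _ _).trans ?_
    rw [card_univ, Fintype.card_finset, hkΩ]
  exact_mod_cast h5

/-- Vertices joined to `v` by a walk of length one or two. -/
def nearby (G : SimpleGraph V) [DecidableRel G.Adj] (v : V) : Finset V :=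
  G.neighborFinset v ∪ (G.neighborFinset v).biUnion fun x => G.neighborFinset x

lemma mem_nearby (G : SimpleGraph V) [DecidableRel G.Adj] {v w : V} :
    w ∈ nearby G v ↔ G.Adj v w ∨ ∃ x, G.Adj v x ∧ G.Adj x w := by
  simp [nearby]

lemma nearby_comm (G : SimpleGraph V) [DecidableRel G.Adj] {v w : V} :
    w ∈ nearby G v ↔ v ∈ nearby G w := by
  rw [mem_nearby, mem_nearby]
  refine or_congr (G.adj_comm _ _) (exists_congr fun x => ?_)
  rw [G.adj_comm v x, G.adj_comm x w, and_comm]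

lemma card_nearby_le (G : SimpleGraph V) [DecidableRel G.Adj] {k : ℕ}
    (hdeg : ∀ u, G.degree u + 1 ≤ k) (v : V) : (nearby G v).card ≤ k ^ 2 := by
  obtain ⟨d, rfl⟩ : ∃ d, k = d + 1 := ⟨k - 1, by have := hdeg v; omega⟩
  have hd : ∀ u, (G.neighborFinset u).card ≤ d := fun u => by
    have := hdeg u
    rw [G.card_neighborFinset_eq_degree]
    omega
  have h1 := card_union_le (G.neighborFinset v) ((G.neighborFinset v).biUnion fun x => G.neighborFinset x)
  have h2 := card_biUnion_le_card_mul (G.neighborFinset v)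
    (fun x => G.neighborFinset x) d fun u _ => hd u
  have h3 := Nat.mul_le_mul_right d (hd v)
  have h4 := hd v
  unfold nearby
  nlinarith

lemma doubles_congr (G : SimpleGraph V) [DecidableRel G.Adj] (S : Finset V) (A : V → Finset Ω)
    {a : ℕ} [NeZero a] (v : V) {X Y : V → Ω × Fin a} (h : ∀ i ∈ nearby G v, X i = Y i) :
    doubles G S A X v = doubles G S A Y v := by
  have hR : ∀ x, G.Adj v x → ∀ c, Retained G S A X x c ↔ Retained G S A Y x c := by
    intro x hx c
    unfold Retained
    rw [h x ((mem_nearby G).2 (Or.inl hx))]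
    refine and_congr_right fun _ => and_congr_right fun _ => ?_
    refine forall₂_congr fun w _ => forall_congr' fun hw => ?_
    rw [h w ((mem_nearby G).2 (Or.inr ⟨x, hx, hw⟩))]
  ext c
  simp only [doubles, mem_filter, mem_univ, true_and]
  constructor
  · rintro ⟨x, hx, y, hy, hxy, hvx, hvy, h1, h2⟩
    exact ⟨x, hx, y, hy, hxy, hvx, hvy, (hR x hvx c).1 h1, (hR y hvy c).1 h2⟩
  · rintro ⟨x, hx, y, hy, hxy, hvx, hvy, h1, h2⟩
    exact ⟨x, hx, y, hy, hxy, hvx, hvy, (hR x hvx c).2 h1, (hR y hvy c).2 h2⟩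

lemma eight_mul_pow_mul_exp_le {a k : ℕ} (ha : 1 ≤ a) (hk : a ^ 16 ≤ k) :
    8 * Real.exp (-(8 * k / a ^ 3)) * (k : ℝ) ^ 4 ≤ 1 := by
  have ha' : (1 : ℝ) ≤ a := by exact_mod_cast ha
  have hk' : (a : ℝ) ^ 16 ≤ k := by exact_mod_cast hk
  have hk0 : (0 : ℝ) < k := lt_of_lt_of_le (by positivity) hk'
  set x : ℝ := 8 * k / a ^ 3 with hx
  have hx0 : 0 ≤ x := by positivity
  have h1 := Real.pow_div_factorial_le_exp x hx0 5
  have h2 : x ^ 5 = 8 ^ 5 * k ^ 4 * (k / a ^ 15) := by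
    rw [hx, div_pow, mul_pow]
    field_simp
  have h3 : 1 ≤ (k : ℝ) / a ^ 15 := by
    rw [le_div_iff₀ (by positivity), one_mul]
    refine le_trans ?_ hk'
    exact pow_le_pow_right₀ ha' (by norm_num)
  have h4 : 8 * (k : ℝ) ^ 4 ≤ Real.exp x := by
    refine le_trans ?_ h1
    rw [h2, le_div_iff₀ (by positivity)]
    norm_num [Nat.factorial]
    have : (k : ℝ) ^ 4 * 1 ≤ k ^ 4 * (k / a ^ 15) := by gcongr
    have h5 : (0 : ℝ) ≤ k ^ 4 := by positivity
    linarith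
  rw [Real.exp_neg, mul_right_comm, ← div_eq_mul_inv, div_le_one (Real.exp_pos _)]
  exact h4

/-- With high probability the lists contain a partial coloring of `S` in which every vertex of `S'`
sees at least `q` colors kept twice in its neighborhood. -/
lemma pr_no_good_partial_coloring_le (G : SimpleGraph V) [DecidableRel G.Adj] (S S' : Finset V)
    {a k : ℕ} [NeZero a] (hkΩ : Fintype.card Ω = k) (ha : a = 10 ^ 13) (hka : a ^ 16 ≤ k)
    (hdeg : ∀ u, G.degree u + 1 ≤ k)
    (hpairs : ∀ v ∈ S', k ^ 2 ≤ 1280000 *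
      numPairs (fun u w => u ≠ w ∧ ¬ G.Adj u w) (S.filter fun w => G.Adj v w)) (q ℓ : ℕ)
    (hq : 8 * (k : ℝ) / a ^ 3 ≤ q) (hq' : (q : ℝ) ≤ 9 * k / a ^ 3) (lam B : ℝ) (hB : 0 ≤ B)
    (hlam : 0 ≤ lam) (hn : (Fintype.card V : ℝ) ≤ Real.exp lam) (hℓ0 : 1 ≤ ℓ)
    (hℓ : 10 * (a ^ 3 * B + B) * lam ≤ ℓ) :
    pr (fun L : V → Fin ℓ → Ω => ¬ ∃ (A : V → Finset Ω) (X : V → Ω × Fin a),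
        (∀ u c, Retained G S A X u c → ∃ i, L u i = c) ∧
        ∀ v ∈ S', q ≤ (doubles G S A X v).card) ≤ 2 * Real.exp (lam - B * lam) := by
  have hBl : 0 ≤ B * lam := by positivity
  have ha1 : 1 ≤ a := Nat.one_le_iff_ne_zero.2 (NeZero.ne a)
  have haR : (1 : ℝ) ≤ a := by exact_mod_cast ha1
  have hka3 : a ^ 3 ≤ k := (Nat.pow_le_pow_right ha1 (by norm_num)).trans hka
  have hk0 : (0 : ℝ) < k := by rw [← hkΩ]; exact_mod_cast Fintype.card_pos
  have hdeg' : ∀ u, (S.filter fun w => G.Adj u w).card ≤ k := fun u => by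
    have h1 : (S.filter fun w => G.Adj u w) ⊆ G.neighborFinset u := fun w hw => by
      simpa using (mem_filter.1 hw).2
    have h2 := card_le_card h1
    rw [G.card_neighborFinset_eq_degree] at h2
    have := hdeg u
    omega
  have hfew : ∀ A : V → Finset Ω, (∀ u ∈ S, 9 * k ≤ 10 * (A u).card) → ∀ v ∈ S',
      pr (fun X : V → Ω × Fin a => (doubles G S A X v).card < q)
        ≤ 2 * Real.exp (-(8 * k / a ^ 3)) := fun A hA v hv =>
    pr_few_doubles_le G S A v hkΩ ha hka3 hdeg' hA (hpairs v hv) q hq hq'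
  by_cases hlarge : a ^ 3 * B * lam ≤ k
  · obtain ⟨m, rfl⟩ : ∃ m, ℓ = m + 1 := ⟨ℓ - 1, by omega⟩
    rw [← pr_fst (Ω' := V → Fin a)]
    calc _ ≤ pr (fun z : (V → Fin (m + 1) → Ω) × (V → Fin a) => ∃ v ∈ S',
            (doubles G S (fun _ => univ) (fun u => (z.1 u 0, z.2 u)) v).card < q) := by
          refine pr_mono fun z hz => ?_
          by_contra hcon
          push Not at hcon
          refine hz ⟨fun _ => univ, fun u => (z.1 u 0, z.2 u), fun u c hc => ?_, hcon⟩
          exact ⟨0, congrArg Prod.fst hc.1⟩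
      _ = pr (fun X : V → Ω × Fin a => ∃ v ∈ S', (doubles G S (fun _ => univ) X v).card < q) :=
          pr_first_color fun X => ∃ v ∈ S', (doubles G S (fun _ => univ) X v).card < q
      _ ≤ S'.card • (2 * Real.exp (-(8 * k / a ^ 3))) := by
          refine (pr_exists_le _ _).trans (Finset.sum_le_card_nsmul _ _ _ fun v hv => ?_)
          refine hfew _ (fun u _ => ?_) v hv
          rw [card_univ, hkΩ]
          omega
      _ ≤ Real.exp lam * (2 * Real.exp (-(B * lam))) := by
          rw [nsmul_eq_mul]
          have h1 : (S'.card : ℝ) ≤ Real.exp lam :=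
            le_trans (by exact_mod_cast card_le_univ S') hn
          have h2 : B * lam ≤ 8 * k / a ^ 3 := by
            rw [le_div_iff₀ (by positivity)]
            nlinarith
          gcongr
      _ = _ := by
          rw [sub_eq_add_neg, Real.exp_add]
          ring
  · push Not at hlarge
    have hlll : ∀ A : V → Finset Ω, (∀ u, 9 * k ≤ 10 * (A u).card) →
        ∃ X : V → Ω × Fin a, ∀ v, ¬ (v ∈ S' ∧ (doubles G S A X v).card < q) := by
      intro A hA
      have h8 := eight_mul_pow_mul_exp_le ha1 hka
      have hk1 : (1 : ℝ) ≤ (k : ℝ) ^ 4 := one_le_pow₀ (by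
        have : 1 ≤ k := by exact_mod_cast hk0
        exact_mod_cast this)
      refine exists_avoiding (fun v X => v ∈ S' ∧ (doubles G S A X v).card < q) (nearby G)
        (2 * Real.exp (-(8 * k / a ^ 3))) (k ^ 4) (by positivity) ?_ ?_ ?_ ?_ ?_
      · have := Real.exp_pos (-(8 * k / a ^ 3))
        nlinarith
      · intro v X Y h
        rw [doubles_congr G S A v h]
      · intro v
        by_cases hv : v ∈ S'
        · exact (pr_mono fun X hX => hX.2).trans (hfew A (fun u _ => hA u) v hv)
        · rw [pr_false fun X hX => hv hX.1]
          positivity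
      · intro v T hT
        have h1 : T ⊆ (nearby G v).biUnion (nearby G) := by
          intro u hu
          obtain ⟨w, hw, hw'⟩ := not_disjoint_iff.1 (hT u hu)
          exact mem_biUnion.2 ⟨w, hw', (nearby_comm G).1 hw⟩
        calc T.card ≤ (nearby G v).card * k ^ 2 := (card_le_card h1).trans
              (card_biUnion_le_card_mul _ _ _ fun u _ => card_nearby_le G hdeg u)
          _ ≤ k ^ 2 * k ^ 2 := Nat.mul_le_mul_right _ (card_nearby_le G hdeg v)
          _ = k ^ 4 := by ring
      · push_cast
        linarith
    calc _ ≤ pr (fun L : V → Fin ℓ → Ω => ∃ u ∈ (univ : Finset V),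
            10 * (univ.image (L u)).card < 9 * k) := by
          refine pr_mono fun L hL => ?_
          by_contra hcon
          push Not at hcon
          obtain ⟨X, hX⟩ := hlll (fun u => univ.image (L u)) fun u => hcon u (mem_univ u)
          refine hL ⟨fun u => univ.image (L u), X, fun u c hc => ?_, fun v hv => ?_⟩
          · obtain ⟨i, -, hi⟩ := mem_image.1 hc.2.1
            exact ⟨i, hi⟩
          · exact not_lt.1 fun h => hX v ⟨hv, h⟩
      _ ≤ (univ : Finset V).card • (2 ^ k * Real.exp (-(ℓ / 10))) := by
          refine (pr_exists_le _ _).trans (Finset.sum_le_card_nsmul _ _ _ fun u _ => ?_)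
          exact (pr_eval u fun l : Fin ℓ → Ω => 10 * (univ.image l).card < 9 * k).le.trans
            (pr_small_range_le hkΩ)
      _ ≤ Real.exp lam * (Real.exp k * Real.exp (-(ℓ / 10))) := by
          rw [nsmul_eq_mul, card_univ]
          have h2 : (2 : ℝ) ^ k ≤ Real.exp k := by
            have : (2 : ℝ) ≤ Real.exp 1 := by have := Real.add_one_le_exp (1 : ℝ); linarith
            calc (2 : ℝ) ^ k ≤ Real.exp 1 ^ k := by gcongr
              _ = _ := by rw [← Real.exp_nat_mul, mul_one]
          gcongr
      _ ≤ Real.exp (lam - B * lam) := by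
          rw [← Real.exp_add, ← Real.exp_add, Real.exp_le_exp]
          linarith
      _ ≤ _ := by
          have := Real.exp_pos (lam - B * lam)
          linarith

end Nibble

section Blocks

variable {V Ω Z : Type*} [Fintype V] [DecidableEq V] [Fintype Ω] [DecidableEq Ω] [Nonempty Ω]
  [Fintype Z] [Nonempty Z]

/-- The coloring `C₁` of `R` extends to a proper coloring of `R ∪ S` whose colors on `S` are allowed
by `L`. -/
def Extends (G : SimpleGraph V) (al : Z → Ω → Prop) (R : Finset V) (C₁ : V → Ω) (S : Finset V)
    (L : V → Z) : Prop :=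
  ∃ C : V → Ω, (∀ u ∈ R, C u = C₁ u) ∧ (∀ u ∈ R ∪ S, ∀ w ∈ R ∪ S, G.Adj u w → C u ≠ C w) ∧
    ∀ v ∈ S, al (L v) (C v)

/-- Coloring one more block `K` costs at most the worst failure probability of that block. -/
lemma pr_not_extends_union_le (G : SimpleGraph V) (al : Z → Ω → Prop) (R S K : Finset V)
    (C₁ : V → Ω) (hRK : Disjoint R K) (hSK : Disjoint S K) (δ : ℝ)
    (h : ∀ C₀ : V → Ω, (∀ u ∈ R, C₀ u = C₁ u) →
      pr (fun L : V → Z => ¬ ∃ f : V → Ω, (∀ u ∈ K, ∀ w ∈ K, G.Adj u w → f u ≠ f w) ∧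
        ∀ v ∈ K, (∀ u ∈ R ∪ S, G.Adj v u → f v ≠ C₀ u) ∧ al (L v) (f v)) ≤ δ) :
    pr (fun L : V → Z => ¬ Extends G al R C₁ (S ∪ K) L)
      ≤ pr (fun L : V → Z => ¬ Extends G al R C₁ S L) + δ := by
  have hδ : 0 ≤ δ := (pr_nonneg _).trans (h C₁ fun _ _ => rfl)
  rw [pr_split (fun L : V → Z => Extends G al R C₁ S L), add_comm]
  refine add_le_add (pr_mono fun L hL => hL.1) ?_
  refine pr_piecewise_le K fun Y => ?_
  by_cases hY : Extends G al R C₁ S Y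
  · obtain ⟨C₀, hC₀, hprop, hal⟩ := hY
    refine (pr_mono fun X hX => ?_).trans (h C₀ hC₀)
    rintro ⟨f, hf, hfK⟩
    refine hX.2 ⟨K.piecewise f C₀, fun u hu => ?_, fun u hu w hw huw => ?_, fun v hv => ?_⟩
    · rw [piecewise_eq_of_notMem _ _ _ (disjoint_left.1 hRK hu), hC₀ u hu]
    · by_cases hu' : u ∈ K <;> by_cases hw' : w ∈ K <;> simp only [piecewise, hu', hw', if_true,
        if_false]
      · exact hf u hu' w hw' huw
      · refine (hfK u hu').1 w ?_ huw
        simp only [mem_union] at hw ⊢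
        tauto
      · refine ((hfK w hw').1 u ?_ huw.symm).symm
        simp only [mem_union] at hu ⊢
        tauto
      · refine hprop u ?_ w ?_ huw <;> simp only [mem_union] at hu hw ⊢ <;> tauto
    · by_cases hv' : v ∈ K
      · rw [piecewise_eq_of_mem _ _ _ hv', piecewise_eq_of_mem _ _ _ hv']
        exact (hfK v hv').2
      · rw [piecewise_eq_of_notMem _ _ _ hv', piecewise_eq_of_notMem _ _ _ hv']
        exact hal v ((mem_union.1 hv).resolve_right hv')
  · rw [pr_false]
    · exact hδ
    · rintro X ⟨⟨C, hC, hprop, hal⟩, -⟩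
      refine hY ⟨C, hC, hprop, fun v hv => ?_⟩
      have := hal v hv
      rwa [piecewise_eq_of_notMem _ _ _ (disjoint_left.1 hSK hv)] at this

/-- Greedy coloring, when each vertex always has at least `m` available colors. -/
lemma pr_not_extends_le_of_available (G : SimpleGraph V) [DecidableRel G.Adj] (R S : Finset V) (hRS : Disjoint R S)
    (C₁ : V → Ω) (hC₁ : ∀ u ∈ R, ∀ w ∈ R, G.Adj u w → C₁ u ≠ C₁ w) (m ℓ : ℕ)
    (hav : ∀ v ∈ S, ∀ C₀ : V → Ω, (∀ u ∈ R, C₀ u = C₁ u) →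
      m ≤ ((univ : Finset Ω).filter fun c => ∀ u ∈ R ∪ S, G.Adj v u → c ≠ C₀ u).card) :
    pr (fun L : V → Fin ℓ → Ω => ¬ Extends G (fun l c => ∃ i, l i = c) R C₁ S L)
      ≤ S.card * Real.exp (-(ℓ / Fintype.card Ω * m)) := by
  suffices H : ∀ T ⊆ S, pr (fun L : V → Fin ℓ → Ω =>
      ¬ Extends G (fun l c => ∃ i, l i = c) R C₁ T L)
        ≤ T.card * Real.exp (-(ℓ / Fintype.card Ω * m)) from H S Subset.rfl
  intro T
  induction T using Finset.induction_on with
  | empty =>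
    intro _
    rw [pr_false]
    · simp
    · intro L hL
      exact hL ⟨C₁, fun _ _ => rfl, by simpa using hC₁, by simp⟩
  | insert v T hv ih =>
    intro hT
    have hvS : v ∈ S := hT (mem_insert_self _ _)
    have hTS : T ⊆ S := (subset_insert _ _).trans hT
    rw [← union_singleton, card_union_of_disjoint (disjoint_singleton_right.2 hv), card_singleton]
    push_cast
    rw [add_mul, one_mul]
    refine (pr_not_extends_union_le G _ R T {v} C₁
      (disjoint_singleton_right.2 fun h => disjoint_left.1 hRS h hvS)
      (disjoint_singleton_right.2 hv) (Real.exp (-(ℓ / Fintype.card Ω * m))) ?_).trans ?_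
    · intro C₀ hC₀
      set D := (univ : Finset Ω).filter fun c => ∀ u ∈ R ∪ T, G.Adj v u → c ≠ C₀ u with hD
      refine (pr_mono (q := fun L : V → Fin ℓ → Ω => ∀ u ∈ ({v} : Finset V), ∀ i, L u i ∉ D)
        fun L hL => ?_).trans ((pr_lists_avoid_le {v} (fun _ => D) ℓ).trans ?_)
      · intro u hu i hi
        rw [mem_singleton] at hu
        subst hu
        refine hL ⟨fun _ => L u i, by simp, ?_⟩
        intro w hw
        rw [mem_singleton] at hw
        subst hw
        exact ⟨(mem_filter.1 hi).2, i, rfl⟩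
      · rw [sum_singleton, Real.exp_le_exp, neg_le_neg_iff]
        have h1 : m ≤ D.card := by
          refine (hav v hvS C₀ hC₀).trans (card_le_card fun c hc => ?_)
          rw [mem_filter] at hc ⊢
          exact ⟨mem_univ _, fun u hu => hc.2 u (union_subset_union_right hTS hu)⟩
        gcongr
    · gcongr
      exact ih hTS

lemma card_image_add_card_le (N : Finset V) (f : V → Ω) (D : Finset Ω)
    (hD : ∀ c ∈ D, ∃ x ∈ N, ∃ y ∈ N, x ≠ y ∧ f x = c ∧ f y = c) :
    (N.image f).card + D.card ≤ N.card := by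
  have hsub : D ⊆ N.image f := fun c hc => by
    obtain ⟨x, hx, -, -, -, h, -⟩ := hD c hc
    exact mem_image.2 ⟨x, hx, h⟩
  rw [card_eq_sum_card_image f N, ← inter_eq_right.2 hsub, ← filter_mem_eq_inter,
    card_filter, card_eq_sum_ones, ← sum_add_distrib]
  refine sum_le_sum fun c hc => ?_
  split_ifs with h
  · obtain ⟨x, hx, y, hy, hxy, h1, h2⟩ := hD c h
    exact one_lt_card.2 ⟨x, mem_filter.2 ⟨hx, h1⟩, y, mem_filter.2 ⟨hy, h2⟩, hxy⟩
  · obtain ⟨x, hx, h1⟩ := mem_image.1 hc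
    exact card_pos.2 ⟨x, mem_filter.2 ⟨hx, h1⟩⟩

end Blocks

section SparseColoring

variable {V Ω : Type*} [Fintype V] [DecidableEq V] [Fintype Ω] [DecidableEq Ω] [Nonempty Ω]

lemma pr_not_extends_sparse_le (G : SimpleGraph V) [DecidableRel G.Adj] (S : Finset V)
    {a k : ℕ} [NeZero a] (hkΩ : Fintype.card Ω = k) (ha : a = 10 ^ 13) (hka : a ^ 16 ≤ k)
    (hdeg : ∀ u, G.degree u + 1 ≤ k) (q ℓ₁ ℓ₂ : ℕ)
    (hS : ∀ v ∈ S, (S.filter fun w => G.Adj v w).card + q ≤ k ∨ k ^ 2 ≤ 1280000 *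
      numPairs (fun u w => u ≠ w ∧ ¬ G.Adj u w) (S.filter fun w => G.Adj v w))
    (hq : 8 * (k : ℝ) / a ^ 3 ≤ q) (hq' : (q : ℝ) ≤ 9 * k / a ^ 3) (lam B : ℝ) (hB : 0 ≤ B)
    (hlam : 0 ≤ lam) (hn : (Fintype.card V : ℝ) ≤ Real.exp lam) (hℓ0 : 1 ≤ ℓ₁)
    (hℓ₁ : 10 * (a ^ 3 * B + B) * lam ≤ ℓ₁) (hℓ₂ : a ^ 3 * B * lam ≤ ℓ₂) (C₁ : V → Ω) :
    pr (fun L : V → (Fin ℓ₁ → Ω) × (Fin ℓ₂ → Ω) => ¬ Extends G inList ∅ C₁ S L)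
      ≤ 3 * Real.exp (lam - B * lam) := by
  classical
  have hk0 : (0 : ℝ) < k := by rw [← hkΩ]; exact_mod_cast Fintype.card_pos
  have ha0 : (0 : ℝ) < a := by exact_mod_cast Nat.pos_of_ne_zero (NeZero.ne a)
  let S' := S.filter fun v => k ^ 2 ≤ 1280000 *
      numPairs (fun u w => u ≠ w ∧ ¬ G.Adj u w) (S.filter fun w => G.Adj v w)
  let Good : (V → Fin ℓ₁ → Ω) → Prop := fun L => ∃ (A : V → Finset Ω) (X : V → Ω × Fin a),
        (∀ u c, Retained G S A X u c → ∃ i, L u i = c) ∧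
        ∀ v ∈ S', q ≤ (doubles G S A X v).card
  have hGood : pr (fun L => ¬ Good L) ≤ 2 * Real.exp (lam - B * lam) :=
    pr_no_good_partial_coloring_le G S S' hkΩ ha hka hdeg (fun v hv => (mem_filter.1 hv).2) q ℓ₁
      hq hq' lam B hB hlam hn hℓ0 hℓ₁
  rw [← pr_equiv (Equiv.arrowProdEquivProdArrow V (fun _ => Fin ℓ₁ → Ω)
    (fun _ => Fin ℓ₂ → Ω)).symm]
  let P : (V → Fin ℓ₁ → Ω) × (V → Fin ℓ₂ → Ω) → Prop := fun z => ¬ Extends G inList ∅ C₁ S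
    ((Equiv.arrowProdEquivProdArrow V (fun _ => Fin ℓ₁ → Ω) (fun _ => Fin ℓ₂ → Ω)).symm z)
  have hP : pr (fun z => Good z.1 ∧ P z) ≤ Real.exp (lam - B * lam) := by
    refine pr_prod_le fun L₁ => ?_
    by_cases hL : Good L₁
    · obtain ⟨A, X, hret, hdbl⟩ := hL
      let R := S.filter fun u => ∃ c, Retained G S A X u c
      let C : V → Ω := fun u => (X u).1
      have hR : ∀ u ∈ R, Retained G S A X u (C u) := fun u hu => by
        obtain ⟨c, hc⟩ := (mem_filter.1 hu).2
        have : C u = c := congrArg Prod.fst hc.1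
        rwa [this]
      have hext : ∀ L₂ : V → Fin ℓ₂ → Ω, Extends G (fun l c => ∃ i, l i = c) R C (S \ R) L₂ →
          ¬ P (L₁, L₂) := by
        rintro L₂ ⟨D, hDR, hprop, hal⟩ hcon
        have hRS : R ∪ S \ R = S := union_sdiff_of_subset (filter_subset _ _)
        rw [hRS] at hprop
        refine hcon ⟨D, by simp, by simpa using hprop, fun v hv => ?_⟩
        by_cases hvR : v ∈ R
        · left
          rw [hDR v hvR]
          exact hret v _ (hR v hvR)
        · right
          exact hal v (mem_sdiff.2 ⟨hv, hvR⟩)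
      refine (pr_mono (q := fun L₂ : V → Fin ℓ₂ → Ω =>
        ¬ Extends G (fun l c => ∃ i, l i = c) R C (S \ R) L₂)
        fun L₂ h hL₂ => hext L₂ hL₂ h.2).trans ?_
      refine (pr_not_extends_le_of_available G R (S \ R) disjoint_sdiff C ?_ q ℓ₂ ?_).trans ?_
      · intro u hu w hw huw hC
        have h1 := hR u hu
        have h2 := (hR w hw).1
        rw [← hC] at h2
        exact h1.2.2 w (mem_filter.1 hw).1 huw h2
      · intro v hv C₀ hC₀
        rw [union_sdiff_of_subset (filter_subset _ _)]
        set Nb := S.filter fun w => G.Adj v w with hNb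
        have h1 : (univ : Finset Ω) \ Nb.image C₀ ⊆
            univ.filter fun c => ∀ u ∈ S, G.Adj v u → c ≠ C₀ u := by
          intro c hc
          refine mem_filter.2 ⟨mem_univ _, fun u hu huv h => ?_⟩
          exact (mem_sdiff.1 hc).2 (mem_image.2 ⟨u, mem_filter.2 ⟨hu, huv⟩, h.symm⟩)
        refine le_trans ?_ (card_le_card h1)
        have h2 := le_card_sdiff (Nb.image C₀) (univ : Finset Ω)
        rw [card_univ, hkΩ] at h2
        have h3 : (Nb.image C₀).card + q ≤ k := by
          have hsub : Nb.card + 1 ≤ k := by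
            refine le_trans (Nat.add_le_add_right ?_ 1) (hdeg v)
            rw [← G.card_neighborFinset_eq_degree]
            exact card_le_card fun w hw => by simpa using (mem_filter.1 hw).2
          have hvS := (mem_sdiff.1 hv).1
          rcases hS v hvS with h | h
          · exact le_trans (Nat.add_le_add_right card_image_le q) h
          · have h4 := hdbl v (mem_filter.2 ⟨hvS, h⟩)
            have h5 := card_image_add_card_le Nb C₀ (doubles G S A X v) ?_
            · omega
            · intro c hc
              simp only [doubles, mem_filter, mem_univ, true_and] at hc
              obtain ⟨x, hx, y, hy, hxy, hvx, hvy, hRx, hRy⟩ := hc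
              refine ⟨x, mem_filter.2 ⟨hx, hvx⟩, y, mem_filter.2 ⟨hy, hvy⟩, hxy, ?_, ?_⟩
              · rw [hC₀ x (mem_filter.2 ⟨hx, c, hRx⟩)]
                exact congrArg Prod.fst hRx.1
              · rw [hC₀ y (mem_filter.2 ⟨hy, c, hRy⟩)]
                exact congrArg Prod.fst hRy.1
        omega
      · rw [sub_eq_add_neg, Real.exp_add, hkΩ]
        have h1 : ((S \ R).card : ℝ) ≤ Real.exp lam :=
          le_trans (by exact_mod_cast card_le_univ (S \ R)) hn
        have h2 : B * lam ≤ ℓ₂ / k * q := by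
          calc B * lam ≤ ℓ₂ / k * (8 * k / a ^ 3) := by
                have : (ℓ₂ : ℝ) / k * (8 * k / a ^ 3) = 8 * ℓ₂ / a ^ 3 := by field_simp
                rw [this, le_div_iff₀ (by positivity)]
                have : (0 : ℝ) ≤ ℓ₂ := Nat.cast_nonneg _
                linarith
            _ ≤ _ := by gcongr
        gcongr
    · rw [pr_false]
      · positivity
      · exact fun L₂ h => hL h.1
  calc _ = pr (fun z => Good z.1 ∧ P z) + pr (fun z => ¬ Good z.1 ∧ P z) := pr_split _ _
    _ ≤ Real.exp (lam - B * lam) + 2 * Real.exp (lam - B * lam) := by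
        refine add_le_add hP (le_trans (pr_mono fun z hz => hz.1) ?_)
        rw [pr_fst (fun L => ¬ Good L)]
        exact hGood
    _ = _ := by ring

end SparseColoring

section Decomposition

variable {V : Type*} [Fintype V] [DecidableEq V]

/-- The neighborhood of `v` is almost a clique of size `k`. -/
def IsDense (G : SimpleGraph V) [DecidableRel G.Adj] (k : ℕ) (v : V) : Prop :=
  159999 * k ≤ 160000 * G.degree v ∧
    160000 * numPairs (fun u w => u ≠ w ∧ ¬ G.Adj u w) (G.neighborFinset v) ≤ k ^ 2

/-- Neighbors of `v` which miss many neighbors of `v`. -/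
def atypical (G : SimpleGraph V) [DecidableRel G.Adj] (k : ℕ) (v : V) : Finset V :=
  (G.neighborFinset v).filter fun w =>
    k ≤ 400 * ((G.neighborFinset v).filter fun x => w ≠ x ∧ ¬ G.Adj w x).card

variable (G : SimpleGraph V) [DecidableRel G.Adj] {k : ℕ}

lemma card_atypical_le {v : V} (hk : 0 < k) (hv : IsDense G k v) :
    400 * (atypical G k v).card ≤ k := by
  have h1 : (atypical G k v).card * k ≤
      400 * numPairs (fun u w => u ≠ w ∧ ¬ G.Adj u w) (G.neighborFinset v) := by
    unfold numPairs
    rw [mul_sum, ← smul_eq_mul]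
    refine (Finset.card_nsmul_le_sum (atypical G k v) (fun u => 400 *
      ((G.neighborFinset v).filter fun x => u ≠ x ∧ ¬ G.Adj u x).card) k
      fun u hu => (mem_filter.1 hu).2).trans ?_
    exact sum_le_sum_of_subset (filter_subset _ _)
  have h2 := hv.2
  refine Nat.le_of_mul_le_mul_right ?_ hk
  nlinarith

lemma card_neighborFinset_le_of_typical {v w : V} (hw : w ∈ G.neighborFinset v)
    (hw' : w ∉ atypical G k v) :
    400 * G.degree v ≤ 400 * (G.neighborFinset v ∩ G.neighborFinset w).card + k + 400 := by
  have h1 : 400 * ((G.neighborFinset v).filter fun x => w ≠ x ∧ ¬ G.Adj w x).card < k := by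
    simpa [atypical, hw] using hw'
  have h2 : G.neighborFinset v ⊆ (G.neighborFinset v ∩ G.neighborFinset w) ∪
      (insert w ((G.neighborFinset v).filter fun x => w ≠ x ∧ ¬ G.Adj w x)) := by
    intro x hx
    simp only [mem_union, mem_inter, mem_insert, mem_filter, G.mem_neighborFinset] at hx ⊢
    tauto
  have h3 := (card_le_card h2).trans (card_union_le _ _)
  have h4 := card_insert_le w ((G.neighborFinset v).filter fun x => w ≠ x ∧ ¬ G.Adj w x)
  rw [G.card_neighborFinset_eq_degree] at h3
  omega

/-- Two sets which are almost all of the degree overlap almost fully. -/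
lemma card_add_card_le_of_inter (A B C : Finset V) :
    (A ∩ C).card + (B ∩ C).card ≤ C.card + (A ∩ B).card := by
  have h1 := card_union_add_card_inter (A ∩ C) (B ∩ C)
  have h2 : ((A ∩ C) ∪ (B ∩ C)).card ≤ C.card :=
    card_le_card (union_subset inter_subset_right inter_subset_right)
  have h3 : ((A ∩ C) ∩ (B ∩ C)).card ≤ (A ∩ B).card :=
    card_le_card fun x hx => by simp only [mem_inter] at hx ⊢; tauto
  omega

/-- Common neighborhoods of dense vertices are either small or almost everything. -/
lemma inter_small_or_large (hdeg : ∀ u, G.degree u + 1 ≤ k) (hk : 10 ^ 6 ≤ k) {u v : V}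
    (hu : IsDense G k u) (hv : IsDense G k v)
    (h : k < 200 * (G.neighborFinset u ∩ G.neighborFinset v).card) :
    159190 * k ≤ 160000 * (G.neighborFinset u ∩ G.neighborFinset v).card := by
  have h1 := card_atypical_le G (by omega) hu
  have h2 := card_atypical_le G (by omega) hv
  obtain ⟨w, hw, hw'⟩ : ∃ w ∈ G.neighborFinset u ∩ G.neighborFinset v,
      w ∉ atypical G k u ∪ atypical G k v := by
    by_contra hcon
    push Not at hcon
    have h3 := (card_le_card hcon).trans (card_union_le _ _)
    omega
  rw [mem_inter] at hw
  rw [mem_union, not_or] at hw'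
  have h3 := card_neighborFinset_le_of_typical G hw.1 hw'.1
  have h4 := card_neighborFinset_le_of_typical G hw.2 hw'.2
  have h5 := card_add_card_le_of_inter (G.neighborFinset u) (G.neighborFinset v)
    (G.neighborFinset w)
  rw [G.card_neighborFinset_eq_degree] at h5
  have h6 := hdeg w
  have h7 := hu.1
  have h8 := hv.1
  omega

lemma exists_decomposition (hdeg : ∀ u, G.degree u + 1 ≤ k) (hk : 10 ^ 6 ≤ k) :
    ∃ (I : Finset V) (K : V → Finset V), (∀ i ∈ I, ∀ j ∈ I, i ≠ j → Disjoint (K i) (K j)) ∧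
      (∀ i ∈ I, ∀ v ∈ K i, 32 * (G.neighborFinset v \ K i).card ≤ k ∧
        32 * ((K i).filter fun w => v ≠ w ∧ ¬ G.Adj v w).card ≤ k) ∧
      ∀ v, IsDense G k v → ∃ i ∈ I, v ∈ K i := by
  classical
  let P : Finset V → Prop := fun I => (∀ i ∈ I, IsDense G k i) ∧ ∀ i ∈ I, ∀ j ∈ I, i ≠ j →
    200 * (G.neighborFinset i ∩ G.neighborFinset j).card ≤ k
  obtain ⟨I, hI, hmax⟩ := ((univ : Finset (Finset V)).filter P).exists_max_image card
    ⟨∅, by simp [P]⟩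
  obtain ⟨hId, hIs⟩ := (mem_filter.1 hI).2
  let K : V → Finset V := fun v => univ.filter fun u =>
    159190 * k ≤ 160000 * (G.neighborFinset u ∩ G.neighborFinset v).card
  have hK : ∀ {u v}, u ∈ K v ↔
      159190 * k ≤ 160000 * (G.neighborFinset u ∩ G.neighborFinset v).card := by simp [K]
  refine ⟨I, K, fun i hi j hj hij => ?_, fun i hi v hv => ?_, fun v hv => ?_⟩
  · refine disjoint_left.2 fun u hu hu' => ?_
    have h1 := hK.1 hu
    have h2 := hK.1 hu'
    have h3 := card_add_card_le_of_inter (G.neighborFinset i) (G.neighborFinset j)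
      (G.neighborFinset u)
    rw [G.card_neighborFinset_eq_degree, inter_comm _ (G.neighborFinset u),
      inter_comm _ (G.neighborFinset u)] at h3
    have h4 := hIs i hi j hj hij
    have h5 := hdeg u
    omega
  · have hd := hId i hi
    have hout : 400 * (G.neighborFinset i \ K i).card ≤ k := by
      refine le_trans (Nat.mul_le_mul_left _ (card_le_card fun w hw => ?_))
        (card_atypical_le G (by omega) hd)
      by_contra hw'
      have h1 := card_neighborFinset_le_of_typical G (mem_sdiff.1 hw).1 hw'
      refine (mem_sdiff.1 hw).2 (hK.2 ?_)
      rw [inter_comm]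
      have := hd.1
      omega
    have hv' := hK.1 hv
    have hdv := hdeg v
    constructor
    · have h1 : G.neighborFinset v \ K i ⊆
          (G.neighborFinset v \ G.neighborFinset i) ∪ (G.neighborFinset i \ K i) := by
        intro x hx
        simp only [mem_union, mem_sdiff] at hx ⊢
        tauto
      have h2 := (card_le_card h1).trans (card_union_le _ _)
      have h3 := card_sdiff_add_card_inter (G.neighborFinset v) (G.neighborFinset i)
      rw [G.card_neighborFinset_eq_degree] at h3
      omega
    · have hKcard : 159190 * (K i).card ≤ 160000 * k := by
        have h1 : ∑ u ∈ K i, (G.neighborFinset u ∩ G.neighborFinset i).card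
            ≤ G.degree i * k := by
          have h2 : ∀ u, (G.neighborFinset u ∩ G.neighborFinset i).card
              = ((G.neighborFinset i).filter fun w => G.Adj u w).card := by
            intro u
            congr 1
            ext w
            simp [and_comm]
          simp_rw [h2]
          refine (sum_card_bipartiteAbove_eq_sum_card_bipartiteBelow (s := K i)
            (t := G.neighborFinset i) fun u w => G.Adj u w).le.trans ?_
          rw [← G.card_neighborFinset_eq_degree, ← smul_eq_mul]
          refine Finset.sum_le_card_nsmul _ _ _ fun w _ => ?_
          refine le_trans (card_le_card (t := G.neighborFinset w) fun u hu => ?_) ?_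
          · simpa [bipartiteBelow, G.adj_comm] using (mem_filter.1 hu).2
          · rw [G.card_neighborFinset_eq_degree]
            exact (Nat.le_succ _).trans (hdeg w)
        have h2 : (K i).card * (159190 * k) ≤
            ∑ u ∈ K i, 160000 * (G.neighborFinset u ∩ G.neighborFinset i).card := by
          rw [← smul_eq_mul]
          exact Finset.card_nsmul_le_sum _ _ _ fun u hu => hK.1 hu
        rw [← mul_sum] at h2
        have h3 : G.degree i * k ≤ k * k :=
          Nat.mul_le_mul_right _ ((Nat.le_succ _).trans (hdeg i))
        refine Nat.le_of_mul_le_mul_right ?_ (show 0 < k by omega)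
        nlinarith
      have h1 : ((K i).filter fun w => v ≠ w ∧ ¬ G.Adj v w).card + (G.neighborFinset v ∩ K i).card
          ≤ (K i).card := by
        rw [← card_union_of_disjoint]
        · exact card_le_card (union_subset (filter_subset _ _) inter_subset_right)
        · refine disjoint_left.2 fun w hw hw' => (mem_filter.1 hw).2.2 ?_
          simpa using (mem_inter.1 hw').1
      have h2 : G.neighborFinset v ∩ G.neighborFinset i ⊆
          (G.neighborFinset v ∩ K i) ∪ (G.neighborFinset i \ K i) := by
        intro x hx
        simp only [mem_union, mem_sdiff, mem_inter] at hx ⊢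
        tauto
      have h3 := (card_le_card h2).trans (card_union_le _ _)
      omega
  · by_cases hvI : v ∈ I
    · refine ⟨v, hvI, hK.2 ?_⟩
      rw [inter_self, G.card_neighborFinset_eq_degree]
      have := hv.1
      omega
    · by_contra hcon
      push Not at hcon
      have hP : P (insert v I) := by
        have key : ∀ i ∈ I, 200 * (G.neighborFinset v ∩ G.neighborFinset i).card ≤ k := by
          intro i hi
          by_contra hlt
          exact hcon i hi (hK.2 (inter_small_or_large G hdeg hk hv (hId i hi) (not_le.1 hlt)))
        refine ⟨fun i hi => ?_, fun i hi j hj hij => ?_⟩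
        · rcases mem_insert.1 hi with rfl | hi
          exacts [hv, hId i hi]
        · rcases mem_insert.1 hi with rfl | hi' <;> rcases mem_insert.1 hj with rfl | hj'
          · exact absurd rfl hij
          · exact key j hj'
          · rw [inter_comm]
            exact key i hi'
          · exact hIs i hi' j hj' hij
      have := hmax _ (mem_filter.2 ⟨mem_univ _, hP⟩)
      rw [card_insert_of_notMem hvI] at this
      omega

lemma sparse_of_not_isDense (hdeg : ∀ u, G.degree u + 1 ≤ k) {q : ℕ} (hq : 1280000 * q ≤ k) {v : V}
    (hv : ¬ IsDense G k v) (S : Finset V) :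
    (S.filter fun w => G.Adj v w).card + q ≤ k ∨ k ^ 2 ≤ 1280000 *
      numPairs (fun u w => u ≠ w ∧ ¬ G.Adj u w) (S.filter fun w => G.Adj v w) := by
  set U := G.neighborFinset v \ S with hU
  have hNS : (S.filter fun w => G.Adj v w) = G.neighborFinset v \ U := by
    ext w
    simp only [hU, mem_filter, mem_sdiff, G.mem_neighborFinset]
    tauto
  have hUsub : U ⊆ G.neighborFinset v := sdiff_subset
  have h1 : (G.neighborFinset v \ U).card + U.card = G.degree v := by
    rw [card_sdiff_add_card_eq_card hUsub, G.card_neighborFinset_eq_degree]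
  have hdv := hdeg v
  rw [hNS]
  by_cases hd : 159999 * k ≤ 160000 * G.degree v
  · by_cases hUc : k ≤ 1280000 * U.card
    · left
      omega
    · right
      have h2 : k ^ 2 < 160000 *
          numPairs (fun u w => u ≠ w ∧ ¬ G.Adj u w) (G.neighborFinset v) := by
        by_contra hcon
        exact hv ⟨hd, not_lt.1 hcon⟩
      have h3 := numPairs_le_sdiff (fun u w => u ≠ w ∧ ¬ G.Adj u w)
        (fun u w h => ⟨h.1.symm, fun h' => h.2 h'.symm⟩) hUsub k fun u _ => by
          refine (card_filter_le _ _).trans ?_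
          rw [G.card_neighborFinset_eq_degree]
          omega
      push Not at hUc
      have h4 : 1280000 * U.card * k ≤ k * k := Nat.mul_le_mul_right _ hUc.le
      nlinarith
  · left
    omega

end Decomposition

section Assembly

variable {V Ω : Type*} [Fintype V] [DecidableEq V] [Fintype Ω] [DecidableEq Ω] [Nonempty Ω]

lemma pr_block_fail_le (G : SimpleGraph V) [DecidableRel G.Adj] (T K : Finset V)
    (hTK : Disjoint T K) {k : ℕ} (hkΩ : Fintype.card Ω = k) (hk : 32 ≤ k)
    (hdeg : ∀ u, G.degree u + 1 ≤ k)
    (hK : ∀ v ∈ K, 32 * (G.neighborFinset v \ K).card ≤ k ∧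
      32 * (K.filter fun w => v ≠ w ∧ ¬ G.Adj v w).card ≤ k)
    (ℓ₁ ℓ₂ : ℕ) (lam B : ℝ) (hB : 1 ≤ B) (hlam : 0 ≤ lam) (hℓ₁ : 320 * (12 + B) * lam ≤ ℓ₁)
    (hℓ₂ : 4 * (B + 2) * lam ≤ ℓ₂) (hkn : (k : ℝ) ≤ Real.exp lam)
    (hn : (Fintype.card V : ℝ) ≤ Real.exp lam) (C₀ : V → Ω) :
    pr (fun L : V → (Fin ℓ₁ → Ω) × (Fin ℓ₂ → Ω) => ¬ ∃ f : V → Ω,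
        (∀ u ∈ K, ∀ w ∈ K, G.Adj u w → f u ≠ f w) ∧
        ∀ v ∈ K, (∀ u ∈ ∅ ∪ T, G.Adj v u → f v ≠ C₀ u) ∧ inList (L v) (f v))
      ≤ 3 * Real.exp (3 - B * lam / 4) := by
  let A : V → Finset Ω := fun v => univ.filter fun c => ∀ u ∈ T, G.Adj v u → c ≠ C₀ u
  have hAc : ∀ v, k ≤ (A v).card + (G.neighborFinset v \ K).card := by
    intro v
    have h1 : (univ : Finset Ω) \ (G.neighborFinset v \ K).image C₀ ⊆ A v := by
      intro c hc
      refine mem_filter.2 ⟨mem_univ _, fun u hu huv h => (mem_sdiff.1 hc).2 (mem_image.2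
        ⟨u, mem_sdiff.2 ⟨by simpa using huv, disjoint_left.1 hTK hu⟩, h.symm⟩)⟩
    have h2 := card_le_card h1
    have h3 := le_card_sdiff ((G.neighborFinset v \ K).image C₀) (univ : Finset Ω)
    have h4 := card_image_le (s := G.neighborFinset v \ K) (f := C₀)
    rw [card_univ, hkΩ] at h3
    omega
  refine le_trans (pr_mono fun L hL => ?_) (pr_clique_fail_le G K A hkΩ hk ℓ₁ ℓ₂ lam B hB hlam hℓ₁
    hℓ₂ hkn ?_ ?_ (fun v hv => (hK v hv).2) ?_)
  · rintro ⟨f, hf, hfA⟩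
    refine hL ⟨f, hf, fun v hv => ⟨fun u hu => ?_, (hfA v hv).2⟩⟩
    rw [empty_union] at hu
    exact (mem_filter.1 (hfA v hv).1).2 u hu
  · exact le_trans (by exact_mod_cast card_le_univ K) hn
  · intro v hv
    have := hAc v
    have := (hK v hv).1
    omega
  · intro v hv
    have h1 : K ⊆ insert v ((K.filter fun w => v ≠ w ∧ ¬ G.Adj v w) ∪ (G.neighborFinset v ∩ K)) := by
      intro w hw
      simp only [mem_insert, mem_union, mem_filter, mem_inter, G.mem_neighborFinset]
      tauto
    have h2 := (card_le_card h1).trans (card_insert_le _ _)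
    have h3 := card_union_le (K.filter fun w => v ≠ w ∧ ¬ G.Adj v w) (G.neighborFinset v ∩ K)
    have h4 := card_sdiff_add_card_inter (G.neighborFinset v) K
    rw [G.card_neighborFinset_eq_degree] at h4
    have := hAc v
    have := hdeg v
    omega

lemma pr_not_extends_univ_le (G : SimpleGraph V) [DecidableRel G.Adj] {a k : ℕ}
    (hkΩ : Fintype.card Ω = k) (ha : a = 10 ^ 13) (hka : a ^ 16 ≤ k)
    (hdeg : ∀ u, G.degree u + 1 ≤ k) (ℓ₁ ℓ₂ : ℕ) (lam B : ℝ) (hB : 1 ≤ B) (hlam : 0 ≤ lam)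
    (hkn : (k : ℝ) ≤ Real.exp lam) (hn : (Fintype.card V : ℝ) ≤ Real.exp lam) (hℓ0 : 1 ≤ ℓ₁)
    (hℓ₁ : 10 * (a ^ 3 * B + B) * lam ≤ ℓ₁) (hℓ₁' : 320 * (12 + B) * lam ≤ ℓ₁)
    (hℓ₂ : a ^ 3 * B * lam ≤ ℓ₂) (hℓ₂' : 4 * (B + 2) * lam ≤ ℓ₂) (C₁ : V → Ω) :
    pr (fun L : V → (Fin ℓ₁ → Ω) × (Fin ℓ₂ → Ω) => ¬ Extends G inList ∅ C₁ univ L)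
      ≤ 3 * Real.exp (lam - B * lam) + Real.exp lam * (3 * Real.exp (3 - B * lam / 4)) := by
  classical
  have : NeZero a := ⟨by rw [ha]; norm_num⟩
  have haR : (a : ℝ) = 10 ^ 13 := by rw [ha]; norm_num
  have ha1 : 1 ≤ a := by rw [ha]; norm_num
  have hka3 : (a : ℝ) ^ 3 ≤ k := by
    exact_mod_cast (Nat.pow_le_pow_right ha1 (by norm_num)).trans hka
  have hk6 : 10 ^ 6 ≤ k := by
    refine le_trans ?_ ((Nat.pow_le_pow_right ha1 (show 1 ≤ 16 by norm_num)).trans hka)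
    rw [ha]
    norm_num
  obtain ⟨I, K, hdisj, hK, hcover⟩ := exists_decomposition G hdeg hk6
  let S : Finset V := univ.filter fun v => ∀ i ∈ I, v ∉ K i
  set q : ℕ := ⌈8 * (k : ℝ) / a ^ 3⌉₊ with hq
  have hq1 : 8 * (k : ℝ) / a ^ 3 ≤ q := Nat.le_ceil _
  have hq2 : (q : ℝ) ≤ 9 * k / a ^ 3 := by
    have h1 := (Nat.ceil_lt_add_one (show 0 ≤ 8 * (k : ℝ) / a ^ 3 by positivity)).le
    have h2 : (1 : ℝ) ≤ k / a ^ 3 := by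
      rw [le_div_iff₀ (by rw [haR]; positivity), one_mul]
      exact hka3
    have h3 : 9 * (k : ℝ) / a ^ 3 = 8 * k / a ^ 3 + k / a ^ 3 := by ring
    rw [h3]
    linarith
  have hqk : 1280000 * q ≤ k := by
    have h1 : (1280000 : ℝ) * q ≤ k := by
      rw [haR, le_div_iff₀ (by norm_num)] at hq2
      have : (0 : ℝ) ≤ q := Nat.cast_nonneg _
      norm_num at hq2
      linarith
    exact_mod_cast h1
  have hS : ∀ v ∈ S, ¬ IsDense G k v := fun v hv hd => by
    obtain ⟨i, hi, hvi⟩ := hcover v hd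
    exact (mem_filter.1 hv).2 i hi hvi
  have key : ∀ J ⊆ I, pr (fun L : V → (Fin ℓ₁ → Ω) × (Fin ℓ₂ → Ω) =>
      ¬ Extends G inList ∅ C₁ (S ∪ J.biUnion K) L)
        ≤ 3 * Real.exp (lam - B * lam) + J.card * (3 * Real.exp (3 - B * lam / 4)) := by
    intro J
    induction J using Finset.induction_on with
    | empty =>
      intro _
      simp only [biUnion_empty, union_empty, card_empty, Nat.cast_zero, zero_mul, add_zero]
      exact pr_not_extends_sparse_le G S hkΩ ha hka hdeg q ℓ₁ ℓ₂
        (fun v hv => sparse_of_not_isDense G hdeg hqk (hS v hv) S) hq1 hq2 lam B (by linarith) hlam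
        hn hℓ0 hℓ₁ hℓ₂ C₁
    | insert i J hi ih =>
      intro hJ
      have hiI := hJ (mem_insert_self _ _)
      have hJI := (subset_insert _ _).trans hJ
      have hTK : Disjoint (S ∪ J.biUnion K) (K i) := by
        refine disjoint_union_left.2 ⟨disjoint_left.2 fun v hv => (mem_filter.1 hv).2 i hiI, ?_⟩
        refine (disjoint_biUnion_left _ _ _).2 fun j hj => hdisj j (hJI hj) i hiI ?_
        rintro rfl
        exact hi hj
      rw [biUnion_insert, union_comm (K i), ← union_assoc, card_insert_of_notMem hi]
      refine (pr_not_extends_union_le G inList ∅ (S ∪ J.biUnion K) (K i) C₁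
        (disjoint_empty_left _) hTK (3 * Real.exp (3 - B * lam / 4)) fun C₀ _ =>
          pr_block_fail_le G _ _ hTK hkΩ (by omega) hdeg (hK i hiI) ℓ₁ ℓ₂ lam B hB hlam hℓ₁' hℓ₂'
            hkn hn C₀).trans ?_
      have := ih hJI
      push_cast
      linarith
  have huniv : S ∪ I.biUnion K = univ := by
    refine eq_univ_of_forall fun v => ?_
    by_cases h : ∃ i ∈ I, v ∈ K i
    · exact mem_union_right _ (mem_biUnion.2 h)
    · push Not at h
      exact mem_union_left _ (mem_filter.2 ⟨mem_univ _, h⟩)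
  have h1 := key I Subset.rfl
  rw [huniv] at h1
  refine h1.trans ?_
  gcongr
  exact le_trans (by exact_mod_cast card_le_univ I) hn

/-- The probability that lists of length `ℓ₁ + ℓ₂` are split into lists of lengths `ℓ₁` and
`ℓ₂`. -/
lemma pr_not_extends_add_eq (G : SimpleGraph V) (ℓ₁ ℓ₂ : ℕ) (C₁ : V → Ω) :
    pr (fun L : V → Fin (ℓ₁ + ℓ₂) → Ω => ¬ Extends G (fun l c => ∃ i, l i = c) ∅ C₁ univ L)
      = pr (fun L : V → (Fin ℓ₁ → Ω) × (Fin ℓ₂ → Ω) => ¬ Extends G inList ∅ C₁ univ L) := by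
  rw [← pr_equiv (Equiv.arrowCongr (Equiv.refl V) (Fin.appendEquiv ℓ₁ ℓ₂))]
  refine pr_congr fun L => not_congr (exists_congr fun C => and_congr_right fun _ =>
    and_congr_right fun _ => forall₂_congr fun v _ => ?_)
  simp only [Equiv.arrowCongr, inList, Fin.appendEquiv]
  constructor
  · rintro ⟨i, hi⟩
    induction i using Fin.addCases with
    | left i => exact Or.inl ⟨i, by simpa using hi⟩
    | right i => exact Or.inr ⟨i, by simpa using hi⟩
  · rintro (⟨i, hi⟩ | ⟨i, hi⟩)
    · exact ⟨Fin.castAdd _ i, by simpa using hi⟩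
    · exact ⟨Fin.natAdd _ i, by simpa using hi⟩

lemma failure_bound_le {c lam B : ℝ} (hc : 0 < c) (hlam : 1 / 2 ≤ lam) (hB : B = 4 * (c + 13)) :
    3 * Real.exp (lam - B * lam) + Real.exp lam * (3 * Real.exp (3 - B * lam / 4))
      ≤ Real.exp (-(c * lam)) := by
  have h2 : (2 : ℝ) ≤ Real.exp 1 := by have := Real.add_one_le_exp (1 : ℝ); linarith
  have h3 : (3 : ℝ) ≤ Real.exp 2 := by have := Real.add_one_le_exp (2 : ℝ); linarith
  have hcl : 0 < c * lam := by positivity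
  have h4 : 3 * Real.exp (lam - B * lam) ≤ Real.exp (-(c * lam) - 1) := by
    calc _ ≤ Real.exp 2 * Real.exp (lam - B * lam) := by gcongr
      _ ≤ _ := by
        rw [← Real.exp_add, Real.exp_le_exp, hB]
        linarith
  have h5 : Real.exp lam * (3 * Real.exp (3 - B * lam / 4)) ≤ Real.exp (-(c * lam) - 1) := by
    calc _ ≤ Real.exp lam * (Real.exp 2 * Real.exp (3 - B * lam / 4)) := by gcongr
      _ ≤ _ := by
        rw [← Real.exp_add, ← Real.exp_add, Real.exp_le_exp, hB]
        linarith
  have h6 : Real.exp (-(c * lam)) = Real.exp (-(c * lam) - 1) * Real.exp 1 := by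
    rw [← Real.exp_add]
    congr 1
    ring
  have h7 := Real.exp_pos (-(c * lam) - 1)
  rw [h6]
  nlinarith

lemma exists_list_length (c : ℝ) (hc : 0 < c) :
    ∃ α : ℝ, 0 < α ∧ ∀ (lam : ℝ), 1 / 2 ≤ lam → ∀ (V Ω : Type) [Fintype V] [DecidableEq V]
      [Fintype Ω] [DecidableEq Ω] [Nonempty Ω] (G : SimpleGraph V) [DecidableRel G.Adj] (k ℓ : ℕ),
      Fintype.card Ω = k → (∀ u, G.degree u + 1 ≤ k) → (k : ℝ) ≤ Real.exp lam →
      (Fintype.card V : ℝ) ≤ Real.exp lam → α * lam ≤ ℓ → ∀ C₁ : V → Ω,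
      pr (fun L : V → Fin ℓ → Ω => ¬ Extends G (fun l c => ∃ i, l i = c) ∅ C₁ univ L)
        ≤ Real.exp (-(c * lam)) := by
  obtain ⟨a, ha⟩ : ∃ a : ℕ, a = 10 ^ 13 := ⟨_, rfl⟩
  have ha0 : (0 : ℝ) < a := by rw [ha]; norm_num
  obtain ⟨B, hB⟩ : ∃ B : ℝ, B = 4 * (c + 13) := ⟨_, rfl⟩
  have hB0 : 1 ≤ B := by linarith
  set M : ℝ := 320 * (12 + B) + 10 * (a ^ 3 * B + B) with hM
  have haB : (0 : ℝ) ≤ a ^ 3 * B := by positivity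
  have hM0 : 2 ≤ M := by linarith
  refine ⟨2 * M + 2 + a ^ 16 * (1 + c), by positivity, ?_⟩
  intro lam hlam V Ω _ _ _ _ _ G _ k ℓ hkΩ hdeg hkn hn hℓ C₁
  have hacl : 0 ≤ (a : ℝ) ^ 16 * (1 + c) * lam := by positivity
  have hMl : 0 ≤ M * lam := by positivity
  by_cases hka : a ^ 16 ≤ k
  · obtain ⟨ℓ₁, ℓ₂, rfl, h12, h21⟩ : ∃ ℓ₁ ℓ₂, ℓ = ℓ₁ + ℓ₂ ∧ ℓ₁ ≤ ℓ₂ ∧ ℓ₂ ≤ ℓ₁ + 1 :=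
      ⟨ℓ / 2, ℓ - ℓ / 2, by omega, by omega, by omega⟩
    have h12' : (ℓ₁ : ℝ) ≤ ℓ₂ := by exact_mod_cast h12
    have h21' : (ℓ₂ : ℝ) ≤ ℓ₁ + 1 := by exact_mod_cast h21
    have hM1 : M * lam ≤ ℓ₁ := by
      push_cast at hℓ
      linarith
    have hM2 : M * lam ≤ ℓ₂ := hM1.trans h12'
    have hℓ0 : 1 ≤ ℓ₁ := by
      have : (1 : ℝ) ≤ ℓ₁ := by nlinarith
      exact_mod_cast this
    have hlam0 : 0 ≤ lam := by linarith
    rw [pr_not_extends_add_eq]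
    refine (pr_not_extends_univ_le G hkΩ ha hka hdeg ℓ₁ ℓ₂ lam B hB0 hlam0 hkn hn hℓ0 ?_ ?_ ?_ ?_
      C₁).trans (failure_bound_le hc hlam hB)
    · refine le_trans ?_ hM1
      gcongr
      linarith
    · refine le_trans ?_ hM1
      gcongr
      linarith
    · refine le_trans ?_ hM2
      gcongr
      linarith
    · refine le_trans ?_ hM2
      gcongr
      linarith
  · have hk0 : (0 : ℝ) < k := by rw [← hkΩ]; exact_mod_cast Fintype.card_pos
    have hka' : (k : ℝ) ≤ a ^ 16 := by exact_mod_cast (not_le.1 hka).le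
    refine (pr_not_extends_le_of_available G ∅ univ (disjoint_empty_left _) C₁ (by simp) 1 ℓ
      fun v _ C₀ _ => ?_).trans ?_
    · have h1 : (univ : Finset Ω) \ (G.neighborFinset v).image C₀ ⊆
          univ.filter fun c => ∀ u ∈ ∅ ∪ (univ : Finset V), G.Adj v u → c ≠ C₀ u := by
        intro c hc
        refine mem_filter.2 ⟨mem_univ _, fun u _ huv h => ?_⟩
        exact (mem_sdiff.1 hc).2 (mem_image.2 ⟨u, by simpa using huv, h.symm⟩)
      have h2 := card_le_card h1
      have h3 := le_card_sdiff ((G.neighborFinset v).image C₀) (univ : Finset Ω)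
      have h4 := card_image_le (s := G.neighborFinset v) (f := C₀)
      rw [G.card_neighborFinset_eq_degree] at h4
      rw [card_univ, hkΩ] at h3
      have := hdeg v
      omega
    · rw [card_univ, hkΩ]
      have h1 : (1 + c) * lam ≤ ℓ / k * (1 : ℕ) := by
        rw [Nat.cast_one, mul_one, le_div_iff₀ hk0]
        have h2 : (1 + c) * lam * k ≤ (1 + c) * lam * a ^ 16 := by gcongr
        linarith
      calc _ ≤ Real.exp lam * Real.exp (-((1 + c) * lam)) := by gcongr
        _ = _ := by
          rw [← Real.exp_add]
          congr 1
          ring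

end Assembly

end PaletteSparsification

/-- **Palette-Sparsification Theorem** (Assadi–Chen–Khanna).
For every constant `c > 0` there is a constant `α > 0` such that for every `n ≥ 2` and every
`n`-vertex graph `G` with maximum degree `Δ`, if every vertex `v` independently samples a list
`L v` of `⌈α log n⌉` colors, each drawn independently and uniformly at random from
`{1, …, Δ+1}` (modeled as `Fin (Δ+1)`), then with probability at least `1 - n^{-c}` there is a
proper coloring `C` of `G` with `C v ∈ L v` for every vertex `v`.  The probability is expressed
by counting outcomes of the uniform sample space `V → Fin ⌈α log n⌉ → Fin (Δ+1)`. -/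
theorem palette_sparsification (c : ℝ) (hc : 0 < c) :
    ∃ α : ℝ, 0 < α ∧
      ∀ (n : ℕ), 2 ≤ n →
        ∀ (V : Type) [Fintype V] [DecidableEq V], Fintype.card V = n →
          ∀ (G : SimpleGraph V) [DecidableRel G.Adj],
            1 - (n : ℝ) ^ (-c) ≤
              (Nat.card {L : V → Fin ⌈α * Real.log n⌉₊ → Fin (G.maxDegree + 1) //
                  ∃ C : V → Fin (G.maxDegree + 1),
                    (∀ u v : V, G.Adj u v → C u ≠ C v) ∧
                    ∀ v : V, ∃ i, L v i = C v} : ℝ) /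
                (Nat.card (V → Fin ⌈α * Real.log n⌉₊ → Fin (G.maxDegree + 1)) : ℝ) := by
  obtain ⟨α, hα, h⟩ := PaletteSparsification.exists_list_length c hc
  refine ⟨α, hα, fun n hn V _ _ hV G _ => ?_⟩
  have hn0 : (0 : ℝ) < n := by exact_mod_cast (by omega : 0 < n)
  have : Nonempty V := Fintype.card_pos_iff.1 (by omega)
  have hlam : 1 / 2 ≤ Real.log n := by
    have h1 : Real.log 2 ≤ Real.log n := Real.log_le_log (by norm_num) (by exact_mod_cast hn)
    linarith [Real.log_two_gt_d9]
  have hfail := h (Real.log n) hlam V (Fin (G.maxDegree + 1)) G (G.maxDegree + 1)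
    ⌈α * Real.log n⌉₊ (Fintype.card_fin _)
    (fun u => Nat.add_le_add_right (G.degree_le_maxDegree u) 1)
    (by
      rw [Real.exp_log hn0, ← hV]
      exact_mod_cast G.maxDegree_lt_card_verts)
    (by rw [Real.exp_log hn0, hV]) (Nat.le_ceil _) fun _ => 0
  have hpow : Real.exp (-(c * Real.log n)) = (n : ℝ) ^ (-c) := by
    rw [Real.rpow_def_of_pos hn0]
    congr 1
    ring
  rw [PaletteSparsification.pr_not, hpow] at hfail
  rw [← PaletteSparsification.pr_eq_card]
  have hext : ∀ L : V → Fin ⌈α * Real.log n⌉₊ → Fin (G.maxDegree + 1),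
      PaletteSparsification.Extends G (fun l c => ∃ i, l i = c) ∅ (fun _ => 0) Finset.univ L →
        ∃ C : V → Fin (G.maxDegree + 1),
          (∀ u v : V, G.Adj u v → C u ≠ C v) ∧ ∀ v : V, ∃ i, L v i = C v := by
    rintro L ⟨C, -, hprop, hL⟩
    exact ⟨C, fun u v => hprop u (by simp) v (by simp), fun v => hL v (Finset.mem_univ v)⟩
  linarith [PaletteSparsification.pr_mono hext]
end

section
/- There exist absolute constants a > 0 and b > 0 such that the following holds. Let G be a simple graph with maximum degree Δ, let K ≥ 1 be an integer, and suppose each vertex u of G independently samples a list L(u) of K colors, each drawn independently and uniformly at random from {1, …, Δ+1}. Then for every vertex v of G, the probability that more than a·K² neighbors u of v satisfy L(u) ∩ L(v) ≠ ∅ is at most exp(−b·K²). -/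
open Finset in
/-- Among all lists of `K` colors, at most a fraction `K ^ 2 / n` share a color with `c`. -/
theorem card_filter_exists_eq_mul_le {K n : ℕ} (c : Fin K → Fin n) :
    #{x : Fin K → Fin n | ∃ i j, x i = c j} * n ≤ K ^ 2 * n ^ K := by
  have hfiber (i j : Fin K) : #{x : Fin K → Fin n | x i = c j} * n = n ^ K := by
    have h := Fintype.card_filter_piFinset_const_eq_of_mem (Finset.univ : Finset (Fin n)) i
      (Finset.mem_univ (c j))
    simp only [Fintype.piFinset_univ, Finset.card_univ, Fintype.card_fin] at h
    rw [h, pow_sub_one_mul i.pos.ne']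
  have hsub : ({x : Fin K → Fin n | ∃ i j, x i = c j} : Finset _) ⊆
      Finset.univ.biUnion fun p : Fin K × Fin K => {x : Fin K → Fin n | x p.1 = c p.2} := by
    intro x hx
    simpa using hx
  calc #{x : Fin K → Fin n | ∃ i j, x i = c j} * n
      ≤ (∑ p : Fin K × Fin K, #{x : Fin K → Fin n | x p.1 = c p.2}) * n :=
        Nat.mul_le_mul_right _ ((card_le_card hsub).trans card_biUnion_le)
    _ = K ^ 2 * n ^ K := by
        simp [sum_mul, hfiber, sq]

open Finset in
/-- The exponential moment of the conflict indicator of a uniformly random list with `c`. -/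
theorem sum_ite_exists_eq_exp_le {K n : ℕ} (hn : 0 < n) (c : Fin K → Fin n) :
    ∑ x : Fin K → Fin n, (if ∃ i j, x i = c j then Real.exp 1 else 1) ≤
      (n : ℝ) ^ K * Real.exp (2 * (K : ℝ) ^ 2 / n) := by
  have hn' : (0 : ℝ) < n := by exact_mod_cast hn
  have hcard : (#{x : Fin K → Fin n | ∃ i j, x i = c j} : ℝ) ≤ (K : ℝ) ^ 2 * n ^ K / n := by
    rw [le_div_iff₀ hn']
    exact_mod_cast card_filter_exists_eq_mul_le c
  have hsplit (x : Fin K → Fin n) : (if ∃ i j, x i = c j then Real.exp 1 else 1) =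
      1 + if ∃ i j, x i = c j then Real.exp 1 - 1 else 0 := by
    split_ifs <;> ring
  have hsum : ∑ x : Fin K → Fin n, (if ∃ i j, x i = c j then Real.exp 1 else 1) =
      (n : ℝ) ^ K + #{x : Fin K → Fin n | ∃ i j, x i = c j} * (Real.exp 1 - 1) := by
    simp only [hsplit, sum_add_distrib, ← sum_filter, sum_const, card_univ, nsmul_eq_mul]
    simp
  calc _ = (n : ℝ) ^ K + #{x : Fin K → Fin n | ∃ i j, x i = c j} * (Real.exp 1 - 1) := hsum
    _ ≤ (n : ℝ) ^ K + (K : ℝ) ^ 2 * n ^ K / n * 2 := by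
        have hlower := Real.add_one_le_exp (1 : ℝ)
        have hupper := Real.exp_one_lt_three
        gcongr <;> linarith
    _ = (n : ℝ) ^ K * (2 * (K : ℝ) ^ 2 / n + 1) := by ring
    _ ≤ _ := by
        gcongr
        exact Real.add_one_le_exp _

open Finset in
/-- The exponential moment of the degree of `v` in the conflict graph. -/
theorem sum_exp_conflict_degree_le {V : Type*} [Fintype V] [DecidableEq V] (G : SimpleGraph V)
    [DecidableRel G.Adj] (K : ℕ) (v : V) :
    ∑ L : V → Fin K → Fin (G.maxDegree + 1),
        Real.exp (#{u : V | G.Adj v u ∧ ∃ i j, L u i = L v j} : ℝ) ≤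
      (Fintype.card (V → Fin K → Fin (G.maxDegree + 1)) : ℝ) * Real.exp (2 * (K : ℝ) ^ 2) := by
  set n := G.maxDegree + 1
  have hn' : (0 : ℝ) < n := by positivity
  set M : ℝ := (n : ℝ) ^ K with hM
  have hM0 : 0 ≤ M := by positivity
  set E : ℝ := Real.exp (2 * (K : ℝ) ^ 2 / n) with hE
  let g (c : Fin K → Fin n) (u : V) (x : Fin K → Fin n) : ℝ :=
    if u = v then (if x = c then 1 else 0)
    else if G.Adj v u then (if ∃ i j, x i = c j then Real.exp 1 else 1) else 1
  have hg0 (c u x) : 0 ≤ g c u x := by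
    dsimp only [g]
    split_ifs <;> positivity
  have hterm (L : V → Fin K → Fin n) :
      Real.exp (#{u : V | G.Adj v u ∧ ∃ i j, L u i = L v j} : ℝ) = ∏ u, g (L v) u (L u) := by
    rw [← mul_one (#_ : ℝ), Real.exp_nat_mul, ← prod_const, prod_filter]
    refine prod_congr rfl fun u _ => ?_
    by_cases huv : u = v
    · subst huv
      simp [g]
    · simp [g, huv, ite_and]
  have hfactor (c : Fin K → Fin n) (u : V) :
      ∑ x, g c u x ≤ (if u = v then 1 else M) * (if G.Adj v u then E else 1) := by
    by_cases huv : u = v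
    · subst huv
      simp [g]
    · by_cases hadj : G.Adj v u
      · simpa only [g, huv, hadj, if_true, if_false] using
          sum_ite_exists_eq_exp_le (Nat.succ_pos _) c
      · simp [g, huv, hadj, hM]
  have hdeg : E ^ G.degree v ≤ Real.exp (2 * (K : ℝ) ^ 2) := by
    rw [hE, ← Real.exp_nat_mul]
    refine Real.exp_le_exp.2 ?_
    have hd : (G.degree v : ℝ) ≤ n := by
      exact_mod_cast (G.degree_le_maxDegree v).trans (Nat.le_succ _)
    calc (G.degree v : ℝ) * (2 * (K : ℝ) ^ 2 / n) ≤ n * (2 * (K : ℝ) ^ 2 / n) := by gcongr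
      _ = 2 * (K : ℝ) ^ 2 := by field_simp
  have hpow : M * ∏ u : V, (if u = v then 1 else M) = M ^ Fintype.card V := by
    have hv : M = ∏ u : V, (if u = v then M else 1) := by simp
    calc _ = (∏ u : V, if u = v then M else 1) * ∏ u : V, (if u = v then 1 else M) := by
          rw [← hv]
      _ = M ^ Fintype.card V := ?_
    rw [← prod_mul_distrib, ← card_univ, ← prod_const]
    exact prod_congr rfl fun u _ => by split_ifs <;> simp
  calc _ = ∑ L : V → Fin K → Fin n, ∏ u, g (L v) u (L u) := sum_congr rfl fun L _ => hterm L
    _ ≤ ∑ L : V → Fin K → Fin n, ∑ c, ∏ u, g c u (L u) :=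
        sum_le_sum fun L _ => single_le_sum (f := fun c => ∏ u, g c u (L u))
          (fun c _ => prod_nonneg fun u _ => hg0 c u (L u)) (mem_univ (L v))
    _ = ∑ c, ∏ u, ∑ x, g c u x := by
        rw [sum_comm]
        simp only [prod_univ_sum, Fintype.piFinset_univ]
    _ ≤ ∑ _c : Fin K → Fin n, ∏ u, (if u = v then 1 else M) * (if G.Adj v u then E else 1) :=
        sum_le_sum fun c _ => prod_le_prod (fun u _ => sum_nonneg fun x _ => hg0 c u x)
          fun u _ => hfactor c u
    _ = M ^ Fintype.card V * E ^ G.degree v := by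
        have hprod : ∏ u, (if G.Adj v u then E else 1) = E ^ G.degree v := by
          rw [← prod_filter, prod_const, ← G.card_neighborFinset_eq_degree,
            G.neighborFinset_eq_filter]
        rw [sum_const, prod_mul_distrib, hprod, nsmul_eq_mul, ← mul_assoc, ← hpow]
        simp [hM]
    _ ≤ _ := by
        simp only [Fintype.card_fun, Fintype.card_fin, Nat.cast_pow]
        gcongr


/-- There are absolute constants `a, b > 0` such that for every graph `G` with maximum degree
`Δ`, every `K ≥ 1` and every vertex `v`, if each vertex independently samples a list of `K`
colors, each drawn independently and uniformly at random from `{1, …, Δ+1}` (modeled by the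
uniform sample space `V → Fin K → Fin (Δ+1)`), then the probability that more than `a·K²`
neighbors `u` of `v` satisfy `L(u) ∩ L(v) ≠ ∅` is at most `exp(-b·K²)`. -/
theorem conflict_graph_degree_bound :
    ∃ a b : ℝ, 0 < a ∧ 0 < b ∧
      ∀ (V : Type) [Fintype V] [DecidableEq V]
        (G : SimpleGraph V) [DecidableRel G.Adj] (K : ℕ), 1 ≤ K →
        ∀ v : V,
          (Nat.card {L : V → Fin K → Fin (G.maxDegree + 1) //
              a * (K : ℝ) ^ 2 <
                (Nat.card {u : V // G.Adj v u ∧ ∃ i j, L u i = L v j} : ℝ)} : ℝ) /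
            (Nat.card (V → Fin K → Fin (G.maxDegree + 1)) : ℝ) ≤
            Real.exp (-b * (K : ℝ) ^ 2) := by
  classical
  refine ⟨3, 1, by norm_num, by norm_num, fun V _ _ G _ K _ v => ?_⟩
  set X : (V → Fin K → Fin (G.maxDegree + 1)) → ℝ := fun L =>
    ((Finset.univ.filter fun u : V => G.Adj v u ∧ ∃ i j, L u i = L v j).card : ℝ)
  have hcard (L : V → Fin K → Fin (G.maxDegree + 1)) :
      (Nat.card {u : V // G.Adj v u ∧ ∃ i j, L u i = L v j} : ℝ) = X L := by
    rw [Nat.card_eq_fintype_card, Fintype.card_subtype]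
  simp only [hcard]
  rw [Nat.card_eq_fintype_card, Nat.card_eq_fintype_card, Fintype.card_subtype]
  have hpos : (0 : ℝ) < Fintype.card (V → Fin K → Fin (G.maxDegree + 1)) := by
    exact_mod_cast Fintype.card_pos
  have hmarkov : ((Finset.univ.filter fun L => 3 * (K : ℝ) ^ 2 < X L).card : ℝ) *
      Real.exp (3 * (K : ℝ) ^ 2) ≤ ∑ L, Real.exp (X L) := by
    rw [← nsmul_eq_mul, ← Finset.sum_const]
    calc _ ≤ ∑ L with 3 * (K : ℝ) ^ 2 < X L, Real.exp (X L) :=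
          Finset.sum_le_sum fun L hL => Real.exp_le_exp.2 (Finset.mem_filter.1 hL).2.le
      _ ≤ _ := Finset.sum_le_sum_of_subset_of_nonneg (Finset.filter_subset _ _)
          fun L _ _ => (Real.exp_pos _).le
  have hmain := hmarkov.trans (sum_exp_conflict_degree_le G K v)
  rw [div_le_iff₀ hpos, ← mul_le_mul_iff_left₀ (Real.exp_pos (3 * (K : ℝ) ^ 2))]
  refine hmain.trans_eq ?_
  rw [mul_comm (Real.exp _), mul_assoc, ← Real.exp_add]
  ring_nf
end

section
/- Let K ≥ 1 and m ≥ 1 be integers, and let G be the disjoint union of m cliques, each on K+2 vertices (so G has n = m(K+2) vertices and maximum degree Δ = K+1). Suppose each vertex v of G independently samples a uniformly random K-element subset L(v) of {1, …, K+2}. Then the probability that there exists a proper coloring C of G with C(v) ∈ L(v) for every vertex v is at most (1 − (K+2)^{−(K+2)})^m. In particular, when K = o(log n / log log n), no proper list-coloring from the sampled lists exists with probability 1 − o(1), so sampling Θ(log n) colors per vertex in the palette-sparsification theorem is essentially optimal. -/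
/-- The disjoint union of `m` cliques, each on `K+2` vertices: vertices are pairs
`(t, i) : Fin m × Fin (K+2)` and two distinct vertices are adjacent iff they lie in the same
clique (same first coordinate). -/
def cliqueUnion (m K : ℕ) : SimpleGraph (Fin m × Fin (K + 2)) :=
  SimpleGraph.fromRel (fun u v => u.1 = v.1)

/-- Functions with some value violating `p` are the complement of the functions into `p`. -/
theorem card_exists_not_add_card_pow {ι T : Type*} [Finite ι] [Finite T] (p : T → Prop) :
    Nat.card {f : ι → T // ∃ i, ¬ p (f i)} + Nat.card {t // p t} ^ Nat.card ι =
      Nat.card T ^ Nat.card ι := by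
  classical
  have := Fintype.ofFinite ι
  have := Fintype.ofFinite T
  have hforall : Nat.card {f : ι → T // ∀ i, p (f i)} = Nat.card {t // p t} ^ Nat.card ι := by
    rw [Nat.card_congr (Equiv.subtypePiEquivPi (p := fun _ : ι => p)), Nat.card_fun]
  rw [← hforall, ← Nat.card_fun, add_comm, ← Nat.card_sum]
  refine Nat.card_congr ((Equiv.sumCongr (Equiv.refl _) (Equiv.subtypeEquivRight ?_)).trans
    (Equiv.sumCompl fun f : ι → T => ∀ i, p (f i)))
  intro f
  exact not_forall.symm

theorem card_subsets (K : ℕ) :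
    Nat.card {S : Finset (Fin (K + 2)) // S.card = K} = (K + 2).choose K := by
  rw [Nat.card_eq_fintype_card, Fintype.card_finset_len, Fintype.card_fin]

theorem card_subsets_avoiding (K : ℕ) (c : Fin (K + 2)) :
    Nat.card {S : {S : Finset (Fin (K + 2)) // S.card = K} // c ∉ S.1} = K + 1 := by
  classical
  have e : {S : {S : Finset (Fin (K + 2)) // S.card = K} // c ∉ S.1} ≃
      ↥((Finset.univ.erase c).powersetCard K) :=
    (Equiv.subtypeSubtypeEquivSubtypeInter (fun S : Finset (Fin (K + 2)) => S.card = K)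
      (fun S => c ∉ S)).trans
      (Equiv.subtypeEquivRight fun S => by
        simp [Finset.mem_powersetCard, Finset.subset_erase, and_comm])
  rw [Nat.card_congr e, Nat.card_eq_fintype_card, Fintype.card_coe, Finset.card_powersetCard,
    Finset.card_erase_of_mem (Finset.mem_univ c), Finset.card_univ, Fintype.card_fin]
  simp

/-- If the clique union is colored from the lists `L`, then every color lies in some list of
every clique. -/
theorem exists_mem_list_of_coloring {m K : ℕ}
    {L : Fin m × Fin (K + 2) → {S : Finset (Fin (K + 2)) // S.card = K}}
    {C : Fin m × Fin (K + 2) → Fin (K + 2)}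
    (hC : ∀ u v, (cliqueUnion m K).Adj u v → C u ≠ C v) (hL : ∀ v, C v ∈ (L v).1)
    (c : Fin (K + 2)) (t : Fin m) : ∃ i, c ∈ (L (t, i)).1 := by
  have hinj : Function.Injective fun i => C (t, i) := by
    intro i j hij
    by_contra hne
    refine hC (t, i) (t, j) ?_ hij
    simp [cliqueUnion, SimpleGraph.fromRel_adj, hne]
  obtain ⟨i, rfl⟩ := Finite.surjective_of_injective hinj c
  exact ⟨i, hL _⟩

theorem card_colorable_lists_le (K m : ℕ) (c : Fin (K + 2)) :
    Nat.card {L : Fin m × Fin (K + 2) → {S : Finset (Fin (K + 2)) // S.card = K} //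
        ∃ C : Fin m × Fin (K + 2) → Fin (K + 2),
          (∀ u v, (cliqueUnion m K).Adj u v → C u ≠ C v) ∧ ∀ v, C v ∈ (L v).1} ≤
      Nat.card {f : Fin (K + 2) → {S : Finset (Fin (K + 2)) // S.card = K} //
        ∃ i, ¬ c ∉ (f i).1} ^ m := by
  calc
    _ ≤ Nat.card (Fin m → {f : Fin (K + 2) → {S : Finset (Fin (K + 2)) // S.card = K} //
        ∃ i, ¬ c ∉ (f i).1}) := by
      refine Nat.card_le_card_of_injective
        (fun L t => ⟨fun i => L.1 (t, i), ?_⟩) ?_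
      · obtain ⟨C, hC, hL⟩ := L.2
        simpa using exists_mem_list_of_coloring hC hL c t
      · intro L L' h
        ext1
        funext v
        exact congrFun (congrArg Subtype.val (congrFun h v.1)) v.2
    _ = _ := by rw [Nat.card_fun, Nat.card_fin]

theorem one_div_le_avoiding_ratio (K : ℕ) :
    ((K + 2 : ℝ))⁻¹ ≤ ((K + 1 : ℕ) : ℝ) / ((K + 2).choose K : ℕ) := by
  have hpos : 0 < (K + 2).choose K := Nat.choose_pos (by omega)
  have hle : (K + 2).choose K ≤ (K + 1) * (K + 2) := by
    rw [Nat.choose_symm_add, Nat.choose_two_right]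
    exact (Nat.div_le_self _ _).trans (by simp [mul_comm])
  rw [inv_eq_one_div, div_le_div_iff₀ (by positivity) (by exact_mod_cast hpos), one_mul]
  exact_mod_cast hle

/-- **Optimality of the `O(log n)` list size.**  Let `G` be the disjoint union of `m` cliques,
each on `K+2` vertices (so `G` has `n = m(K+2)` vertices and maximum degree `Δ = K+1`).  If
each vertex independently samples a uniformly random `K`-element subset `L v` of the palette
`{1, …, K+2}`, then the probability that there is a proper coloring `C` of `G` with
`C v ∈ L v` for every `v` is at most `(1 - (K+2)^{-(K+2)})^m`. -/
theorem list_size_logn_optimal (K m : ℕ) (hK : 1 ≤ K) (hm : 1 ≤ m) :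
    (Nat.card {L : Fin m × Fin (K + 2) → {S : Finset (Fin (K + 2)) // S.card = K} //
        ∃ C : Fin m × Fin (K + 2) → Fin (K + 2),
          (∀ u v, (cliqueUnion m K).Adj u v → C u ≠ C v) ∧
          ∀ v, C v ∈ (L v).1} : ℝ) /
      (Nat.card (Fin m × Fin (K + 2) → {S : Finset (Fin (K + 2)) // S.card = K}) : ℝ) ≤
      (1 - ((K + 2 : ℝ))⁻¹ ^ (K + 2)) ^ m := by
  have hcount := card_exists_not_add_card_pow (ι := Fin (K + 2))
    (fun S : {S : Finset (Fin (K + 2)) // S.card = K} => (0 : Fin (K + 2)) ∉ S.1)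
  rw [card_subsets_avoiding, card_subsets, Nat.card_fin] at hcount
  have hle := card_colorable_lists_le K m 0
  set a := Nat.card {f : Fin (K + 2) → {S : Finset (Fin (K + 2)) // S.card = K} //
    ∃ i, ¬ (0 : Fin (K + 2)) ∉ (f i).1}
  have hN : (0 : ℝ) < ((K + 2).choose K : ℕ) := by
    exact_mod_cast Nat.choose_pos (by omega)
  have hratio : (a : ℝ) / (((K + 2).choose K : ℕ) : ℝ) ^ (K + 2) =
      1 - (((K + 1 : ℕ) : ℝ) / ((K + 2).choose K : ℕ)) ^ (K + 2) := by
    rw [div_pow, eq_sub_iff_add_eq, ← add_div, div_eq_one_iff_eq (by positivity)]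
    exact_mod_cast hcount
  rw [Nat.card_fun, card_subsets, Nat.card_prod, Nat.card_fin, Nat.card_fin, mul_comm m,
    pow_mul, Nat.cast_pow, Nat.cast_pow]
  calc
    _ ≤ (a : ℝ) ^ m / ((((K + 2).choose K : ℕ) : ℝ) ^ (K + 2)) ^ m := by
      gcongr
      exact_mod_cast hle
    _ = ((a : ℝ) / (((K + 2).choose K : ℕ) : ℝ) ^ (K + 2)) ^ m := (div_pow _ _ _).symm
    _ ≤ _ := by
      refine pow_le_pow_left₀ (by positivity) ?_ m
      rw [hratio]
      gcongr
      exact one_div_le_avoiding_ratio K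
end

section
/- Let Δ ≥ 1 and 0 ≤ k ≤ Δ be integers, and let G be the graph on Δ+1 vertices obtained from the complete graph K_{Δ+1} by removing all edges among a fixed set of k+1 vertices v₁, …, v_{k+1}. Then G has maximum degree at most Δ and admits a proper coloring with Δ+1−k colors; moreover, for any integer 1 ≤ s ≤ Δ+1−k, if each vertex of G independently samples a uniformly random s-element subset L(v) of {1, …, Δ+1−k}, then the probability that there exists a proper coloring C of G with C(v) ∈ L(v) for every vertex v is at most (Δ+1−k)·(s/(Δ+1−k))^{k+1}. Consequently, a palette-sparsification result for (Δ+1−k)-coloring requires lists of size Ω(Δ^{1−1/(k+1)}). -/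
/-- The graph on `Δ+1` vertices obtained from the complete graph `K_{Δ+1}` by removing all
edges among a fixed set `T` of vertices: two distinct vertices are adjacent iff not both of
them lie in `T`. -/
def cliqueMinusIndep (Δ : ℕ) (T : Finset (Fin (Δ + 1))) : SimpleGraph (Fin (Δ + 1)) :=
  SimpleGraph.fromRel (fun u v => ¬(u ∈ T ∧ v ∈ T))

noncomputable instance (Δ : ℕ) (T : Finset (Fin (Δ + 1))) :
    DecidableRel (cliqueMinusIndep Δ T).Adj :=
  Classical.decRel _

open Finset in
/-- A fixed element lies in an `s / |α|` fraction of the `s`-element subsets of `α`. -/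
theorem card_filter_mem_mul_card {α : Type*} [Fintype α] [DecidableEq α] (s : ℕ) (c : α) :
    #{S : {S : Finset α // S.card = s} | c ∈ S.1} * Fintype.card α =
      s * Fintype.card {S : Finset α // S.card = s} := by
  have hcompl : #{S : {S : Finset α // S.card = s} | c ∉ S.1} =
      (Fintype.card α - 1).choose s := by
    have h : ({S : {S : Finset α // S.card = s} | c ∉ S.1} : Finset _).map
        (Function.Embedding.subtype _) = powersetCard s (univ.erase c) := by
      ext S
      simp [mem_powersetCard, subset_erase, and_comm]
    rw [← card_map, h, card_powersetCard, card_erase_of_mem (mem_univ c), card_univ]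
  have hsum := card_filter_add_card_filter_not (s := (univ : Finset {S : Finset α // S.card = s}))
    (fun S => c ∈ S.1)
  rw [hcompl, card_univ, Fintype.card_finset_len] at hsum
  rw [Fintype.card_finset_len]
  obtain ⟨m, hm⟩ := Nat.exists_eq_succ_of_ne_zero (Fintype.card_pos_iff.2 ⟨c⟩).ne'
  rw [hm] at hsum ⊢
  rw [Nat.succ_sub_one] at hsum
  cases s with
  | zero => simp
  | succ r =>
    rw [Nat.choose_succ_succ, Nat.add_right_cancel_iff] at hsum
    rw [hsum, mul_comm (r + 1), ← Nat.add_one_mul_choose_eq, mul_comm]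

open Finset in
/-- The number of families whose members indexed by `T` all satisfy `p`. -/
theorem card_filter_forall_mem {ι β : Type*} [Fintype ι] [DecidableEq ι] [Fintype β]
    (T : Finset ι) (p : β → Prop) [DecidablePred p] :
    #{L : ι → β | ∀ v ∈ T, p (L v)} = #{b | p b} ^ #T * Fintype.card β ^ #Tᶜ := by
  have h : ({L : ι → β | ∀ v ∈ T, p (L v)} : Finset _) =
      Fintype.piFinset fun v => if v ∈ T then ({b | p b} : Finset β) else univ := by
    ext L
    simp only [mem_filter_univ, Fintype.mem_piFinset]
    refine forall_congr' fun v => ?_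
    by_cases hv : v ∈ T <;> simp [hv]
  rw [h, Fintype.card_piFinset, ← prod_mul_prod_compl T]
  congr 1
  · exact prod_eq_pow_card fun v hv => by simp [hv]
  · exact prod_eq_pow_card fun v hv => by simp [mem_compl.1 hv]

open Finset in
/-- Union bound: independent uniform `s`-subsets of `α` indexed by `T` have a common element with
probability at most `|α| (s / |α|) ^ |T|`. -/
theorem card_common_mem_div_le {ι α : Type*} [Fintype ι] [DecidableEq ι] [Fintype α]
    [DecidableEq α] (T : Finset ι) (s : ℕ) (hs : s ≤ Fintype.card α) :
    (#{L : ι → {S : Finset α // S.card = s} | ∃ c, ∀ v ∈ T, c ∈ (L v).1} : ℝ) /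
        Fintype.card (ι → {S : Finset α // S.card = s}) ≤
      Fintype.card α * ((s : ℝ) / Fintype.card α) ^ #T := by
  have hN : (0 : ℝ) < Fintype.card {S : Finset α // S.card = s} := by
    rw [Fintype.card_finset_len]
    exact_mod_cast Nat.choose_pos hs
  have hunion : #{L : ι → {S : Finset α // S.card = s} | ∃ c, ∀ v ∈ T, c ∈ (L v).1} ≤
      ∑ c : α, #{L : ι → {S : Finset α // S.card = s} | ∀ v ∈ T, c ∈ (L v).1} := by
    refine (card_le_card fun L hL => ?_).trans card_biUnion_le
    simpa using hL
  have hterm (c : α) : (#{L : ι → {S : Finset α // S.card = s} | ∀ v ∈ T, c ∈ (L v).1} : ℝ) =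
      ((s : ℝ) / Fintype.card α) ^ #T * Fintype.card (ι → {S : Finset α // S.card = s}) := by
    have hα : (0 : ℝ) < Fintype.card α := by exact_mod_cast Fintype.card_pos_iff.2 ⟨c⟩
    have hfrac : (#{S : {S : Finset α // S.card = s} | c ∈ S.1} : ℝ) =
        (s : ℝ) / Fintype.card α * Fintype.card {S : Finset α // S.card = s} := by
      rw [div_mul_eq_mul_div, eq_div_iff hα.ne']
      exact_mod_cast card_filter_mem_mul_card s c
    rw [card_filter_forall_mem T (fun S : {S : Finset α // S.card = s} => c ∈ S.1),
      Fintype.card_fun, ← card_add_card_compl T, pow_add]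
    push_cast
    rw [hfrac, mul_pow, mul_assoc]
  have hpos : (0 : ℝ) < Fintype.card (ι → {S : Finset α // S.card = s}) := by
    rw [Fintype.card_fun]
    push_cast
    positivity
  rw [div_le_iff₀ hpos]
  calc (#{L : ι → {S : Finset α // S.card = s} | ∃ c, ∀ v ∈ T, c ∈ (L v).1} : ℝ)
      ≤ ∑ c : α, (#{L : ι → {S : Finset α // S.card = s} | ∀ v ∈ T, c ∈ (L v).1} : ℝ) := by
        exact_mod_cast hunion
    _ = _ := by simp only [hterm, sum_const, card_univ, nsmul_eq_mul, mul_assoc]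

theorem cliqueMinusIndep_adj {Δ : ℕ} {T : Finset (Fin (Δ + 1))} {u v : Fin (Δ + 1)} :
    (cliqueMinusIndep Δ T).Adj u v ↔ u ≠ v ∧ ¬(u ∈ T ∧ v ∈ T) := by
  simp only [cliqueMinusIndep, SimpleGraph.fromRel_adj]
  tauto

theorem card_insert_compl {Δ k : ℕ} (hk : k ≤ Δ) {T : Finset (Fin (Δ + 1))}
    (hT : T.card = k + 1) {t : Fin (Δ + 1)} (ht : t ∈ T) :
    (insert t Tᶜ).card = Δ + 1 - k := by
  rw [Finset.card_insert_of_notMem (by simpa using ht), Finset.card_compl, Fintype.card_fin, hT]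
  omega

theorem exists_proper_coloring_cliqueMinusIndep {Δ k : ℕ} (hk : k ≤ Δ)
    {T : Finset (Fin (Δ + 1))} (hT : T.card = k + 1) :
    ∃ C : Fin (Δ + 1) → Fin (Δ + 1 - k),
      ∀ u v, (cliqueMinusIndep Δ T).Adj u v → C u ≠ C v := by
  obtain ⟨t, ht⟩ : T.Nonempty := Finset.card_pos.1 (by omega)
  let e := Finset.equivFinOfCardEq (card_insert_compl hk hT ht)
  refine ⟨fun v => if hv : v ∈ T then e ⟨t, by simp⟩ else e ⟨v, by simp [hv]⟩,
    fun u v huv => ?_⟩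
  obtain ⟨hne, huv⟩ := cliqueMinusIndep_adj.1 huv
  by_cases hu : u ∈ T <;> by_cases hv : v ∈ T
  · exact absurd ⟨hu, hv⟩ huv
  · simpa [hu, hv] using ne_of_mem_of_not_mem ht hv
  · simpa [hu, hv] using (ne_of_mem_of_not_mem ht hu).symm
  · simpa [hu, hv] using hne

/-- A proper coloring with `Δ + 1 - k` colors spends `Δ - k` of them outside `T`, so it is constant
on `T`. -/
theorem proper_coloring_const_on {Δ k : ℕ} (hk : k ≤ Δ) {T : Finset (Fin (Δ + 1))}
    (hT : T.card = k + 1) {C : Fin (Δ + 1) → Fin (Δ + 1 - k)}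
    (hC : ∀ u v, (cliqueMinusIndep Δ T).Adj u v → C u ≠ C v)
    {t t' : Fin (Δ + 1)} (ht : t ∈ T) (ht' : t' ∈ T) : C t = C t' := by
  have hinj : Set.InjOn C (insert t' Tᶜ : Finset (Fin (Δ + 1))) := by
    intro u hu v hv huv
    by_contra hne
    refine hC u v (cliqueMinusIndep_adj.2 ⟨hne, fun ⟨hu', hv'⟩ => hne ?_⟩) huv
    have hu : u = t' := by simpa [hu'] using hu
    have hv : v = t' := by simpa [hv'] using hv
    rw [hu, hv]
  have himage : (insert t' Tᶜ).image C = Finset.univ := by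
    rw [← Finset.card_eq_iff_eq_univ, Finset.card_image_of_injOn hinj,
      card_insert_compl hk hT ht', Fintype.card_fin]
  obtain ⟨w, hw, hwt⟩ := Finset.mem_image.1 (himage ▸ Finset.mem_univ (C t))
  rcases Finset.mem_insert.1 hw with rfl | hw
  · exact hwt.symm
  · have hw := Finset.mem_compl.1 hw
    exact absurd hwt (hC w t (cliqueMinusIndep_adj.2
      ⟨(ne_of_mem_of_not_mem ht hw).symm, fun h => hw h.1⟩))

/-- **No palette sparsification below `Δ+1` colors.**  Let `G` be `K_{Δ+1}` minus all edges
among a fixed set `T` of `k+1` vertices.  Then `G` has maximum degree at most `Δ` and admits a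
proper coloring with `Δ+1-k` colors; moreover, for any `1 ≤ s ≤ Δ+1-k`, if each vertex of `G`
independently samples a uniformly random `s`-element subset `L v` of `{1, …, Δ+1-k}`, the
probability that some proper coloring `C` of `G` satisfies `C v ∈ L v` for all `v` is at most
`(Δ+1-k) · (s/(Δ+1-k))^{k+1}`. -/
theorem smaller_palette_needs_large_lists (Δ k : ℕ) (hΔ : 1 ≤ Δ) (hk : k ≤ Δ)
    (T : Finset (Fin (Δ + 1))) (hT : T.card = k + 1)
    (s : ℕ) (hs1 : 1 ≤ s) (hs2 : s ≤ Δ + 1 - k) :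
    (cliqueMinusIndep Δ T).maxDegree ≤ Δ ∧
    (∃ C : Fin (Δ + 1) → Fin (Δ + 1 - k),
        ∀ u v, (cliqueMinusIndep Δ T).Adj u v → C u ≠ C v) ∧
    (Nat.card {L : Fin (Δ + 1) → {S : Finset (Fin (Δ + 1 - k)) // S.card = s} //
        ∃ C : Fin (Δ + 1) → Fin (Δ + 1 - k),
          (∀ u v, (cliqueMinusIndep Δ T).Adj u v → C u ≠ C v) ∧
          ∀ v, C v ∈ (L v).1} : ℝ) /
      (Nat.card (Fin (Δ + 1) → {S : Finset (Fin (Δ + 1 - k)) // S.card = s}) : ℝ) ≤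
      ((Δ + 1 - k : ℕ) : ℝ) * ((s : ℝ) / ((Δ + 1 - k : ℕ) : ℝ)) ^ (k + 1) := by
  refine ⟨?_, exists_proper_coloring_cliqueMinusIndep hk hT, ?_⟩
  · have h := (cliqueMinusIndep Δ T).maxDegree_lt_card_verts
    rw [Fintype.card_fin] at h
    exact Nat.lt_succ_iff.1 h
  · classical
    have hbound := card_common_mem_div_le (α := Fin (Δ + 1 - k)) T s (by simpa using hs2)
    rw [hT, Fintype.card_fin] at hbound
    refine le_trans ?_ hbound
    rw [Nat.card_eq_fintype_card, Nat.card_eq_fintype_card, Fintype.card_subtype]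
    gcongr with L
    rintro ⟨C, hC, hCL⟩
    obtain ⟨t, ht⟩ : T.Nonempty := Finset.card_pos.1 (by omega)
    exact ⟨C t, fun v hv => proper_coloring_const_on hk hT hC ht hv ▸ hCL v⟩
end
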